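/- Let Ω, Γ = Γ₁ ∪ … ∪ Γ_J be as described, and let u ∈ C¹(closure(Ω)) ∩ C²(Ω) be harmonic in Ω and satisfy u ≡ a_j on Γ_j for j = 1,…,J, where a₁,…,a_J are real numbers that are not all equal. Then u has only finitely many critical points z₁,…,z_K in closure(Ω); at each critical point z_k there exist c ∈ ℂ∖{0} and an integer m(z_k) ≥ 1 such that u_x − i·u_y = c·(z−z_k)^{m(z_k)} + o(|z−z_k|^{m(z_k)}) as z → z_k in closure(Ω); and the identity Σ_{z_k ∈ Ω} m(z_k) + (1/2)·Σ_{z_k ∈ Γ} m(z_k) = J − 2 holds. -/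

import Mathlib

open Complex Topology Filter Asymptotics

/-- The complex gradient `uₓ - i·u_y` of `u`, with derivatives taken within the set `S`. -/
noncomputable def complexGradWithin (u : ℂ → ℝ) (S : Set ℂ) (z : ℂ) : ℂ :=
  Complex.ofReal (fderivWithin ℝ u S z 1) -
    Complex.I * Complex.ofReal (fderivWithin ℝ u S z Complex.I)


section
open Complex Topology Filter Asymptotics

/-! ### Winding of (anti)periodic nonvanishing curves -/

/-- `c : ℝ → ℂ` has a continuous logarithm that gains `2πiw` over one period. -/
def HasWind (c : ℝ → ℂ) (w : ℝ) : Prop :=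
  ∃ L : ℝ → ℂ, Continuous L ∧ (∀ t, Complex.exp (L t) = c t) ∧
    ∀ t, L (t + 1) = L t + 2 * Real.pi * w * Complex.I

theorem const_of_exp_const {X : Type*} [TopologicalSpace X] [PreconnectedSpace X] {f : X → ℂ}
    (hf : Continuous f) {k : ℂ} (hk : ∀ x, Complex.exp (f x) = k) (x y : X) : f x = f y := by
  have h2 : ∀ z, ∃ n : ℤ, f z = f x + n * (2 * Real.pi * Complex.I) := by
    intro z
    exact Complex.exp_eq_exp_iff_exists_int.1 ((hk z).trans (hk x).symm)
  choose n hn using h2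
  have hpi : (2 * Real.pi : ℝ) ≠ 0 := by positivity
  have hre : ∀ z, ((f z - f x).im / (2 * Real.pi)) = (n z : ℝ) := by
    intro z
    rw [hn z]
    simp
  have hcont : Continuous (fun z => ((n z : ℤ) : ℝ)) := by
    have : (fun z => ((n z : ℤ) : ℝ)) = fun z => ((f z - f x).im / (2 * Real.pi)) := by
      funext z; rw [hre]
    rw [this]; fun_prop
  have hcont' : Continuous n := Int.isClosedEmbedding_coe_real.isEmbedding.continuous_iff.2 hcont
  have h1 : n x = n y := PreconnectedSpace.constant inferInstance hcont'
  rw [hn x, hn y, h1]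

theorem HasWind.mul {c d : ℝ → ℂ} {w v : ℝ} (hc : HasWind c w) (hd : HasWind d v) :
    HasWind (fun t => c t * d t) (w + v) := by
  obtain ⟨L, h1, h2, h3⟩ := hc
  obtain ⟨M, k1, k2, k3⟩ := hd
  refine ⟨fun t => L t + M t, by fun_prop, fun t => by rw [Complex.exp_add, h2, k2], fun t => ?_⟩
  simp only [h3, k3]; push_cast; ring

theorem hasWind_one : HasWind (fun _ => 1) 0 :=
  ⟨fun _ => 0, by fun_prop, by simp, by simp⟩

theorem hasWind_const {k : ℂ} (hk : k ≠ 0) : HasWind (fun _ => k) 0 :=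
  ⟨fun _ => Complex.log k, by fun_prop, fun _ => Complex.exp_log hk, by simp⟩

theorem HasWind.pow {c : ℝ → ℂ} {w : ℝ} (hc : HasWind c w) (n : ℕ) :
    HasWind (fun t => c t ^ n) (n * w) := by
  induction n with
  | zero => simpa using hasWind_one
  | succ n ih =>
    have h := ih.mul hc
    have e : ((n + 1 : ℕ) : ℝ) * w = n * w + w := by push_cast; ring
    rw [e]
    simpa only [pow_succ] using h

theorem HasWind.prod {ι : Type*} (s : Finset ι) {c : ι → ℝ → ℂ} {w : ι → ℝ}
    (hc : ∀ i ∈ s, HasWind (c i) (w i)) :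
    HasWind (fun t => ∏ i ∈ s, c i t) (∑ i ∈ s, w i) := by
  classical
  induction s using Finset.induction_on with
  | empty => simpa using hasWind_one
  | insert i s hi ih =>
    simp only [Finset.prod_insert hi, Finset.sum_insert hi]
    exact (hc i (by simp)).mul (ih fun j hj => hc j (by simp [hj]))

theorem HasWind.unique {c : ℝ → ℂ} {w v : ℝ} (hc : HasWind c w) (hd : HasWind c v) : w = v := by
  obtain ⟨L, h1, h2, h3⟩ := hc
  obtain ⟨M, k1, k2, k3⟩ := hd
  have h := const_of_exp_const (f := fun t => L t - M t) (by fun_prop) (k := 1)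
    (fun t => by
      rw [Complex.exp_sub, h2, k2, div_self]
      rw [← h2]; exact Complex.exp_ne_zero _) (0 + 1) 0
  simp only [h3, k3] at h
  have h4 : (2 * Real.pi * Complex.I : ℂ) * (w - v) = 0 := by linear_combination h
  have h5 : (2 * Real.pi * Complex.I : ℂ) ≠ 0 := Complex.two_pi_I_ne_zero
  have h6 := (mul_eq_zero.1 h4).resolve_left h5
  have : (w : ℂ) = v := by linear_combination h6
  exact_mod_cast this

theorem HasWind.ne_zero {c : ℝ → ℂ} {w : ℝ} (hc : HasWind c w) (t : ℝ) : c t ≠ 0 := by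
  obtain ⟨L, h1, h2, h3⟩ := hc
  rw [← h2]; exact Complex.exp_ne_zero _

theorem HasWind.continuous {c : ℝ → ℂ} {w : ℝ} (hc : HasWind c w) : Continuous c := by
  obtain ⟨L, h1, h2, h3⟩ := hc
  have : c = fun t => Complex.exp (L t) := by funext t; rw [h2]
  rw [this]; fun_prop

theorem hasWind_of_slit {c : ℝ → ℂ} (hc : Continuous c) (hp : ∀ t, c (t + 1) = c t)
    (hs : ∀ t, c t ∈ Complex.slitPlane) : HasWind c 0 := by
  refine ⟨fun t => Complex.log (c t), hc.clog hs, fun t => Complex.exp_log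
    (Complex.slitPlane_ne_zero (hs t)), fun t => by simp [hp]⟩

theorem HasWind.close {c d : ℝ → ℂ} {w : ℝ} (hc : HasWind c w) (hd : Continuous d)
    (hcp : ∀ t, c (t + 1) = c t) (hdp : ∀ t, d (t + 1) = d t)
    (h : ∀ t, ‖d t - c t‖ < ‖c t‖) : HasWind d w := by
  have h1 : HasWind (fun t => d t / c t) 0 := by
    have hct : Continuous fun t => d t / c t := hd.div hc.continuous hc.ne_zero
    refine hasWind_of_slit hct (fun t => by rw [hcp, hdp]) (fun t => ?_)
    have h0 := hc.ne_zero t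
    have : ‖d t / c t - 1‖ < 1 := by
      rw [div_sub_one h0, norm_div, div_lt_one (norm_pos_iff.2 h0)]
      exact h t
    left
    have h3 := (Complex.abs_re_le_norm (d t / c t - 1)).trans_lt this
    rw [abs_lt] at h3
    simp at h3
    linarith [h3.1]
  have h2 := hc.mul h1
  have e : (fun t => c t * (d t / c t)) = d := by
    funext t
    rw [mul_div_cancel₀ _ (hc.ne_zero t)]
  rwa [e, add_zero] at h2

theorem hasWind_real {p : ℝ → ℝ} (hp : Continuous p) (h0 : ∀ t, p t ≠ 0)
    (hper : ∀ t, |p (t + 1)| = |p t|) : HasWind (fun t => (p t : ℂ)) 0 := by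
  rcases lt_or_gt_of_ne (h0 0) with hneg | hpos
  · have hall : ∀ t, p t < 0 := by
      intro t
      by_contra hcon
      push Not at hcon
      have := mem_range_of_exists_le_of_exists_ge hp ⟨0, hneg.le⟩ ⟨t, hcon⟩
      obtain ⟨s, hs⟩ := this
      exact h0 s hs
    refine ⟨fun t => (Real.log (-p t) : ℂ) + Real.pi * Complex.I, ?_, ?_, ?_⟩
    · have : Continuous fun t => Real.log (-p t) :=
        Continuous.log (by fun_prop : Continuous fun t => -p t) (fun t => (neg_pos.2 (hall t)).ne')
      fun_prop
    · intro t
      rw [Complex.exp_add, Complex.exp_pi_mul_I, ← Complex.ofReal_exp,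
        Real.exp_log (by linarith [hall t])]
      simp
    · intro t
      have := hper t
      rw [abs_of_neg (hall _), abs_of_neg (hall _)] at this
      simp [this]
  · have hall : ∀ t, 0 < p t := by
      intro t
      by_contra hcon
      push Not at hcon
      have := mem_range_of_exists_le_of_exists_ge hp ⟨t, hcon⟩ ⟨0, hpos.le⟩
      obtain ⟨s, hs⟩ := this
      exact h0 s hs
    refine ⟨fun t => (Real.log (p t) : ℂ), ?_, ?_, ?_⟩
    · have : Continuous fun t => Real.log (p t) := hp.log h0
      fun_prop
    · intro t
      rw [← Complex.ofReal_exp, Real.exp_log (hall t)]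
    · intro t
      have := hper t
      rw [abs_of_pos (hall _), abs_of_pos (hall _)] at this
      simp [this]

theorem exists_lift {X : Type*} [TopologicalSpace X] [LocallyPathConnectedSpace X]
    [SimplyConnectedSpace X] {c : X → ℂ} (hc : Continuous c) (h0 : ∀ t, c t ≠ 0) :
    ∃ L : X → ℂ, Continuous L ∧ ∀ t, Complex.exp (L t) = c t := by
  obtain ⟨f, hf, he⟩ := Complex.exists_continuousOn_eqOn_exp_comp (X := X) (U := Set.univ)
    (g := c) ((Homeomorph.Set.univ X).toHomotopyEquiv.simplyConnectedSpace_iff.2 inferInstance) isOpen_univ hc.continuousOn (by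
      rintro ⟨x, -, hx⟩; exact h0 x hx)
  refine ⟨f, continuousOn_univ.1 hf, fun t => he (Set.mem_univ t)⟩

theorem exists_hasWind {c : ℝ → ℂ} (hc : Continuous c) (h0 : ∀ t, c t ≠ 0)
    (hp : ∀ t, c (t + 1) = c t) : ∃ w, HasWind c w := by
  obtain ⟨L, hL, he⟩ := exists_lift hc h0
  have h := const_of_exp_const (f := fun t => L (t + 1) - L t) (by fun_prop) (k := 1)
    (fun t => by rw [Complex.exp_sub, he, he, hp, div_self (h0 t)])
  have h1 : Complex.exp (L (0 + 1) - L 0) = 1 := by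
    rw [Complex.exp_sub, he, he, hp, div_self (h0 0)]
  obtain ⟨n, hn⟩ := Complex.exp_eq_one_iff.1 h1
  refine ⟨n, L, hL, he, fun t => ?_⟩
  have h2 := h t 0
  rw [hn] at h2
  push_cast
  linear_combination h2

end


section
open Complex Topology Filter Asymptotics

/-! ### The secant function of a simple closed curve and Hopf's Umlaufsatz -/

/-- Regular simple closed `C¹` curve of period one. -/
structure IsSCC (γ : ℝ → ℂ) : Prop where
  per : ∀ t, γ (t + 1) = γ t
  c1 : ContDiff ℝ 1 γ
  inj : Set.InjOn γ (Set.Ico (0 : ℝ) 1)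
  reg : ∀ t, deriv γ t ≠ 0

namespace IsSCC

theorem continuous {γ : ℝ → ℂ} (h : IsSCC γ) : Continuous γ := h.c1.continuous
theorem contDeriv {γ : ℝ → ℂ} (h : IsSCC γ) : Continuous (deriv γ) := h.c1.continuous_deriv le_rfl
theorem hasDerivAt {γ : ℝ → ℂ} (h : IsSCC γ) (t : ℝ) : HasDerivAt γ (deriv γ t) t :=
  (h.c1.differentiable (by norm_num) t).hasDerivAt
theorem periodic {γ : ℝ → ℂ} (h : IsSCC γ) : Function.Periodic γ 1 := h.per
theorem perDeriv {γ : ℝ → ℂ} (h : IsSCC γ) (t : ℝ) : deriv γ (t + 1) = deriv γ t := by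
  have h1 : HasDerivAt (fun s => γ (s + 1)) (deriv γ (t + 1)) t :=
    (h.hasDerivAt (t + 1)).comp_add_const t 1
  have h2 : (fun s => γ (s + 1)) = γ := funext h.per
  rw [h2] at h1
  exact h1.deriv.symm
theorem perDeriv' {γ : ℝ → ℂ} (h : IsSCC γ) : Function.Periodic (deriv γ) 1 := h.perDeriv

theorem sub_int {γ : ℝ → ℂ} (h : IsSCC γ) (t : ℝ) (n : ℤ) : γ (t - n) = γ t := by
  have := h.periodic.sub_int_mul_eq (x := t) n
  simpa using this
theorem derivSub_int {γ : ℝ → ℂ} (h : IsSCC γ) (t : ℝ) (n : ℤ) : deriv γ (t - n) = deriv γ t := by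
  have := h.perDeriv'.sub_int_mul_eq (x := t) n
  simpa using this

theorem eq_imp {γ : ℝ → ℂ} (h : IsSCC γ) {s t : ℝ} (hst : γ s = γ t) : ∃ n : ℤ, s - t = n := by
  have h1 : γ (Int.fract s) = γ (Int.fract t) := by
    rw [Int.fract, Int.fract, h.sub_int, h.sub_int, hst]
  have h2 := h.inj ⟨Int.fract_nonneg s, Int.fract_lt_one s⟩
    ⟨Int.fract_nonneg t, Int.fract_lt_one t⟩ h1
  refine ⟨⌊s⌋ - ⌊t⌋, ?_⟩
  rw [Int.fract, Int.fract] at h2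
  push_cast
  linarith

end IsSCC

theorem sin_pi_eq_zero {x : ℝ} : Real.sin (Real.pi * x) = 0 ↔ ∃ n : ℤ, x = n := by
  rw [Real.sin_eq_zero_iff]
  constructor
  · rintro ⟨n, hn⟩
    refine ⟨n, ?_⟩
    have := Real.pi_pos.ne'
    apply mul_left_cancel₀ this
    linarith
  · rintro ⟨n, hn⟩
    exact ⟨n, by rw [hn]; ring⟩

theorem hasWind_ellipse {s : ℝ} (hs : s ^ 2 = 1) {k : ℝ} (hk : 0 < k) (a : ℝ) :
    HasWind (fun t => (Real.sin (Real.pi * (t - a)) - s * (k : ℝ) * Complex.I *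
      Real.cos (Real.pi * (t - a)) : ℂ)) (s / 2) := by
  have hsC : (s : ℂ) ^ 2 = 1 := by exact_mod_cast hs
  have hs0 : (s : ℂ) ≠ 0 := by intro h0; rw [h0] at hsC; norm_num at hsC
  have habs : |s| = 1 := by
    rw [← abs_one (α := ℝ)]; exact (sq_eq_sq_iff_abs_eq_abs _ _).1 (by rw [hs]; norm_num)
  have hk1 : ((1 + k : ℝ) : ℂ) ≠ 0 := by exact_mod_cast (by linarith : (1 + k) ≠ 0)
  have e1 : HasWind (fun t : ℝ => Complex.exp (s * (Real.pi * (t - a) : ℝ) * Complex.I)) (s / 2) :=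
    ⟨fun t : ℝ => (s * (Real.pi * (t - a) : ℝ) * Complex.I), by fun_prop, fun _ => rfl, fun t => by
      push_cast; ring⟩
  have e2 : HasWind (fun _ : ℝ => (-(Complex.I * s * (1 + k : ℝ) / 2) : ℂ)) 0 := by
    apply hasWind_const
    simp only [ne_eq, neg_eq_zero, div_eq_zero_iff, mul_eq_zero, Complex.I_ne_zero, hs0, hk1]
    norm_num
  set q : ℝ := (1 - k) / (1 + k) with hq
  have hq1 : |q| < 1 := by
    rw [hq, abs_div, abs_of_pos (by linarith : 0 < 1 + k), div_lt_one (by linarith), abs_lt]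
    constructor <;> linarith
  have e3 : HasWind (fun t : ℝ => 1 - q * Complex.exp (-2 * (s * (Real.pi * (t - a) : ℝ) * Complex.I))) 0 := by
    apply hasWind_of_slit
    · fun_prop
    · intro t
      have : -2 * (s * (Real.pi * (t + 1 - a) : ℝ) * Complex.I) =
        -2 * (s * (Real.pi * (t - a) : ℝ) * Complex.I) + -s * (2 * Real.pi * Complex.I) := by
        push_cast; ring
      rw [this, Complex.exp_add]
      have h1 : Complex.exp (-s * (2 * Real.pi * Complex.I)) = 1 := by
        have : s = 1 ∨ s = -1 := sq_eq_one_iff.1 hs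
        rcases this with rfl | rfl
        · rw [Complex.exp_eq_one_iff]; exact ⟨-1, by push_cast; ring⟩
        · rw [Complex.exp_eq_one_iff]; exact ⟨1, by push_cast; ring⟩
      rw [h1, mul_one]
    · intro t
      left
      have h1 : ‖(q : ℂ) * Complex.exp (-2 * (s * (Real.pi * (t - a) : ℝ) * Complex.I))‖ = |q| := by
        have : -2 * (s * (Real.pi * (t - a) : ℝ) * Complex.I) = ((-2 * (s * (Real.pi * (t - a))) : ℝ) : ℂ) * Complex.I := by
          push_cast; ring
        rw [norm_mul, this, Complex.norm_exp_ofReal_mul_I, mul_one, Complex.norm_real, Real.norm_eq_abs]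
      have h2 := Complex.abs_re_le_norm ((q : ℂ) * Complex.exp (-2 * (s * (Real.pi * (t - a) : ℝ) * Complex.I)))
      rw [h1] at h2
      have := (abs_le.1 h2).2
      rw [Complex.sub_re, Complex.one_re]
      linarith
  have e4 := (e2.mul e1).mul e3
  rw [zero_add, add_zero] at e4
  convert e4 using 2 with t
  set θ := Real.pi * (t - a)
  have hE : Complex.exp (s * (θ : ℝ) * Complex.I) = Real.cos θ + s * Real.sin θ * Complex.I := by
    have : s = 1 ∨ s = -1 := sq_eq_one_iff.1 hs
    rcases this with rfl | rfl
    · rw [Complex.ofReal_one, one_mul, Complex.exp_mul_I]; push_cast; ring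
    · rw [Complex.ofReal_neg, Complex.ofReal_one, neg_one_mul, Complex.exp_mul_I,
        Complex.cos_neg, Complex.sin_neg]; push_cast; ring
  have hE2 : Complex.exp (s * (θ : ℝ) * Complex.I) * Complex.exp (-2 * (s * (θ : ℝ) * Complex.I))
      = Real.cos θ - s * Real.sin θ * Complex.I := by
    rw [← Complex.exp_add]
    have : s = 1 ∨ s = -1 := sq_eq_one_iff.1 hs
    have e : (s * (θ : ℝ) * Complex.I) + (-2 * (s * (θ : ℝ) * Complex.I)) = (-s * θ : ℝ) * Complex.I := by
      push_cast; ring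
    rw [e]
    rcases this with rfl | rfl
    · rw [Complex.exp_mul_I]; push_cast; rw [neg_one_mul, Complex.cos_neg, Complex.sin_neg]; ring
    · rw [Complex.exp_mul_I]; push_cast; rw [neg_neg, one_mul]; ring
  have hqk : (q : ℂ) * (1 + k : ℝ) = 1 - k := by
    rw [hq]; push_cast at hk1 ⊢; field_simp
  rw [mul_sub, mul_one, mul_assoc _ (Complex.exp _) (_ * _), mul_left_comm (Complex.exp _), hE2, hE]
  push_cast at hqk ⊢
  linear_combination (Complex.sin θ * Complex.I ^ 2) * hsC + Complex.sin θ * Complex.I_sq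
    - (Complex.I * s / 2) * (Complex.cos θ - s * Complex.sin θ * Complex.I) * hqk

/-- The secant function. -/
noncomputable def secT (γ : ℝ → ℂ) (a t : ℝ) : ℂ :=
  if Real.sin (Real.pi * (t - a)) = 0 then deriv γ a / (Real.pi * Real.cos (Real.pi * (t - a)))
  else (γ t - γ a) / Real.sin (Real.pi * (t - a))

/-- mean of the derivative over a segment -/
noncomputable def secq (γ : ℝ → ℂ) (a t : ℝ) : ℂ :=
  ∫ τ in (0 : ℝ)..1, deriv γ (a + τ * (t - a))

namespace IsSCC

theorem secq_cont {γ : ℝ → ℂ} (h : IsSCC γ) : Continuous fun p : ℝ × ℝ => secq γ p.1 p.2 := by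
  unfold secq
  have hd := h.contDeriv
  apply intervalIntegral.continuous_parametric_intervalIntegral_of_continuous'
  fun_prop

theorem secq_mul {γ : ℝ → ℂ} (h : IsSCC γ) (a t : ℝ) : secq γ a t * (t - a : ℝ) = γ t - γ a := by
  have h1 : ∀ τ ∈ Set.uIcc (0 : ℝ) 1,
      HasDerivAt (fun τ : ℝ => γ (a + τ * (t - a))) (deriv γ (a + τ * (t - a)) * (t - a : ℝ)) τ := by
    intro τ _
    have h2 : HasDerivAt (fun τ : ℝ => a + τ * (t - a)) (t - a) τ := by
      simpa using ((hasDerivAt_id τ).mul_const (t - a)).const_add a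
    have h3 := (h.hasDerivAt (a + τ * (t - a))).scomp τ h2
    rw [mul_comm, ← Complex.real_smul]
    exact h3
  have hd := h.contDeriv
  have h2 := intervalIntegral.integral_eq_sub_of_hasDerivAt h1
    (Continuous.intervalIntegrable (by fun_prop) _ _)
  rw [intervalIntegral.integral_mul_const] at h2
  unfold secq
  rw [h2]
  simp

theorem secT_ne {γ : ℝ → ℂ} (h : IsSCC γ) (a t : ℝ) : secT γ a t ≠ 0 := by
  unfold secT
  split_ifs with hs
  · apply div_ne_zero (h.reg a)
    apply mul_ne_zero (by exact_mod_cast Real.pi_pos.ne')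
    have := Real.sin_sq_add_cos_sq (Real.pi * (t - a))
    rw [hs] at this
    intro h0
    have h0' : Real.cos (Real.pi * (t - a)) = 0 := by exact_mod_cast h0
    rw [h0'] at this
    norm_num at this
  · apply div_ne_zero _ (by exact_mod_cast hs)
    intro h0
    exact hs (sin_pi_eq_zero.2 (h.eq_imp (sub_eq_zero.1 h0)))

theorem secT_mul_sin {γ : ℝ → ℂ} (h : IsSCC γ) (a t : ℝ) :
    secT γ a t * Real.sin (Real.pi * (t - a)) = γ t - γ a := by
  unfold secT
  split_ifs with hs
  · obtain ⟨n, hn⟩ := sin_pi_eq_zero.1 hs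
    have : t - n = a := by linarith
    rw [hs, ← h.sub_int t n, this]
    simp
  · rw [div_mul_cancel₀]
    exact_mod_cast hs

theorem secT_diag {γ : ℝ → ℂ} (_h : IsSCC γ) (a : ℝ) : secT γ a a = deriv γ a / Real.pi := by
  simp [secT]

theorem secT_add_one_right {γ : ℝ → ℂ} (h : IsSCC γ) (a t : ℝ) : secT γ a (t + 1) = -secT γ a t := by
  have e : Real.pi * (t + 1 - a) = Real.pi * (t - a) + Real.pi := by ring
  unfold secT
  rw [e, Real.sin_add_pi, Real.cos_add_pi, h.per]
  simp only [neg_eq_zero]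
  split_ifs
  · push_cast; rw [mul_neg, div_neg]
  · push_cast; rw [div_neg]

theorem secT_symm {γ : ℝ → ℂ} (h : IsSCC γ) (a t : ℝ) : secT γ a t = secT γ t a := by
  have e : Real.pi * (t - a) = -(Real.pi * (a - t)) := by ring
  unfold secT
  rw [e, Real.sin_neg, Real.cos_neg]
  simp only [neg_eq_zero]
  split_ifs with hs
  · obtain ⟨n, hn⟩ := sin_pi_eq_zero.1 hs
    have : a - n = t := by linarith
    rw [← this, h.derivSub_int]
  · push_cast
    rw [div_neg, ← neg_div, neg_sub]

theorem secT_local {γ : ℝ → ℂ} (h : IsSCC γ) (n : ℤ) {a t : ℝ} (hn : |t - a - n| < 1) :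
    secT γ a t = Real.cos (n * Real.pi) * secq γ a (t - n)
      / (Real.pi * Real.sinc (Real.pi * (t - n - a))) := by
  have e : Real.pi * (t - a) = Real.pi * (t - n - a) + n * Real.pi := by ring
  have hc : Real.cos (n * Real.pi) ^ 2 = 1 := by
    have := Real.sin_sq_add_cos_sq (n * Real.pi)
    rw [Real.sin_int_mul_pi] at this
    linarith
  have hc' : (Real.cos (n * Real.pi) : ℂ) ^ 2 = 1 := by exact_mod_cast hc
  have hc0 : (Real.cos (n * Real.pi) : ℂ) ≠ 0 := by
    intro h0; rw [h0] at hc'; norm_num at hc'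
  have hpi : (Real.pi : ℂ) ≠ 0 := by exact_mod_cast Real.pi_pos.ne'
  have hsin : Real.sin (Real.pi * (t - a)) = Real.cos (n * Real.pi) * Real.sin (Real.pi * (t - n - a)) := by
    rw [e, Real.sin_add, Real.sin_int_mul_pi]; ring
  by_cases hs : t - n - a = 0
  · have hta : t - n = a := by linarith
    have h0 : Real.sin (Real.pi * (t - a)) = 0 := by rw [hsin, hs]; simp
    have hq : secq γ a a = deriv γ a := by simp [secq]
    rw [hta, sub_self, mul_zero, Real.sinc_zero, hq, secT, if_pos h0]
    have : Real.cos (Real.pi * (t - a)) = Real.cos (n * Real.pi) := by rw [e, hs]; simp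
    rw [this]
    rw [Complex.ofReal_one, mul_one, div_eq_div_iff (mul_ne_zero hpi hc0) hpi]
    linear_combination -(deriv γ a * Real.pi) * hc'
  · have hs2 : Real.sin (Real.pi * (t - n - a)) ≠ 0 := by
      intro h0
      obtain ⟨k, hk⟩ := sin_pi_eq_zero.1 h0
      have h1 : |(k : ℝ)| < 1 := by rw [← hk]; convert hn using 2; ring
      have h2 : k = 0 := by
        have : |k| < 1 := by exact_mod_cast h1
        exact Int.abs_lt_one_iff.1 this
      rw [h2] at hk
      exact hs (by simpa using hk)
    have h1 := h.secT_mul_sin a t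
    rw [hsin, ← h.sub_int t n, ← h.secq_mul] at h1
    rw [Real.sinc_of_ne_zero (by
      intro h0; rw [h0] at hs2; simp at hs2)]
    have hs3 : (Real.sin (Real.pi * (t - n - a)) : ℂ) ≠ 0 := by exact_mod_cast hs2
    have hs4 : ((t - n - a : ℝ) : ℂ) ≠ 0 := by exact_mod_cast hs
    have h5 : secT γ a t * (Real.sin (Real.pi * (t - n - a)) : ℂ)
      = Real.cos (n * Real.pi) * secq γ a (t - n) * (t - n - a : ℝ) := by
      have : secT γ a t * (Real.sin (Real.pi * (t - n - a)) : ℂ)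
        = Real.cos (n * Real.pi) * (secT γ a t * (Real.cos (n * Real.pi) * Real.sin (Real.pi * (t - n - a)) : ℝ)) := by
        rw [Complex.ofReal_mul]
        linear_combination -(secT γ a t * (Real.sin (Real.pi * (t - n - a)) : ℂ)) * hc'
      rw [this, h1]; ring
    rw [eq_div_iff]
    · rw [Complex.ofReal_div, Complex.ofReal_mul, ← mul_div_assoc, mul_div_mul_left _ _ hpi,
        ← mul_div_assoc, div_eq_iff hs4]
      linear_combination h5
    · rw [Complex.ofReal_div, Complex.ofReal_mul, ← mul_div_assoc, mul_div_mul_left _ _ hpi]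
      exact div_ne_zero hs3 hs4

theorem secT_cont {γ : ℝ → ℂ} (h : IsSCC γ) : Continuous fun p : ℝ × ℝ => secT γ p.1 p.2 := by
  rw [continuous_iff_continuousAt]
  rintro ⟨a, t⟩
  set n := round (t - a) with hn
  have h1 : |t - a - n| < 1 := by
    have := abs_sub_round (t - a)
    rw [← hn] at this
    linarith
  have h2 : ∀ᶠ p : ℝ × ℝ in 𝓝 (a, t), |p.2 - p.1 - n| < 1 := by
    have : Continuous fun p : ℝ × ℝ => |p.2 - p.1 - n| := by fun_prop
    exact this.continuousAt.eventually_lt continuousAt_const h1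
  have hq := h.secq_cont
  have h3 : ContinuousAt (fun p : ℝ × ℝ => (Real.cos (n * Real.pi) * secq γ p.1 (p.2 - n)
      / (Real.pi * Real.sinc (Real.pi * (p.2 - n - p.1))) : ℂ)) (a, t) := by
    have hq2 : Continuous fun p : ℝ × ℝ => secq γ p.1 (p.2 - n) :=
      hq.comp (by fun_prop : Continuous fun p : ℝ × ℝ => (p.1, p.2 - (n : ℝ)))
    have hs : Continuous fun p : ℝ × ℝ => Real.sinc (Real.pi * (p.2 - n - p.1)) :=
      Real.continuous_sinc.comp (by fun_prop)
    refine ContinuousAt.div (by fun_prop) (by fun_prop) ?_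
    refine mul_ne_zero (by exact_mod_cast Real.pi_pos.ne') ?_
    have hx : |t - n - a| < 1 := by convert h1 using 2; ring
    have : Real.sinc (Real.pi * (t - n - a)) ≠ 0 := by
      by_cases h0 : t - n - a = 0
      · rw [h0]; simp
      · rw [Real.sinc_of_ne_zero (mul_ne_zero Real.pi_pos.ne' h0)]
        refine div_ne_zero ?_ (mul_ne_zero Real.pi_pos.ne' h0)
        intro h5
        obtain ⟨k, hk⟩ := sin_pi_eq_zero.1 h5
        rw [hk] at hx h0
        have h6 : |k| < 1 := by exact_mod_cast hx
        rw [Int.abs_lt_one_iff.1 h6] at h0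
        simp at h0
    exact_mod_cast this
  refine h3.congr ?_
  filter_upwards [h2] with p hp
  rw [h.secT_local n hp]

theorem hopf {γ : ℝ → ℂ} (h : IsSCC γ) :
    ∃ τ : ℝ, HasWind (deriv γ) τ ∧ ∀ a, HasWind (secT γ a) (τ / 2) := by
  obtain ⟨L, hL, he⟩ := exists_lift (X := ℝ × ℝ) h.secT_cont (fun p => h.secT_ne p.1 p.2)
  have hneg : ∀ p : ℝ × ℝ, Complex.exp (L (p.1, p.2 + 1) - L p) = -1 := by
    intro p
    rw [Complex.exp_sub, he, he, h.secT_add_one_right, neg_div, div_self (h.secT_ne _ _)]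
  have h1 := const_of_exp_const (f := fun p : ℝ × ℝ => L (p.1, p.2 + 1) - L p) (by fun_prop) hneg
  have h2 := const_of_exp_const (f := fun p : ℝ × ℝ => L (p.2, p.1) - L p) (by fun_prop) (k := 1)
    (fun p => by
      rw [Complex.exp_sub, he, he, h.secT_symm, div_self (h.secT_ne _ _)])
  have hsym : ∀ a t, L (t, a) = L (a, t) := by
    intro a t
    have := h2 (a, t) (0, 0)
    simp only [sub_self] at this
    exact sub_eq_zero.1 this
  obtain ⟨k, hk⟩ : ∃ k : ℝ, L (0, 0 + 1) - L (0, 0) = Real.pi * k * Complex.I := by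
    have h3 : Complex.exp (L (0, 0 + 1) - L (0, 0)) = Complex.exp (Real.pi * Complex.I) := by
      rw [Complex.exp_pi_mul_I]; exact hneg (0, 0)
    obtain ⟨n, hn⟩ := Complex.exp_eq_exp_iff_exists_int.1 h3
    refine ⟨1 + 2 * n, ?_⟩
    rw [hn]; push_cast; ring
  have h4 : ∀ a t, L (a, t + 1) = L (a, t) + Real.pi * k * Complex.I := by
    intro a t
    have := h1 (a, t) (0, 0)
    rw [hk] at this
    linear_combination this
  refine ⟨k, ⟨fun a => L (a, a) + Real.log Real.pi, by fun_prop, ?_, ?_⟩, fun a =>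
    ⟨fun t => L (a, t), by fun_prop, fun t => he (a, t), fun t => ?_⟩⟩
  · intro a
    rw [Complex.exp_add, he, h.secT_diag, ← Complex.ofReal_exp, Real.exp_log Real.pi_pos,
      div_mul_cancel₀]
    exact_mod_cast Real.pi_pos.ne'
  · intro a
    show L (a + 1, a + 1) + _ = L (a, a) + _ + _
    rw [h4, hsym, h4]; ring
  · show L (a, t + 1) = L (a, t) + _
    rw [h4]; push_cast; ring

theorem jump {γ : ℝ → ℂ} (h : IsSCC γ) {τ : ℝ} (a : ℝ) (hT : HasWind (secT γ a) (τ / 2)) :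
    ∃ ε > (0 : ℝ), ∀ s : ℝ, (s = 1 ∨ s = -1) → ∀ κ : ℝ, 0 < κ → κ < ε →
      HasWind (fun t => γ t - (γ a + s * κ * Complex.I * deriv γ a)) (τ / 2 + s / 2) := by
  have hTc : Continuous (secT γ a) := hT.continuous
  set D : ℝ → ℝ := fun t => ‖(Real.pi * Real.cos (Real.pi * (t - a)) : ℝ) * secT γ a t - deriv γ a‖
    with hD
  have hDc : Continuous D := by rw [hD]; fun_prop
  have hTn : Continuous fun t => ‖secT γ a t‖ := hTc.norm
  have hDp : Function.Periodic D 1 := by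
    intro t
    have e : Real.pi * (t + 1 - a) = Real.pi * (t - a) + Real.pi := by ring
    simp only [hD, h.secT_add_one_right, e, Real.cos_add_pi]
    congr 1; push_cast; ring
  have hTp : Function.Periodic (fun t => ‖secT γ a t‖) 1 := by
    intro t; simp only [h.secT_add_one_right, norm_neg]
  have hSp : Function.Periodic (fun t => |Real.sin (Real.pi * (t - a))|) 1 := by
    intro t
    have e : Real.pi * (t + 1 - a) = Real.pi * (t - a) + Real.pi := by ring
    simp only [e, Real.sin_add_pi, abs_neg]
  have hDa : D a = 0 := by
    have : (Real.pi : ℂ) ≠ 0 := by exact_mod_cast Real.pi_pos.ne'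
    simp only [hD, h.secT_diag, sub_self, mul_zero, Real.cos_zero, mul_one]
    rw [mul_div_cancel₀ _ this]; simp
  obtain ⟨m0, hm0, hm⟩ := (isCompact_Icc (a := a) (b := a + 1)).exists_forall_le' (f := fun t => ‖secT γ a t‖)
    hTn.continuousOn (a := 0) (fun t _ => norm_pos_iff.2 (h.secT_ne a t))
  obtain ⟨s0, hs0, hs⟩ := ((isCompact_Icc (a := a) (b := a + 1)).inter_right
    (isClosed_le continuous_const hDc : IsClosed {t | m0 ≤ D t})).exists_forall_le'
      (f := fun t => |Real.sin (Real.pi * (t - a))|) (by fun_prop) (a := 0) (by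
        rintro t ⟨ht, htD⟩
        rw [abs_pos]
        intro h0
        obtain ⟨n, hn⟩ := sin_pi_eq_zero.1 h0
        have h5 : D t = 0 := by
          have e : t = a + n * 1 := by linarith
          rw [e, ← hDa]
          exact (hDp.int_mul n) a
        have : m0 ≤ D t := htD
        linarith)
  obtain ⟨M, hM⟩ := (isCompact_Icc (a := a) (b := a + 1)).bddAbove_image hDc.continuousOn
  have key : ∀ t : ℝ, ∃ t' ∈ Set.Icc a (a + 1), D t = D t' ∧ ‖secT γ a t‖ = ‖secT γ a t'‖ ∧
      |Real.sin (Real.pi * (t - a))| = |Real.sin (Real.pi * (t' - a))| := by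
    intro t
    refine ⟨t - ⌊t - a⌋, ⟨by linarith [Int.floor_le (t - a)],
      by linarith [Int.lt_floor_add_one (t - a)]⟩, ?_, ?_, ?_⟩
    · simpa using (hDp.sub_int_mul_eq (x := t) ⌊t - a⌋).symm
    · simpa using (hTp.sub_int_mul_eq (x := t) ⌊t - a⌋).symm
    · simpa using (hSp.sub_int_mul_eq (x := t) ⌊t - a⌋).symm
  have hpi := Real.pi_pos
  have hpi1 : 1 < Real.pi := by linarith [Real.pi_gt_three]
  have hM0 : 0 ≤ M := by
    have := hM ⟨a, ⟨le_rfl, by linarith⟩, rfl⟩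
    rwa [hDa] at this
  refine ⟨min (1 / Real.pi) (m0 * s0 / (M + 1)), by positivity, fun s hs1 κ hκ hκε => ?_⟩
  have hκ1 : κ * Real.pi < 1 := by
    have := hκε.trans_le (min_le_left _ _)
    rwa [lt_div_iff₀ hpi] at this
  have hκ2 : κ * (M + 1) < m0 * s0 := by
    have := hκε.trans_le (min_le_right _ _)
    rwa [lt_div_iff₀ (by linarith)] at this
  have hss : s ^ 2 = 1 := by rcases hs1 with rfl | rfl <;> norm_num
  have habs : |s| = 1 := by rcases hs1 with rfl | rfl <;> norm_num
  have hE := hasWind_ellipse (s := s) hss (k := κ * Real.pi) (by positivity) a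
  have hc1 := hT.mul hE
  refine hc1.close (by have := h.continuous; fun_prop) ?_ ?_ ?_
  · intro t
    have e : Real.pi * (t + 1 - a) = Real.pi * (t - a) + Real.pi := by ring
    simp only [h.secT_add_one_right, e, Real.sin_add_pi, Real.cos_add_pi]
    push_cast; ring
  · intro t; simp only [h.per]
  · intro t
    obtain ⟨t', ht', e1, e2, e3⟩ := key t
    have hdiff : γ t - (γ a + s * κ * Complex.I * deriv γ a) - secT γ a t *
        (Real.sin (Real.pi * (t - a)) - s * (κ * Real.pi : ℝ) * Complex.I * Real.cos (Real.pi * (t - a)))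
        = s * κ * Complex.I * ((Real.pi * Real.cos (Real.pi * (t - a)) : ℝ) * secT γ a t - deriv γ a) := by
      have := h.secT_mul_sin a t
      push_cast at this ⊢
      linear_combination -this
    rw [hdiff, norm_mul, norm_mul, norm_mul, Complex.norm_I, Complex.norm_real, Complex.norm_real,
      Real.norm_eq_abs, Real.norm_eq_abs, habs, abs_of_pos hκ, one_mul, mul_one, norm_mul]
    change κ * D t < _
    set z : ℂ := (Real.sin (Real.pi * (t - a)) - s * (κ * Real.pi : ℝ) * Complex.I * Real.cos (Real.pi * (t - a))) with hz
    have hzre : z.re = Real.sin (Real.pi * (t - a)) := by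
      rw [hz]; simp [-Complex.ofReal_mul, -Complex.ofReal_sin, -Complex.ofReal_cos]
    have hzim : z.im = - (s * (κ * Real.pi) * Real.cos (Real.pi * (t - a))) := by
      rw [hz]; simp [-Complex.ofReal_mul, -Complex.ofReal_sin, -Complex.ofReal_cos]
    have hz1 : |Real.sin (Real.pi * (t - a))| ≤ ‖z‖ := by rw [← hzre]; exact Complex.abs_re_le_norm z
    have hz2 : κ * Real.pi ≤ ‖z‖ := by
      have h7 : ‖z‖ ^ 2 = Real.sin (Real.pi * (t - a)) ^ 2 + (κ * Real.pi) ^ 2 * Real.cos (Real.pi * (t - a)) ^ 2 := by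
        rw [← Complex.normSq_eq_norm_sq, Complex.normSq_apply, hzre, hzim]
        linear_combination (κ * Real.pi) ^ 2 * Real.cos (Real.pi * (t - a)) ^ 2 * hss
      have h8 := Real.sin_sq_add_cos_sq (Real.pi * (t - a))
      have h9 : (κ * Real.pi) ^ 2 ≤ ‖z‖ ^ 2 := by
        rw [h7]
        have : (κ * Real.pi) ^ 2 ≤ 1 := by
          rw [sq_le_one_iff_abs_le_one, abs_of_pos (by positivity)]; exact hκ1.le
        nlinarith [sq_nonneg (Real.sin (Real.pi * (t - a)))]
      exact (pow_le_pow_iff_left₀ (by positivity) (norm_nonneg _) two_ne_zero).1 h9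
    have hT0 : m0 ≤ ‖secT γ a t‖ := by rw [e2]; exact hm t' ht'
    have hDM : D t ≤ M := by rw [e1]; exact hM ⟨t', ht', rfl⟩
    by_cases hcase : m0 ≤ D t
    · have h6 : s0 ≤ |Real.sin (Real.pi * (t - a))| := by
        rw [e3]; exact hs t' ⟨ht', by rw [e1] at hcase; exact hcase⟩
      calc κ * D t ≤ κ * M := by gcongr
        _ < m0 * s0 := by linarith
        _ ≤ ‖secT γ a t‖ * ‖z‖ := by gcongr; exact h6.trans hz1
    · push Not at hcase
      calc κ * D t < κ * m0 := by gcongr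
        _ ≤ m0 * (κ * Real.pi) := by nlinarith [mul_pos hκ hm0]
        _ ≤ ‖secT γ a t‖ * ‖z‖ := by gcongr

end IsSCC

end


section
open Complex Topology Filter Asymptotics

/-! ### Winding numbers about points -/

open Classical in
/-- the winding (junk value `0`). -/
noncomputable def wnum (c : ℝ → ℂ) : ℝ := if h : ∃ w, HasWind c w then h.choose else 0

theorem HasWind.wnum_eq {c : ℝ → ℂ} {w : ℝ} (h : HasWind c w) : wnum c = w := by
  have h1 : ∃ w, HasWind c w := ⟨w, h⟩
  rw [wnum, dif_pos h1]
  exact h1.choose_spec.unique h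

/-- winding number of `γ` about `z` -/
noncomputable def nw (γ : ℝ → ℂ) (z : ℂ) : ℝ := wnum fun t => γ t - z

theorem eq_of_locally_const {X β : Type*} [TopologicalSpace X] {S : Set X} (hS : IsPreconnected S)
    {f : X → β} (hf : ∀ z ∈ S, ∀ᶠ z' in 𝓝[S] z, f z' = f z) {x y : X} (hx : x ∈ S) (hy : y ∈ S) :
    f x = f y := by
  let _ : TopologicalSpace β := ⊥
  have : DiscreteTopology β := ⟨rfl⟩
  refine hS.constant (f := f) (fun z hz => ?_) hx hy
  rw [ContinuousWithinAt, nhds_discrete, tendsto_pure]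
  exact hf z hz

namespace IsSCC

theorem range_eq {γ : ℝ → ℂ} (h : IsSCC γ) : Set.range γ = γ '' Set.Icc 0 1 := by
  apply Set.Subset.antisymm
  · rintro _ ⟨t, rfl⟩
    exact ⟨Int.fract t, ⟨Int.fract_nonneg t, (Int.fract_lt_one t).le⟩, h.sub_int t _⟩
  · exact Set.image_subset_range _ _

theorem isCompact_range {γ : ℝ → ℂ} (h : IsSCC γ) : IsCompact (Set.range γ) := by
  rw [h.range_eq]
  exact isCompact_Icc.image h.continuous

theorem hasWind_nw {γ : ℝ → ℂ} (h : IsSCC γ) {z : ℂ} (hz : z ∉ Set.range γ) :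
    HasWind (fun t => γ t - z) (nw γ z) := by
  obtain ⟨w, hw⟩ := exists_hasWind (c := fun t => γ t - z) (by have := h.continuous; fun_prop)
    (fun t h0 => hz ⟨t, sub_eq_zero.1 h0⟩) (fun t => by simp only [h.per])
  rw [nw, hw.wnum_eq]
  exact hw

theorem nw_eventually {γ : ℝ → ℂ} (h : IsSCC γ) {z : ℂ} (hz : z ∉ Set.range γ) :
    ∀ᶠ z' in 𝓝 z, nw γ z' = nw γ z := by
  have hc := h.continuous
  have hcl : IsClosed (Set.range γ) := h.isCompact_range.isClosed
  obtain ⟨ε, hε, hb⟩ := Metric.isOpen_iff.1 hcl.isOpen_compl z hz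
  filter_upwards [Metric.ball_mem_nhds z hε] with z' hz'
  refine HasWind.wnum_eq ?_
  refine (h.hasWind_nw hz).close (by fun_prop) (fun t => by simp only [h.per])
    (fun t => by simp only [h.per]) (fun t => ?_)
  have h1 : ε ≤ ‖γ t - z‖ := by
    by_contra hcon
    push Not at hcon
    exact hb (by rwa [Metric.mem_ball, dist_eq_norm] : γ t ∈ Metric.ball z ε) ⟨t, rfl⟩
  have h2 : ‖z - z'‖ < ε := by rwa [Metric.mem_ball, dist_comm, dist_eq_norm] at hz'
  have e : γ t - z' - (γ t - z) = z - z' := by ring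
  rw [e]; linarith

theorem nw_preconnected {γ : ℝ → ℂ} (h : IsSCC γ) {S : Set ℂ} (hS : IsPreconnected S)
    (hd : ∀ z ∈ S, z ∉ Set.range γ) {x y : ℂ} (hx : x ∈ S) (hy : y ∈ S) : nw γ x = nw γ y := by
  refine eq_of_locally_const hS (fun z hz => ?_) hx hy
  exact (h.nw_eventually (hd z hz)).filter_mono nhdsWithin_le_nhds

theorem nw_far {γ : ℝ → ℂ} (h : IsSCC γ) : ∃ R : ℝ, ∀ z, R < ‖z‖ → nw γ z = 0 ∧ z ∉ Set.range γ := by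
  have hc := h.continuous
  obtain ⟨R, hR⟩ := h.isCompact_range.isBounded.exists_norm_le
  have hR' : ∀ t, ‖γ t‖ ≤ R := fun t => hR _ ⟨t, rfl⟩
  refine ⟨R, fun z hz => ⟨HasWind.wnum_eq ?_, ?_⟩⟩
  · have hz0 : -z ≠ 0 := by
      rw [neg_ne_zero]
      rintro rfl
      simp at hz
      linarith [norm_nonneg (γ 0), hR' 0]
    refine (hasWind_const hz0).close (by fun_prop) (fun t => rfl) (fun t => by simp only [h.per])
      (fun t => ?_)
    have e : γ t - z - -z = γ t := by ring
    rw [e, norm_neg]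
    exact (hR' t).trans_lt hz
  · rintro ⟨t, rfl⟩
    linarith [hR' t]

end IsSCC

/-- The winding of a `C¹` curve as an integral. -/
theorem HasWind.integral_eq {c c' : ℝ → ℂ} {w : ℝ} (h : HasWind c w)
    (hd : ∀ t, HasDerivAt c (c' t) t) (hc' : Continuous c') :
    ∫ t in (0 : ℝ)..1, c' t / c t = 2 * Real.pi * w * Complex.I := by
  have h0 := h.ne_zero
  have hc := h.continuous
  obtain ⟨L, hL, he, hp⟩ := h
  have hcont : Continuous fun t => c' t / c t := hc'.div hc h0
  set M : ℝ → ℂ := fun t => ∫ s in (0 : ℝ)..t, c' s / c s with hM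
  have hMd : ∀ t, HasDerivAt M (c' t / c t) t := fun t =>
    intervalIntegral.integral_hasDerivAt_right (hcont.intervalIntegrable _ _)
      hcont.stronglyMeasurable.stronglyMeasurableAtFilter hcont.continuousAt
  have hMc : Continuous M := continuous_iff_continuousAt.2 fun t => (hMd t).continuousAt
  have hE : ∀ t, HasDerivAt (fun t => Complex.exp (-M t) * c t) 0 t := by
    intro t
    have := ((hMd t).neg.cexp).mul (hd t)
    refine this.congr_deriv ?_
    have h2 : c' t / c t * c t = c' t := div_mul_cancel₀ _ (h0 t)
    show Complex.exp (-M t) * -(c' t / c t) * c t + Complex.exp (-M t) * c' t = 0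
    linear_combination -(Complex.exp (-M t)) * h2
  have hconst : ∀ t, Complex.exp (-M t) * c t = Complex.exp (-M 0) * c 0 := fun t =>
    is_const_of_deriv_eq_zero (fun t => (hE t).differentiableAt) (fun t => (hE t).deriv) t 0
  have h5 := const_of_exp_const (f := fun t => -M t + L t) (by fun_prop) (k := Complex.exp (-M 0) * c 0)
    (fun t => by rw [Complex.exp_add, he]; exact hconst t) 1 0
  have h6 := hp 0
  have hM0 : M 0 = 0 := by simp [hM]
  rw [zero_add] at h6
  simp only [hM0, h6] at h5
  change M 1 = _
  linear_combination -h5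

end


section
open Complex Topology Filter Asymptotics MeasureTheory

/-! ### The Cauchy–Pompeiu formula -/

/-- `∂̄` -/
noncomputable def dbar (f : ℂ → ℂ) (z : ℂ) : ℂ := (fderiv ℝ f z 1 + I * fderiv ℝ f z I) / 2
/-- `∂` -/
noncomputable def dz (f : ℂ → ℂ) (z : ℂ) : ℂ := (fderiv ℝ f z 1 - I * fderiv ℝ f z I) / 2

theorem fderiv_decomp (f : ℂ → ℂ) (z v : ℂ) :
    fderiv ℝ f z v = v.re * fderiv ℝ f z 1 + v.im * fderiv ℝ f z I := by
  have : v = v.re • (1 : ℂ) + v.im • I := by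
    simp [Complex.re_add_im]
  conv_lhs => rw [this]
  rw [map_add, map_smul, map_smul]
  simp

theorem pompeiu_zero {f : ℂ → ℂ} (hf : ContDiff ℝ 1 f) (hs : HasCompactSupport f) :
    ∫ ζ, dbar f ζ / ζ = -Real.pi * f 0 := by
  obtain ⟨R, hR0, hR⟩ : ∃ R > 0, ∀ z, R < ‖z‖ → f z = 0 ∧ fderiv ℝ f z = 0 := by
    obtain ⟨R, hR⟩ := (show IsCompact (tsupport f) from hs).isBounded.exists_norm_le
    refine ⟨max R 1, by positivity, fun z hz => ?_⟩
    have h1 : z ∉ tsupport f := fun h => by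
      have := hR z h
      linarith [le_max_left R 1]
    exact ⟨image_eq_zero_of_notMem_tsupport h1,
      image_eq_zero_of_notMem_tsupport (fun h => h1 (tsupport_fderiv_subset ℝ h))⟩
  have hfd : Continuous (fderiv ℝ f) := hf.continuous_fderiv (by norm_num)
  have hdiff : ∀ z, HasFDerivAt f (fderiv ℝ f z) z := fun z => (hf.differentiable (by norm_num) z).hasFDerivAt
  set e : ℝ → ℂ := fun θ => Complex.exp (θ * I) with he
  have hec : Continuous e := by rw [he]; fun_prop
  have hen : ∀ θ, ‖e θ‖ = 1 := fun θ => Complex.norm_exp_ofReal_mul_I θ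
  set H1 : ℝ × ℝ → ℂ := fun p => fderiv ℝ f (p.1 * e p.2) (e p.2) with hH1
  set H2 : ℝ × ℝ → ℂ := fun p => fderiv ℝ f (p.1 * e p.2) (I * e p.2) with hH2
  have hH1c : Continuous H1 := by rw [hH1]; fun_prop
  have hH2c : Continuous H2 := by rw [hH2]; fun_prop
  have hz : ∀ p : ℝ × ℝ, R < p.1 → fderiv ℝ f (p.1 * e p.2) = 0 := by
    intro p hp
    refine (hR _ ?_).2
    rw [norm_mul, hen, mul_one, Complex.norm_real, Real.norm_eq_abs]
    exact hp.trans_le (le_abs_self _)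
  set S : Set (ℝ × ℝ) := Set.Ioi (0 : ℝ) ×ˢ Set.Ioo (-Real.pi) Real.pi with hS
  have hSm : MeasurableSet S := measurableSet_Ioi.prod measurableSet_Ioo
  have hintg : ∀ H : ℝ × ℝ → ℂ, Continuous H → (∀ p : ℝ × ℝ, R < p.1 → H p = 0) →
      IntegrableOn H S (volume.prod volume) := by
    intro H hc h0
    have h1 : IntegrableOn H (Set.Icc 0 R ×ˢ Set.Icc (-Real.pi) Real.pi) (volume.prod volume) :=
      hc.continuousOn.integrableOn_compact (isCompact_Icc.prod isCompact_Icc)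
    refine h1.of_forall_sdiff_eq_zero hSm ?_
    rintro ⟨r, θ⟩ ⟨⟨h2, h3⟩, h4⟩
    apply h0
    by_contra hcon
    push Not at hcon
    exact h4 ⟨⟨(h2 : 0 < r).le, hcon⟩, ⟨h3.1.le, h3.2.le⟩⟩
  have hi1 := hintg H1 hH1c (fun p hp => by simp only [hH1, hz p hp]; simp)
  have hi2 := hintg H2 hH2c (fun p hp => by simp only [hH2, hz p hp]; simp)
  have hA : ∫ p in S, H1 p ∂(volume.prod volume) = -2 * Real.pi * f 0 := by
    rw [hS, ← Measure.prod_restrict] at *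
    rw [integral_prod_symm _ (by rw [Measure.prod_restrict]; exact hi1)]
    have h1 : ∀ θ : ℝ, ∫ r in Set.Ioi (0 : ℝ), H1 (r, θ) = -f 0 := by
      intro θ
      have hd : ∀ r ∈ Set.Ici (0 : ℝ), HasDerivAt (fun r : ℝ => f (r * e θ)) (H1 (r, θ)) r := by
        intro r _
        have h2 : HasDerivAt (fun r : ℝ => (r : ℂ) * e θ) (e θ) r := by
          simpa using (Complex.ofRealCLM.hasDerivAt (x := r)).mul_const (e θ)
        exact (hdiff (r * e θ)).comp_hasDerivAt r h2
      have hio : IntegrableOn (fun r => H1 (r, θ)) (Set.Ioi 0) := by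
        have h3 : IntegrableOn (fun r => H1 (r, θ)) (Set.Icc 0 R) :=
          (by fun_prop : Continuous fun r => H1 (r, θ)).continuousOn.integrableOn_compact isCompact_Icc
        refine h3.of_forall_sdiff_eq_zero measurableSet_Ioi ?_
        rintro r ⟨h4, h5⟩
        have : R < r := by
          by_contra hcon; push Not at hcon
          exact h5 ⟨(h4 : 0 < r).le, hcon⟩
        simp only [hH1, hz (r, θ) this]; simp
      have hlim : Tendsto (fun r : ℝ => f (r * e θ)) atTop (𝓝 0) := by
        refine tendsto_const_nhds.congr' ?_
        filter_upwards [eventually_gt_atTop R] with r hr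
        symm
        refine (hR _ ?_).1
        rw [norm_mul, hen, mul_one, Complex.norm_real, Real.norm_eq_abs]
        exact hr.trans_le (le_abs_self _)
      rw [integral_Ioi_of_hasDerivAt_of_tendsto' hd hio hlim]
      simp
    simp only [h1]
    rw [setIntegral_const]
    simp [Real.pi_pos.le]
    left; ring
  have hB : ∫ p in S, H2 p ∂(volume.prod volume) = 0 := by
    rw [hS, ← Measure.prod_restrict] at *
    rw [integral_prod _ (by rw [Measure.prod_restrict]; exact hi2)]
    have h1 : ∀ r ∈ Set.Ioi (0 : ℝ), ∫ θ in Set.Ioo (-Real.pi) Real.pi, H2 (r, θ) = 0 := by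
      intro r hr
      have hr0 : (r : ℂ) ≠ 0 := by exact_mod_cast (hr : 0 < r).ne'
      have hd : ∀ θ ∈ Set.uIcc (-Real.pi) Real.pi,
          HasDerivAt (fun θ : ℝ => f (r * e θ)) (r * H2 (r, θ)) θ := by
        intro θ _
        have h2 : HasDerivAt e (I * e θ) θ := by
          have := ((Complex.ofRealCLM.hasDerivAt (x := θ)).mul_const I).cexp
          simp only [he]
          refine this.congr_deriv ?_
          simp only [Complex.ofRealCLM_apply, Complex.ofReal_one]; ring
        have h3 := (hdiff (r * e θ)).comp_hasDerivAt θ (h2.const_mul (r : ℂ))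
        refine h3.congr_deriv ?_
        simp only [hH2]
        have : (r : ℂ) * (I * e θ) = r • (I * e θ) := by simp
        rw [this, map_smul]; simp
      have h4 := intervalIntegral.integral_eq_sub_of_hasDerivAt hd
        (Continuous.intervalIntegrable (by fun_prop) _ _)
      rw [intervalIntegral.integral_of_le (by linarith [Real.pi_pos]), integral_Ioc_eq_integral_Ioo,
        integral_const_mul] at h4
      have h5 : e Real.pi = e (-Real.pi) := by
        simp only [he]
        rw [Complex.exp_pi_mul_I]; push_cast
        rw [neg_mul, Complex.exp_neg, Complex.exp_pi_mul_I]; norm_num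
      rw [h5, sub_self] at h4
      exact (mul_eq_zero.1 h4).resolve_left hr0
    rw [setIntegral_congr_fun measurableSet_Ioi h1]
    simp
  rw [← Complex.integral_comp_polarCoord_symm]
  have hT : polarCoord.target = S := rfl
  rw [hT]
  have hcong : ∀ p ∈ S, p.1 • (dbar f (Complex.polarCoord.symm p) / Complex.polarCoord.symm p)
      = (1 / 2) * H1 p + (I / 2) * H2 p := by
    rintro ⟨r, θ⟩ ⟨h1, h2⟩
    have hr0 : (r : ℂ) ≠ 0 := by exact_mod_cast (h1 : 0 < r).ne'
    have hp : Complex.polarCoord.symm (r, θ) = r * e θ := by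
      rw [Complex.polarCoord_symm_apply]
      simp only [he, Complex.exp_mul_I]
      push_cast; ring
    rw [hp]
    have he0 : e θ ≠ 0 := Complex.exp_ne_zero _
    have hre : (e θ).re = Real.cos θ := Complex.exp_ofReal_mul_I_re θ
    have him : (e θ).im = Real.sin θ := Complex.exp_ofReal_mul_I_im θ
    have heθ : e θ = Real.cos θ + Real.sin θ * I := by
      rw [← hre, ← him, Complex.re_add_im]
    simp only [hH1, hH2]
    rw [fderiv_decomp f _ (e θ), fderiv_decomp f _ (I * e θ)]
    simp only [Complex.mul_re, Complex.mul_im, Complex.I_re, Complex.I_im, hre, him, zero_mul,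
      one_mul, zero_sub, zero_add, add_zero]
    rw [dbar, Complex.real_smul]
    set X := fderiv ℝ f (r * e θ) 1
    set Y := fderiv ℝ f (r * e θ) I
    have hcs : (Real.cos θ : ℂ) ^ 2 + (Real.sin θ : ℂ) ^ 2 = 1 := by
      exact_mod_cast Real.cos_sq_add_sin_sq θ
    rw [mul_div_assoc', div_eq_iff (mul_ne_zero hr0 he0), heθ]
    push_cast at hcs ⊢
    linear_combination (-(r : ℂ) * (X + I * Y) / 2) * hcs + ((r:ℂ) * X * Complex.sin θ ^ 2 / 2 - (r:ℂ) * Y * Complex.cos θ * Complex.sin θ / 2) * I_sq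
  rw [setIntegral_congr_fun hSm hcong]
  have : (volume : Measure (ℝ × ℝ)) = volume.prod volume := rfl
  rw [this, integral_add (hi1.const_mul _) (hi2.const_mul _), integral_const_mul, integral_const_mul,
    hA, hB]
  push_cast; ring

theorem pompeiu {f : ℂ → ℂ} (hf : ContDiff ℝ 1 f) (hs : HasCompactSupport f) (z : ℂ) :
    ∫ ζ, dbar f ζ / (ζ - z) = -Real.pi * f z := by
  have h1 := pompeiu_zero (f := fun w => f (w + z)) (by fun_prop)
    (hs.comp_homeomorph (Homeomorph.addRight z))
  have h2 : ∀ w, dbar (fun w => f (w + z)) w = dbar f (w + z) := by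
    intro w
    simp only [dbar, fderiv_comp_add_right]
  simp only [h2, zero_add] at h1
  rw [← h1, ← integral_add_right_eq_self (fun ζ => dbar f ζ / (ζ - z)) z]
  simp

end


section
open Complex Topology Filter Asymptotics MeasureTheory

/-! ### Integrals over closed curves as area integrals -/

theorem integrableOn_inv_norm (r : ℝ) : IntegrableOn (fun x : ℂ => ‖x‖⁻¹) (Metric.ball (0 : ℂ) r) := by
  rw [integrableOn_fun_norm_addHaar volume (f := fun y : ℝ => y⁻¹)]
  have h1 : IntegrableOn (fun _ : ℝ => (1 : ℝ)) (Set.Ioo 0 r) := by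
    simp
  refine h1.congr_fun ?_ measurableSet_Ioo
  intro y hy
  have : y ≠ 0 := hy.1.ne'
  simp [Complex.finrank_real_complex, this]

theorem IsSCC.range_null {γ : ℝ → ℂ} (h : IsSCC γ) : volume (Set.range γ) = 0 := by
  have hd : ∀ x ∈ (Set.univ : Set ℂ), HasFDerivWithinAt (fun z : ℂ => γ z.re)
      ((ContinuousLinearMap.toSpanSingleton ℝ (deriv γ x.re)).comp Complex.reCLM) Set.univ x := by
    intro x _
    have h1 := (h.hasDerivAt x.re).hasFDerivAt
    exact (h1.comp x Complex.reCLM.hasFDerivAt).hasFDerivWithinAt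
  have := addHaar_image_eq_zero_of_det_fderivWithin_eq_zero volume hd (by
    intro x _
    rw [ContinuousLinearMap.det]
    by_contra hcon
    have hI := (LinearMap.equivOfDetNeZero _ hcon).injective
    have h0 : (LinearMap.equivOfDetNeZero _ hcon) I = (LinearMap.equivOfDetNeZero _ hcon) 0 := by
      simp [LinearMap.equivOfDetNeZero]
    exact I_ne_zero (hI h0))
  rw [Set.image_univ] at this
  have e : Set.range (fun z : ℂ => γ z.re) = Set.range γ := by
    ext w; constructor
    · rintro ⟨z, rfl⟩; exact ⟨_, rfl⟩
    · rintro ⟨t, rfl⟩; exact ⟨t, by simp⟩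
  rwa [e] at this

theorem fubini_kernel {γ : ℝ → ℂ} (h : IsSCC γ) {D : ℂ → ℂ} (hD : Continuous D)
    (hs : HasCompactSupport D) :
    Integrable (Function.uncurry fun t ζ => deriv γ t * (D ζ / (γ t - ζ)))
      ((volume.restrict (Set.uIoc (0 : ℝ) 1)).prod volume) := by
  have hγ := h.continuous
  have hγ' := h.contDeriv
  obtain ⟨M, hM⟩ := hD.bounded_above_of_compact_support hs
  obtain ⟨R1, hR1⟩ := (show IsCompact (tsupport D) from hs).isBounded.exists_norm_le
  obtain ⟨R2, hR2⟩ := h.isCompact_range.isBounded.exists_norm_le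
  obtain ⟨M', hM'⟩ := (isCompact_Icc (a := (0:ℝ)) (b := 1)).exists_bound_of_continuousOn hγ'.continuousOn
  have hM0 : 0 ≤ M := (norm_nonneg _).trans (hM 0)
  set R := R1 + R2 + 1 with hR
  set b : ℂ → ℝ := (Metric.ball (0 : ℂ) R).indicator (fun x => M * ‖x‖⁻¹) with hb
  have hbi : Integrable b := by
    rw [hb, integrable_indicator_iff Metric.isOpen_ball.measurableSet]
    exact (integrableOn_inv_norm R).const_mul M
  have hpt : ∀ t ζ, ‖D ζ / (γ t - ζ)‖ ≤ b (ζ - γ t) := by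
    intro t ζ
    by_cases hζ : ζ ∈ tsupport D
    · have h1 := hR1 ζ hζ
      have h2 := hR2 (γ t) ⟨t, rfl⟩
      have h3 : ζ - γ t ∈ Metric.ball (0 : ℂ) R := by
        rw [mem_ball_zero_iff]
        have := norm_sub_le ζ (γ t)
        linarith
      rw [hb, Set.indicator_of_mem h3, norm_div, ← norm_neg (γ t - ζ), neg_sub, div_eq_mul_inv]
      exact mul_le_mul_of_nonneg_right (hM ζ) (by positivity)
    · rw [image_eq_zero_of_notMem_tsupport hζ]
      simp only [zero_div, norm_zero]
      exact Set.indicator_nonneg (fun x _ => by positivity) _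
  have hmeas : Measurable (Function.uncurry fun t ζ => deriv γ t * (D ζ / (γ t - ζ))) := by
    have e : (Function.uncurry fun t ζ => deriv γ t * (D ζ / (γ t - ζ))) =
        fun p : ℝ × ℂ => deriv γ p.1 * (D p.2 / (γ p.1 - p.2)) := by ext ⟨t, ζ⟩; rfl
    rw [e]
    have h1 : Measurable fun p : ℝ × ℂ => deriv γ p.1 := (by fun_prop : Continuous _).measurable
    have h2 : Measurable fun p : ℝ × ℂ => D p.2 := (by fun_prop : Continuous _).measurable
    have h3 : Measurable fun p : ℝ × ℂ => γ p.1 - p.2 := (by fun_prop : Continuous _).measurable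
    exact h1.mul (h2.div h3)
  have hintg : ∀ t, Integrable (fun ζ => deriv γ t * (D ζ / (γ t - ζ))) := by
    intro t
    refine Integrable.const_mul ?_ _
    refine (hbi.comp_sub_right (γ t)).mono' ?_ (Eventually.of_forall fun ζ => hpt t ζ)
    exact (hD.measurable.div (by fun_prop)).aestronglyMeasurable
  rw [integrable_prod_iff hmeas.aestronglyMeasurable]
  refine ⟨Eventually.of_forall fun t => hintg t, ?_⟩
  have hc : Integrable (fun _ : ℝ => M' * ∫ x, b x) (volume.restrict (Set.uIoc (0 : ℝ) 1)) := by
    rw [Set.uIoc_of_le zero_le_one]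
    exact integrable_const _
  refine hc.mono' (hmeas.aestronglyMeasurable.norm.integral_prod_right') ?_
  refine (ae_restrict_iff' measurableSet_uIoc).2 (Eventually.of_forall fun t ht => ?_)
  rw [Set.uIoc_of_le zero_le_one] at ht
  rw [Real.norm_of_nonneg (integral_nonneg fun _ => norm_nonneg _)]
  have h4 : ∫ x, b x = ∫ ζ, b (ζ - γ t) := (integral_sub_right_eq_self b (γ t)).symm
  rw [h4, ← integral_const_mul]
  refine integral_mono (hintg t).norm ((hbi.comp_sub_right (γ t)).const_mul M') fun ζ => ?_
  show ‖deriv γ t * (D ζ / (γ t - ζ))‖ ≤ M' * b (ζ - γ t)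
  rw [norm_mul]
  exact mul_le_mul (hM' t ⟨ht.1.le, ht.2⟩) (hpt t ζ) (norm_nonneg _)
    ((norm_nonneg _).trans (hM' t ⟨ht.1.le, ht.2⟩))

theorem dbar_continuous {f : ℂ → ℂ} (hf : ContDiff ℝ 1 f) : Continuous (dbar f) := by
  have := hf.continuous_fderiv (by norm_num)
  unfold dbar; fun_prop

theorem dz_continuous {f : ℂ → ℂ} (hf : ContDiff ℝ 1 f) : Continuous (dz f) := by
  have := hf.continuous_fderiv (by norm_num)
  unfold dz; fun_prop

theorem dbar_support {f : ℂ → ℂ} (hs : HasCompactSupport f) : HasCompactSupport (dbar f) := by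
  refine HasCompactSupport.intro (K := tsupport f) hs fun z hz => ?_
  have : fderiv ℝ f z = 0 :=
    image_eq_zero_of_notMem_tsupport (fun h => hz (tsupport_fderiv_subset ℝ h))
  simp [dbar, this]

theorem cycle_integral {γ : ℝ → ℂ} (h : IsSCC γ) {A : ℂ → ℂ} (hA : ContDiff ℝ 1 A)
    (hs : HasCompactSupport A) :
    ∫ t in (0 : ℝ)..1, A (γ t) * deriv γ t = 2 * I * ∫ ζ, dbar A ζ * nw γ ζ ∧
      Integrable (fun ζ => dbar A ζ * nw γ ζ) := by
  have hfub := fubini_kernel h (dbar_continuous hA) (dbar_support hs)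
  have h1 : ∀ t, A (γ t) * deriv γ t = (1 / Real.pi : ℂ) * ∫ ζ, deriv γ t * (dbar A ζ / (γ t - ζ)) := by
    intro t
    have h2 := pompeiu hA hs (γ t)
    rw [integral_const_mul]
    have h3 : ∀ ζ, dbar A ζ / (γ t - ζ) = -(dbar A ζ / (ζ - γ t)) := by
      intro ζ; rw [← neg_sub ζ, div_neg]
    simp only [h3, integral_neg, h2]
    have : (Real.pi : ℂ) ≠ 0 := by exact_mod_cast Real.pi_ne_zero
    field_simp
  simp only [h1]
  rw [intervalIntegral.integral_const_mul, intervalIntegral_integral_swap hfub]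
  have h4 : ∀ᵐ ζ, ∫ t in (0 : ℝ)..1, deriv γ t * (dbar A ζ / (γ t - ζ)) =
      2 * Real.pi * I * (dbar A ζ * nw γ ζ) := by
    have : ∀ᵐ ζ, ζ ∉ Set.range γ := measure_eq_zero_iff_ae_notMem.1 h.range_null
    filter_upwards [this] with ζ hζ
    have h5 := (h.hasWind_nw hζ).integral_eq (fun t => (h.hasDerivAt t).sub_const ζ) h.contDeriv
    have h6 : ∀ t, deriv γ t * (dbar A ζ / (γ t - ζ)) = dbar A ζ * (deriv γ t / (γ t - ζ)) := by
      intro t; ring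
    simp only [h6]
    rw [intervalIntegral.integral_const_mul, h5]; ring
  rw [integral_congr_ae h4, integral_const_mul]
  have : (Real.pi : ℂ) ≠ 0 := by exact_mod_cast Real.pi_ne_zero
  constructor
  · field_simp
  · have h7 := hfub.integral_prod_right
    rw [Set.uIoc_of_le zero_le_one] at h7
    have h8 := (h7.congr (g := fun ζ => 2 * Real.pi * I * (dbar A ζ * nw γ ζ)) (by
      filter_upwards [h4] with ζ hζ
      rw [intervalIntegral.integral_of_le zero_le_one] at hζ
      exact hζ)).const_mul (2 * Real.pi * I)⁻¹
    refine h8.congr (Eventually.of_forall fun ζ => ?_)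
    have : (2 * Real.pi * I : ℂ) ≠ 0 := Complex.two_pi_I_ne_zero
    show (2 * Real.pi * I : ℂ)⁻¹ * (2 * Real.pi * I * (dbar A ζ * nw γ ζ)) = _
    rw [inv_mul_cancel_left₀ this]

theorem fderiv_conj (B : ℂ → ℂ) (z v : ℂ) :
    fderiv ℝ (fun w => (starRingEnd ℂ) (B w)) z v = (starRingEnd ℂ) (fderiv ℝ B z v) := by
  have h := Complex.conjCLE.comp_fderiv (f := B) (x := z)
  have h2 : (fun w => (starRingEnd ℂ) (B w)) = Complex.conjCLE ∘ B := by ext; simp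
  rw [h2, h]; simp

theorem dbar_conj (B : ℂ → ℂ) (z : ℂ) :
    dbar (fun w => (starRingEnd ℂ) (B w)) z = (starRingEnd ℂ) (dz B z) := by
  have h2 : (starRingEnd ℂ) (2 : ℂ) = 2 := Complex.conj_ofNat 2
  simp only [dbar, dz, fderiv_conj]
  simp [h2]

theorem cycle_integral_conj {γ : ℝ → ℂ} (h : IsSCC γ) {B : ℂ → ℂ} (hB : ContDiff ℝ 1 B)
    (hs : HasCompactSupport B) :
    ∫ t in (0 : ℝ)..1, B (γ t) * (starRingEnd ℂ) (deriv γ t) = -(2 * I * ∫ ζ, dz B ζ * nw γ ζ) ∧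
      Integrable (fun ζ => dz B ζ * nw γ ζ) := by
  have h1 := cycle_integral h (A := fun w => (starRingEnd ℂ) (B w))
    (Complex.conjCLE.contDiff.comp hB) (hs.comp_left (by simp))
  simp only [dbar_conj] at h1
  have e1 : ∀ ζ, (starRingEnd ℂ) (dz B ζ) * (nw γ ζ : ℂ) = (starRingEnd ℂ) (dz B ζ * nw γ ζ) := by
    intro ζ; simp
  have e2 : ∀ t, (starRingEnd ℂ) (B (γ t)) * deriv γ t =
      (starRingEnd ℂ) (B (γ t) * (starRingEnd ℂ) (deriv γ t)) := by intro t; simp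
  simp only [e1, e2] at h1
  obtain ⟨h2, h3⟩ := h1
  constructor
  · rw [integral_conj, intervalIntegral.integral_of_le zero_le_one, integral_conj] at h2
    have := congrArg (starRingEnd ℂ) h2
    simp only [map_mul, Complex.conj_conj, Complex.conj_I, map_ofNat] at this
    rw [intervalIntegral.integral_of_le zero_le_one, this]; ring
  · have := Complex.conjCLE.toContinuousLinearMap.integrable_comp h3
    simpa using this

end


section
open Complex Topology Filter Asymptotics MeasureTheory
open scoped ContDiff Manifold

/-! ### The total winding of a nonvanishing function over the boundary vanishes -/

theorem dbar_mul {f g : ℂ → ℂ} {z : ℂ} (hf : DifferentiableAt ℝ f z) (hg : DifferentiableAt ℝ g z) :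
    dbar (fun w => f w * g w) z = dbar f z * g z + f z * dbar g z := by
  simp only [dbar, fderiv_fun_mul hf hg]
  simp; ring

theorem dz_mul {f g : ℂ → ℂ} {z : ℂ} (hf : DifferentiableAt ℝ f z) (hg : DifferentiableAt ℝ g z) :
    dz (fun w => f w * g w) z = dz f z * g z + f z * dz g z := by
  simp only [dz, fderiv_fun_mul hf hg]
  simp; ring

theorem dbar_congr {f g : ℂ → ℂ} {z : ℂ} (h : f =ᶠ[𝓝 z] g) : dbar f z = dbar g z := by
  simp only [dbar, h.fderiv_eq]

theorem dz_congr {f g : ℂ → ℂ} {z : ℂ} (h : f =ᶠ[𝓝 z] g) : dz f z = dz g z := by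
  simp only [dz, h.fderiv_eq]

theorem dz_contDiff {f : ℂ → ℂ} (hf : ContDiff ℝ ∞ f) : ContDiff ℝ ∞ (dz f) := by
  have h1 : ContDiff ℝ ∞ (fderiv ℝ f) := hf.fderiv_right (by simp)
  unfold dz
  have h2 : ∀ v : ℂ, ContDiff ℝ ∞ fun z => fderiv ℝ f z v := fun v => h1.clm_apply contDiff_const
  exact ((h2 1).sub (contDiff_const.mul (h2 I))).div_const 2

theorem dbar_contDiff {f : ℂ → ℂ} (hf : ContDiff ℝ ∞ f) : ContDiff ℝ ∞ (dbar f) := by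
  have h1 : ContDiff ℝ ∞ (fderiv ℝ f) := hf.fderiv_right (by simp)
  unfold dbar
  have h2 : ∀ v : ℂ, ContDiff ℝ ∞ fun z => fderiv ℝ f z v := fun v => h1.clm_apply contDiff_const
  exact ((h2 1).add (contDiff_const.mul (h2 I))).div_const 2

theorem dbar_dz_comm {f : ℂ → ℂ} (hf : ContDiff ℝ ∞ f) (z : ℂ) : dbar (dz f) z = dz (dbar f) z := by
  have h1 : ContDiff ℝ ∞ (fderiv ℝ f) := hf.fderiv_right (by simp)
  have hd : DifferentiableAt ℝ (fderiv ℝ f) z := h1.differentiable (by simp) z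
  have hsym : fderiv ℝ (fderiv ℝ f) z 1 I = fderiv ℝ (fderiv ℝ f) z I 1 :=
    (hf.contDiffAt (x := z)).isSymmSndFDerivAt (by simp only [minSmoothness_of_isRCLikeNormedField]; exact WithTop.coe_le_coe.2 le_top) 1 I
  have h2 : ∀ v w : ℂ, fderiv ℝ (fun z => fderiv ℝ f z v) z w = fderiv ℝ (fderiv ℝ f) z w v := by
    intro v w
    rw [fderiv_clm_apply hd (by fun_prop)]
    simp
  have hdv : ∀ v : ℂ, DifferentiableAt ℝ (fun z => fderiv ℝ f z v) z := fun v =>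
    hd.clm_apply (by fun_prop)
  have h3 : ∀ w, fderiv ℝ (dz f) z w =
      (fderiv ℝ (fderiv ℝ f) z w 1 - I * fderiv ℝ (fderiv ℝ f) z w I) / 2 := by
    intro w
    have e : dz f = fun z => (2 : ℂ)⁻¹ * (fderiv ℝ f z 1 - I * fderiv ℝ f z I) := by
      ext z; simp only [dz]; ring
    rw [e, fderiv_const_mul (by exact (hdv 1).sub ((hdv I).const_mul I)), fderiv_fun_sub (hdv 1) ((hdv I).const_mul I),
      fderiv_const_mul (hdv I)]
    simp [h2]; ring
  have h4 : ∀ w, fderiv ℝ (dbar f) z w =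
      (fderiv ℝ (fderiv ℝ f) z w 1 + I * fderiv ℝ (fderiv ℝ f) z w I) / 2 := by
    intro w
    have e : dbar f = fun z => (2 : ℂ)⁻¹ * (fderiv ℝ f z 1 + I * fderiv ℝ f z I) := by
      ext z; simp only [dbar]; ring
    rw [e, fderiv_const_mul (by exact (hdv 1).add ((hdv I).const_mul I)), fderiv_fun_add (hdv 1) ((hdv I).const_mul I),
      fderiv_const_mul (hdv I)]
    simp [h2]; ring
  rw [dbar, dz, h3, h3, h4, h4, hsym]; ring

theorem fderiv_dz_dbar (f : ℂ → ℂ) (z v : ℂ) :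
    fderiv ℝ f z v = dz f z * v + dbar f z * (starRingEnd ℂ) v := by
  rw [fderiv_decomp, dz, dbar]
  have h1 : (starRingEnd ℂ) v = v.re - v.im * I := by
    apply Complex.ext <;> simp
  have h2 : v = v.re + v.im * I := (Complex.re_add_im v).symm
  rw [h1]
  conv_rhs => rw [h2]
  simp only [Complex.add_re, Complex.add_im, Complex.ofReal_re, Complex.ofReal_im, Complex.mul_re,
    Complex.mul_im, Complex.I_re, Complex.I_im, mul_zero, mul_one, sub_zero, add_zero, zero_add]
  linear_combination ((v.im : ℂ) * fderiv ℝ f z I) * I_sq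

theorem exists_smooth_approx {K : Set ℂ} (hK : IsCompact K) {G : ℂ → ℂ} (hG : ContinuousOn G K)
    {δ : ℝ} (hδ : 0 < δ) : ∃ G1 : ℂ → ℂ, ContDiff ℝ ∞ G1 ∧ ∀ z ∈ K, ‖G1 z - G z‖ < δ := by
  obtain ⟨g, hg⟩ := ContinuousMap.exists_restrict_eq (X := ℂ) (Y := ℂ) hK.isClosed
    (⟨K.domRestrict G, hG.domRestrict⟩ : C(K, ℂ))
  have hd := ContinuousMap.dense_setOfPred_contDiff (E := ℂ) (F := ℂ) g
  rw [mem_closure_iff_nhds_basis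
    (nhds_basis_uniformity Metric.uniformity_basis_dist.compactConvergenceUniformity)] at hd
  obtain ⟨G1, h1, h2⟩ := hd (K, δ) ⟨hK, hδ⟩
  refine ⟨G1, h1, fun z hz => ?_⟩
  have h3 := h2 z hz
  have h4 : g z = G z := congrArg (fun f : C(K, ℂ) => f ⟨z, hz⟩) hg
  simp only [Set.mem_ofPred_eq, dist_eq_norm, h4] at h3
  exact h3

theorem sum_wind_zero {ι : Type*} [Fintype ι] {γ : ι → ℝ → ℂ} (h : ∀ j, IsSCC (γ j)) {K : Set ℂ}
    (hK : IsCompact K) (hγK : ∀ j t, γ j t ∈ K) (σ : ι → ℝ)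
    (h0 : ∀ ζ ∉ K, ∑ j, σ j * nw (γ j) ζ = 0) {G : ℂ → ℂ} (hG : ContinuousOn G K)
    (hG0 : ∀ z ∈ K, G z ≠ 0) (w : ι → ℝ) (hw : ∀ j, HasWind (fun t => G (γ j t)) (w j)) :
    ∑ j, σ j * w j = 0 := by
  obtain ⟨δ, hδ, hδK⟩ : ∃ δ > 0, ∀ z ∈ K, δ ≤ ‖G z‖ :=
    hK.exists_forall_le' (hG.norm) (fun z hz => norm_pos_iff.2 (hG0 z hz))
  obtain ⟨G1, hG1, hclose⟩ := exists_smooth_approx hK hG hδ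
  have hG1c := hG1.continuous
  have hw1 : ∀ j, HasWind (fun t => G1 (γ j t)) (w j) := by
    intro j
    have := (h j).continuous
    refine (hw j).close (by fun_prop) (fun t => by simp only [(h j).per])
      (fun t => by simp only [(h j).per]) (fun t => ?_)
    exact (hclose _ (hγK j t)).trans_le (hδK _ (hγK j t))
  have hU : IsOpen {z | G1 z ≠ 0} := isOpen_ne_fun hG1c continuous_const
  have hKU : K ⊆ {z | G1 z ≠ 0} := by
    intro z hz h1
    have h2 := hclose z hz
    rw [h1, zero_sub, norm_neg] at h2
    linarith [hδK z hz]
  obtain ⟨L, hL, hKL, hLU⟩ := exists_compact_between hK hU hKU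
  obtain ⟨χ, hχs, hχ1, hχ0⟩ : ∃ χ : ℂ → ℝ, ContDiff ℝ ∞ χ ∧ (∀ᶠ x in 𝓝ˢ K, χ x = 1) ∧
      (∀ x ∉ L, χ x = 0) := by
    obtain ⟨χ, h1, h2, -⟩ := exists_contMDiffMap_one_nhds_of_subset_interior (n := ⊤) 𝓘(ℝ, ℂ)
      hK.isClosed hKL
    exact ⟨χ, χ.contMDiff.contDiff, h1, h2⟩
  have hsm : ∀ f : ℂ → ℂ, ContDiff ℝ ∞ f → ContDiff ℝ 1 (fun z => (χ z : ℂ) * (f z / G1 z)) ∧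
      HasCompactSupport (fun z => (χ z : ℂ) * (f z / G1 z)) := by
    intro f hf
    refine ⟨?_, HasCompactSupport.intro hL fun z hz => by simp [hχ0 z hz]⟩
    rw [contDiff_iff_contDiffAt]
    intro z
    by_cases hz : z ∈ L
    · have h1 : ContDiff ℝ ∞ fun z => (χ z : ℂ) := Complex.ofRealCLM.contDiff.comp hχs
      have h2 : ContDiffAt ℝ ∞ (fun z => (G1 z)⁻¹) z := hG1.contDiffAt.inv (hLU hz)
      have h3 := h1.contDiffAt.mul (hf.contDiffAt.mul h2) (x := z)
      exact (h3.of_le (by simp))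
    · have h1 : (fun z => (χ z : ℂ) * (f z / G1 z)) =ᶠ[𝓝 z] fun _ => 0 := by
        filter_upwards [hL.isClosed.isOpen_compl.mem_nhds hz] with y hy
        simp [hχ0 y hy]
      exact contDiffAt_const.congr_of_eventuallyEq h1
  set A : ℂ → ℂ := fun z => (χ z : ℂ) * (dz G1 z / G1 z) with hA
  set B : ℂ → ℂ := fun z => (χ z : ℂ) * (dbar G1 z / G1 z) with hB
  obtain ⟨hA1, hA2⟩ := hsm _ (dz_contDiff hG1)
  obtain ⟨hB1, hB2⟩ := hsm _ (dbar_contDiff hG1)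
  rw [← hA] at hA1 hA2
  rw [← hB] at hB1 hB2
  have hAB : ∀ z ∈ K, dbar A z = dz B z := by
    intro z hz
    have hn : ∀ᶠ y in 𝓝 z, χ y = 1 ∧ G1 y ≠ 0 :=
      (hχ1.filter_mono (nhds_le_nhdsSet hz)).and (hU.mem_nhds (hKU hz))
    have hGd : DifferentiableAt ℝ G1 z := hG1.differentiable (by simp) z
    have e1 : (fun y => A y * G1 y) =ᶠ[𝓝 z] dz G1 := by
      filter_upwards [hn] with y hy
      simp only [hA, hy.1]
      have := hy.2
      field_simp; simp [hy.1]
    have e2 : (fun y => B y * G1 y) =ᶠ[𝓝 z] dbar G1 := by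
      filter_upwards [hn] with y hy
      simp only [hB, hy.1]
      have := hy.2
      field_simp; simp [hy.1]
    have f1 := dbar_congr e1
    have f2 := dz_congr e2
    rw [dbar_mul (hA1.differentiable (by norm_num) z) hGd] at f1
    rw [dz_mul (hB1.differentiable (by norm_num) z) hGd, ← dbar_dz_comm hG1] at f2
    have g1 := e1.self_of_nhds
    have g2 := e2.self_of_nhds
    simp only at g1 g2
    rw [← g2] at f1
    rw [← g1] at f2
    have : (dbar A z - dz B z) * G1 z = 0 := by linear_combination f1 - f2
    exact sub_eq_zero.1 ((mul_eq_zero.1 this).resolve_right (hKU hz))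
  have hj : ∀ j, 2 * Real.pi * (w j) * I = 2 * I * ∫ ζ, (dbar A ζ - dz B ζ) * nw (γ j) ζ ∧
      Integrable fun ζ => (dbar A ζ - dz B ζ) * nw (γ j) ζ := by
    intro j
    obtain ⟨a1, a2⟩ := cycle_integral (h j) hA1 hA2
    obtain ⟨b1, b2⟩ := cycle_integral_conj (h j) hB1 hB2
    have hgc := (h j).continuous
    have hgc' := (h j).contDeriv
    have hd : ∀ t, HasDerivAt (fun t => G1 (γ j t)) (fderiv ℝ G1 (γ j t) (deriv (γ j) t)) t := fun t =>
      (hG1.differentiable (by simp) (γ j t)).hasFDerivAt.comp_hasDerivAt t ((h j).hasDerivAt t)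
    have hfc : Continuous (fderiv ℝ G1) := hG1.continuous_fderiv (by simp)
    have hi := (hw1 j).integral_eq hd (by fun_prop)
    have e : ∀ t, fderiv ℝ G1 (γ j t) (deriv (γ j) t) / G1 (γ j t) =
        A (γ j t) * deriv (γ j) t + B (γ j t) * (starRingEnd ℂ) (deriv (γ j) t) := by
      intro t
      have hx : χ (γ j t) = 1 := (hχ1.filter_mono (nhds_le_nhdsSet (hγK j t))).self_of_nhds
      rw [fderiv_dz_dbar]
      simp only [hA, hB, hx]
      push_cast; ring
    have hAc := hA1.continuous
    have hBc := hB1.continuous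
    have hcc : Continuous fun t => (starRingEnd ℂ) (deriv (γ j) t) := Complex.continuous_conj.comp hgc'
    simp only [e] at hi
    rw [intervalIntegral.integral_add ((by fun_prop : Continuous _).intervalIntegrable _ _)
      ((by fun_prop : Continuous _).intervalIntegrable _ _), a1, b1] at hi
    have e3 : (fun ζ => (dbar A ζ - dz B ζ) * (nw (γ j) ζ : ℂ)) =
      fun ζ => dbar A ζ * nw (γ j) ζ - dz B ζ * nw (γ j) ζ := by ext ζ; ring
    rw [e3]
    refine ⟨?_, a2.sub b2⟩
    rw [integral_sub a2 b2, ← hi]; ring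
  have hsum : ∑ j, (σ j : ℂ) * ∫ ζ, (dbar A ζ - dz B ζ) * nw (γ j) ζ = 0 := by
    simp only [← integral_const_mul]
    rw [← integral_finsetSum _ fun j _ => (hj j).2.const_mul _]
    rw [← integral_zero ℂ ℂ]
    congr 1
    ext ζ
    by_cases hζ : ζ ∈ K
    · simp [hAB ζ hζ]
    · have h1 : ∑ j, (σ j : ℂ) * (nw (γ j) ζ : ℂ) = 0 := by exact_mod_cast h0 ζ hζ
      calc _ = (dbar A ζ - dz B ζ) * ∑ j, (σ j : ℂ) * (nw (γ j) ζ : ℂ) := by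
            rw [Finset.mul_sum]; refine Finset.sum_congr rfl fun j _ => by ring
        _ = 0 := by rw [h1, mul_zero]
  have hfin : (2 * Real.pi * I : ℂ) * ∑ j, (σ j : ℂ) * (w j : ℂ) = 0 := by
    calc (2 * Real.pi * I : ℂ) * ∑ j, (σ j : ℂ) * (w j : ℂ)
        = ∑ j, (σ j : ℂ) * (2 * Real.pi * (w j) * I) := by
          rw [Finset.mul_sum]; refine Finset.sum_congr rfl fun j _ => by ring
      _ = 2 * I * ∑ j, (σ j : ℂ) * ∫ ζ, (dbar A ζ - dz B ζ) * nw (γ j) ζ := by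
          rw [Finset.mul_sum]; refine Finset.sum_congr rfl fun j _ => by rw [(hj j).1]; ring
      _ = 0 := by rw [hsum, mul_zero]
  have := (mul_eq_zero.1 hfin).resolve_left Complex.two_pi_I_ne_zero
  exact_mod_cast this

end


section
open Complex Topology Filter Asymptotics MeasureTheory

/-! ### Normalized curves and the double layer kernel -/

theorem intervalIntegrable_abs_rpow {p : ℝ} (hp : -1 < p) (a b : ℝ) :
    IntervalIntegrable (fun x : ℝ => |x| ^ p) volume a b := by
  have h1 : ∀ c : ℝ, 0 ≤ c → IntervalIntegrable (fun x : ℝ => |x| ^ p) volume 0 c := by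
    intro c hc
    refine (intervalIntegral.intervalIntegrable_rpow' hp (a := 0) (b := c)).congr ?_
    rw [Set.uIoc_of_le hc]
    intro x hx
    simp only [abs_of_pos hx.1]
  have h2 : ∀ c : ℝ, IntervalIntegrable (fun x : ℝ => |x| ^ p) volume 0 c := by
    intro c
    rcases le_total 0 c with hc | hc
    · exact h1 c hc
    · have h3 := (IntervalIntegrable.iff_comp_neg (by simp)).1 (h1 (-c) (by linarith))
      simpa using h3
  exact (h2 a).symm.trans (h2 b)

/-- normalized curve of class `C^{1,α}`, close to the real axis. -/
structure NC (α η : ℝ) (γ γ' : ℝ → ℂ) : Prop where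
  ha : 0 < α
  ha1 : α < 1
  e0 : 0 < η
  e1 : η ≤ 1 / 100
  hd : ∀ t, HasDerivAt γ (γ' t) t
  h0 : γ 0 = 0
  h1 : γ' 0 = 1
  near : ∀ t, ‖γ' t - 1‖ ≤ η
  hol : ∀ s t, ‖γ' t - γ' s‖ ≤ η * |t - s| ^ α

namespace NC

theorem cont {α η : ℝ} {γ γ' : ℝ → ℂ} (h : NC α η γ γ') : Continuous γ :=
  continuous_iff_continuousAt.2 fun t => (h.hd t).continuousAt

theorem cont' {α η : ℝ} {γ γ' : ℝ → ℂ} (h : NC α η γ γ') : Continuous γ' := by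
  rw [continuous_iff_continuousAt]
  intro t
  rw [ContinuousAt, tendsto_iff_norm_sub_tendsto_zero]
  have h1 : Tendsto (fun s => η * |s - t| ^ α) (𝓝 t) (𝓝 0) := by
    have h2 : Tendsto (fun s : ℝ => |s - t|) (𝓝 t) (𝓝 0) := by
      have : Continuous fun s : ℝ => |s - t| := by fun_prop
      simpa using this.tendsto t
    have h3 := (h2.rpow_const (p := α) (Or.inr h.ha.le)).const_mul η
    rwa [Real.zero_rpow h.ha.ne', mul_zero] at h3
  exact squeeze_zero (fun _ => norm_nonneg _) (fun s => h.hol t s) h1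

theorem mvt {f f' : ℝ → ℂ} (hf : ∀ t, HasDerivAt f (f' t) t) {C : ℝ} {a b : ℝ}
    (hb : ∀ t ∈ Set.uIcc a b, ‖f' t‖ ≤ C) : ‖f b - f a‖ ≤ C * |b - a| := by
  have := (convex_uIcc a b).norm_image_sub_le_of_norm_hasDerivWithin_le
    (fun t _ => (hf t).hasDerivWithinAt) hb (Set.left_mem_uIcc) (Set.right_mem_uIcc)
  simpa using this

/-- `γ` is close to the identity -/
theorem lip {α η : ℝ} {γ γ' : ℝ → ℂ} (h : NC α η γ γ') (a b : ℝ) :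
    ‖(γ b - b) - (γ a - a)‖ ≤ η * |b - a| := by
  refine mvt (f := fun t => γ t - t) (f' := fun t => γ' t - 1) (fun t => ?_) (fun t _ => h.near t)
  exact (h.hd t).sub (Complex.ofRealCLM.hasDerivAt (x := t))

theorem lip' {α η : ℝ} {γ γ' : ℝ → ℂ} (h : NC α η γ γ') (x τ : ℝ) :
    ‖γ (x + τ) - γ x - τ‖ ≤ η * |τ| := by
  have := h.lip x (x + τ)
  have e : γ (x + τ) - ((x + τ : ℝ) : ℂ) - (γ x - x) = γ (x + τ) - γ x - τ := by push_cast; ring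
  rw [e] at this
  simpa using this

theorem lower {α η : ℝ} {γ γ' : ℝ → ℂ} (h : NC α η γ γ') (x τ s : ℝ) :
    |τ| / 2 ≤ ‖γ (x + τ) - γ x - s * I‖ := by
  have h1 := h.lip' x τ
  have h2 := Complex.abs_re_le_norm (γ (x + τ) - γ x - τ)
  have h3 := Complex.abs_re_le_norm (γ (x + τ) - γ x - s * I)
  have h4 : (γ (x + τ) - γ x - τ).re = (γ (x + τ) - γ x - s * I).re - τ := by simp
  rw [h4] at h2
  have h5 := abs_sub_abs_le_abs_sub τ (γ (x + τ) - γ x - s * I).re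
  rw [abs_sub_comm] at h5
  nlinarith [h.e1, abs_nonneg τ]

theorem re_sub_pos {α η : ℝ} {γ γ' : ℝ → ℂ} (h : NC α η γ γ') {x y : ℝ} (hxy : x < y) :
    (y - x) / 2 ≤ (γ y - γ x).re := by
  have h1 := h.lip x y
  have h2 := (abs_le.1 ((Complex.abs_re_le_norm _).trans h1)).1
  rw [abs_of_pos (by linarith)] at h2
  simp at h2 ⊢
  nlinarith [h.e1]

/-- the kernel -/
noncomputable def ker (γ γ' : ℝ → ℂ) (x τ : ℝ) : ℝ := (γ' (x + τ) / (γ (x + τ) - γ x)).im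

theorem norm_le_two {α η : ℝ} {γ γ' : ℝ → ℂ} (h : NC α η γ γ') (t : ℝ) : ‖γ' t‖ ≤ 2 := by
  have h1 := h.near t
  have h2 : ‖γ' t‖ ≤ ‖γ' t - 1‖ + ‖(1 : ℂ)‖ := by
    simpa using norm_add_le (γ' t - 1) 1
  rw [norm_one] at h2
  linarith [h.e1]

theorem sub_smul {α η : ℝ} {γ γ' : ℝ → ℂ} (h : NC α η γ γ') (x τ : ℝ) :
    ‖γ (x + τ) - γ x - τ * γ' (x + τ)‖ ≤ η * |τ| ^ α * |τ| := by
  have := mvt (f := fun t => γ t - t * γ' (x + τ)) (f' := fun t => γ' t - γ' (x + τ))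
    (C := η * |τ| ^ α) (a := x) (b := x + τ)
    (fun t => by
      have := (h.hd t).sub ((Complex.ofRealCLM.hasDerivAt (x := t)).mul_const (γ' (x + τ)))
      exact this.congr_deriv (by simp))
    (fun t ht => by
      refine (h.hol _ _).trans ?_
      refine mul_le_mul_of_nonneg_left ?_ h.e0.le
      refine Real.rpow_le_rpow (abs_nonneg _) ?_ h.ha.le
      have := Set.abs_sub_right_of_mem_uIcc ht
      rw [abs_sub_comm]
      simpa using this)
  have e : γ (x + τ) - ((x + τ : ℝ) : ℂ) * γ' (x + τ) - (γ x - x * γ' (x + τ)) =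
    γ (x + τ) - γ x - τ * γ' (x + τ) := by push_cast; ring
  rw [e] at this
  simpa using this

theorem ker_bound {α η : ℝ} {γ γ' : ℝ → ℂ} (h : NC α η γ γ') (x τ : ℝ) (hτ : τ ≠ 0) :
    |ker γ γ' x τ| ≤ 2 * η * |τ| ^ (α - 1) := by
  have hp : 0 < |τ| := abs_pos.2 hτ
  have hl := h.lower x τ 0
  simp only [Complex.ofReal_zero, zero_mul, sub_zero] at hl
  have hne : γ (x + τ) - γ x ≠ 0 := norm_pos_iff.1 (by linarith)
  have hτ' : (τ : ℂ) ≠ 0 := by exact_mod_cast hτ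
  have e : γ' (x + τ) / (γ (x + τ) - γ x) =
      (((1 / τ : ℝ)) : ℂ) - (γ (x + τ) - γ x - τ * γ' (x + τ)) / (τ * (γ (x + τ) - γ x)) := by
    push_cast; field_simp; ring
  have e2 : ker γ γ' x τ = -((γ (x + τ) - γ x - τ * γ' (x + τ)) / (τ * (γ (x + τ) - γ x))).im := by
    rw [ker, e, Complex.sub_im, Complex.ofReal_im, zero_sub]
  rw [e2, abs_neg]
  refine (Complex.abs_im_le_norm _).trans ?_
  rw [norm_div, norm_mul, Complex.norm_real, Real.norm_eq_abs, div_le_iff₀ (by positivity)]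
  refine (h.sub_smul x τ).trans ?_
  have e3 : |τ| ^ (α - 1) = |τ| ^ α / |τ| := by rw [Real.rpow_sub_one hp.ne']
  rw [e3]
  have h0 : 0 ≤ |τ| ^ α := Real.rpow_nonneg hp.le _
  have := h.e0
  calc η * |τ| ^ α * |τ| = 2 * η * (|τ| ^ α / |τ|) * (|τ| * (|τ| / 2)) := by field_simp
    _ ≤ _ := by gcongr

theorem ker_diff {α η : ℝ} {γ γ' : ℝ → ℂ} (h : NC α η γ γ') (x y τ : ℝ) (hτ : τ ≠ 0) :
    |ker γ γ' x τ - ker γ γ' y τ| ≤ 10 * η * |x - y| ^ α / |τ| := by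
  have hp : 0 < |τ| := abs_pos.2 hτ
  have hl : ∀ x, |τ| / 2 ≤ ‖γ (x + τ) - γ x‖ := by
    intro x
    have hl := h.lower x τ 0
    simpa only [Complex.ofReal_zero, zero_mul, sub_zero] using hl
  have hne : ∀ x, γ (x + τ) - γ x ≠ 0 := fun x => norm_pos_iff.1 (by linarith [hl x])
  have hq : ‖(γ (y + τ) - γ y) - (γ (x + τ) - γ x)‖ ≤ η * |x - y| ^ α * |τ| := by
    have := mvt (f := fun t => γ (y + t) - γ (x + t)) (f' := fun t => γ' (y + t) - γ' (x + t))
      (C := η * |x - y| ^ α) (a := 0) (b := τ)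
      (fun t => ((h.hd (y + t)).comp_const_add y t).sub ((h.hd (x + t)).comp_const_add x t))
      (fun t _ => by
        have := h.hol (x + t) (y + t)
        rw [abs_sub_comm] at this
        simpa using this)
    simp only [add_zero, sub_zero] at this
    convert this using 2; ring
  have ha : ‖γ' (x + τ) - γ' (y + τ)‖ ≤ η * |x - y| ^ α := by
    have := h.hol (y + τ) (x + τ)
    simpa using this
  have e : γ' (x + τ) / (γ (x + τ) - γ x) - γ' (y + τ) / (γ (y + τ) - γ y) =
     (γ' (x + τ) - γ' (y + τ)) / (γ (x + τ) - γ x) +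
     γ' (y + τ) * ((γ (y + τ) - γ y) - (γ (x + τ) - γ x)) / ((γ (x + τ) - γ x) * (γ (y + τ) - γ y)) := by
    have h1 := hne x
    have h2 := hne y
    field_simp; ring
  rw [ker, ker, ← Complex.sub_im, e]
  refine (Complex.abs_im_le_norm _).trans ((norm_add_le _ _).trans ?_)
  rw [norm_div, norm_div, norm_mul, norm_mul]
  set A := η * |x - y| ^ α with hA
  have hA0 : 0 ≤ A := by have := h.e0; positivity
  have t1 : ‖γ' (x + τ) - γ' (y + τ)‖ / ‖γ (x + τ) - γ x‖ ≤ A / (|τ| / 2) :=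
    div_le_div₀ hA0 ha (by positivity) (hl x)
  have t2 : ‖γ' (y + τ)‖ * ‖(γ (y + τ) - γ y) - (γ (x + τ) - γ x)‖ /
      (‖γ (x + τ) - γ x‖ * ‖γ (y + τ) - γ y‖) ≤ 2 * (A * |τ|) / ((|τ| / 2) * (|τ| / 2)) := by
    refine div_le_div₀ (by positivity) ?_ (by positivity) ?_
    · exact mul_le_mul (h.norm_le_two _) hq (norm_nonneg _) (by norm_num)
    · exact mul_le_mul (hl x) (hl y) (by positivity) (norm_nonneg _)
  refine (add_le_add t1 t2).trans (le_of_eq ?_)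
  rw [mul_assoc 10, ← hA]
  field_simp; ring

theorem ker_holder {α η : ℝ} {γ γ' : ℝ → ℂ} (h : NC α η γ γ') (x y τ : ℝ) (hτ : τ ≠ 0) :
    |ker γ γ' x τ - ker γ γ' y τ| ≤ 10 * η * |x - y| ^ (α / 2) * |τ| ^ (α / 2 - 1) := by
  have hp : 0 < |τ| := abs_pos.2 hτ
  have he := h.e0
  set D := |ker γ γ' x τ - ker γ γ' y τ| with hD
  have h1 : D ≤ 4 * η * |τ| ^ (α - 1) := by
    have := abs_sub (ker γ γ' x τ) (ker γ γ' y τ)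
    linarith [h.ker_bound x τ hτ, h.ker_bound y τ hτ]
  have h2 := h.ker_diff x y τ hτ
  refine abs_le_of_sq_le_sq' ?_ (by positivity) |>.2
  have h3 : D ^ 2 ≤ (4 * η * |τ| ^ (α - 1)) * (10 * η * |x - y| ^ α / |τ|) := by
    rw [sq]; exact mul_le_mul h1 h2 (abs_nonneg _) (by positivity)
  refine h3.trans ?_
  have e1 : (|x - y| ^ (α / 2)) ^ 2 = |x - y| ^ α := by
    rw [← Real.rpow_natCast, ← Real.rpow_mul (abs_nonneg _)]; congr 1; push_cast; ring
  have e2 : (|τ| ^ (α / 2 - 1)) ^ 2 = |τ| ^ (α - 1) / |τ| := by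
    rw [← Real.rpow_natCast, ← Real.rpow_mul (abs_nonneg _), ← Real.rpow_sub_one hp.ne']
    congr 1; push_cast; ring
  rw [mul_pow, mul_pow, e1, e2]
  have : 0 ≤ η ^ 2 * |x - y| ^ α * (|τ| ^ (α - 1) / |τ|) := by positivity
  calc _ = 40 * (η ^ 2 * |x - y| ^ α * (|τ| ^ (α - 1) / |τ|)) := by ring
    _ ≤ 100 * (η ^ 2 * |x - y| ^ α * (|τ| ^ (α - 1) / |τ|)) := by linarith
    _ = _ := by ring

end NC

end


section
open Complex Topology Filter Asymptotics MeasureTheory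

namespace NC

/-- the constant controlling the smallness required -/
noncomputable def cst (α : ℝ) : ℝ :=
  (∫ τ in (-4 : ℝ)..4, |τ| ^ (α - 1)) + ∫ τ in (-4 : ℝ)..4, |τ| ^ (α / 2 - 1)

noncomputable def kop (γ γ' : ℝ → ℂ) (f : ℝ → ℝ) (x : ℝ) : ℝ :=
  (1 / Real.pi) * ∫ τ in (-4 : ℝ)..4, ker γ γ' x τ * f (x + τ)

theorem cst_nonneg (p : ℝ) : 0 ≤ ∫ τ in (-4 : ℝ)..4, |τ| ^ p :=
  intervalIntegral.integral_nonneg (by norm_num) fun _ _ => Real.rpow_nonneg (abs_nonneg _) _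

theorem ker_meas {α η : ℝ} {γ γ' : ℝ → ℂ} (h : NC α η γ γ') (x : ℝ) :
    Measurable fun τ => ker γ γ' x τ := by
  have h1 := h.cont.measurable
  have h2 := h.cont'.measurable
  unfold ker
  exact Complex.measurable_im.comp (((h2.comp (by fun_prop : Measurable fun τ : ℝ => x + τ))).div
    ((h1.comp (by fun_prop : Measurable fun τ : ℝ => x + τ)).sub measurable_const))

theorem int_le {f : ℝ → ℝ} {C p : ℝ} (hp : -1 < p)
    (hb : ∀ τ, τ ≠ 0 → |f τ| ≤ C * |τ| ^ p) :
    |∫ τ in (-4 : ℝ)..4, f τ| ≤ C * ∫ τ in (-4 : ℝ)..4, |τ| ^ p := by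
  rw [← intervalIntegral.integral_const_mul, ← Real.norm_eq_abs]
  refine intervalIntegral.norm_integral_le_of_norm_le (by norm_num) ?_
    ((intervalIntegrable_abs_rpow hp _ _).const_mul C)
  have : ∀ᵐ t : ℝ, t ≠ 0 := by
    rw [ae_iff]; simp
  filter_upwards [this] with t ht _ using hb t ht

theorem integrable_of_bound {E : Type*} [NormedAddCommGroup E] {f : ℝ → E} {C p : ℝ} (hp : -1 < p)
    (hm : AEStronglyMeasurable f) (a b : ℝ)
    (hb : ∀ τ, τ ≠ 0 → ‖f τ‖ ≤ C * |τ| ^ p) : IntervalIntegrable f volume a b := by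
  refine ((intervalIntegrable_abs_rpow hp a b).const_mul C).mono_fun hm.restrict ?_
  have : ∀ᵐ t : ℝ, t ≠ 0 := by
    rw [ae_iff]; simp
  filter_upwards [ae_restrict_of_ae this] with t ht
  exact (hb t ht).trans (le_abs_self _)

theorem one_div_pi_le : 1 / Real.pi ≤ 1 := by
  rw [div_le_one Real.pi_pos]; linarith [Real.pi_gt_three]

theorem ker_integrable {α η : ℝ} {γ γ' : ℝ → ℂ} (h : NC α η γ γ') {f : ℝ → ℝ} (hf : Continuous f)
    {A : ℝ} (hA : ∀ x, |f x| ≤ A) (x y : ℝ) :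
    IntervalIntegrable (fun τ => ker γ γ' x τ * f (y + τ)) volume (-4) 4 := by
  have hA0 : 0 ≤ A := (abs_nonneg _).trans (hA 0)
  have he := h.e0
  refine integrable_of_bound (C := 2 * η * A) (p := α - 1) (by linarith [h.ha]) ?_ _ _ ?_
  · exact ((h.ker_meas x).mul (hf.measurable.comp (by fun_prop))).aestronglyMeasurable
  · intro τ hτ
    rw [Real.norm_eq_abs, abs_mul]
    calc _ ≤ (2 * η * |τ| ^ (α - 1)) * A :=
          mul_le_mul (h.ker_bound x τ hτ) (hA _) (abs_nonneg _) (by positivity)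
      _ = _ := by ring

theorem kop_bound {α η : ℝ} {γ γ' : ℝ → ℂ} (h : NC α η γ γ') {f : ℝ → ℝ}
    {A : ℝ} (hA : ∀ x, |f x| ≤ A) (x : ℝ) : |kop γ γ' f x| ≤ 2 * η * cst α * A := by
  have hA0 : 0 ≤ A := (abs_nonneg _).trans (hA 0)
  have he := h.e0
  have h1 := int_le (f := fun τ => ker γ γ' x τ * f (x + τ)) (C := 2 * η * A) (p := α - 1)
    (by linarith [h.ha]) (fun τ hτ => by
      rw [abs_mul]
      calc _ ≤ (2 * η * |τ| ^ (α - 1)) * A :=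
            mul_le_mul (h.ker_bound x τ hτ) (hA _) (abs_nonneg _) (by positivity)
        _ = _ := by ring)
  rw [kop, abs_mul, abs_of_pos (by positivity : 0 < 1 / Real.pi)]
  have h2 := cst_nonneg (α / 2 - 1)
  have h3 := cst_nonneg (α - 1)
  calc _ ≤ 1 * (2 * η * A * ∫ τ in (-4 : ℝ)..4, |τ| ^ (α - 1)) :=
        mul_le_mul one_div_pi_le h1 (abs_nonneg _) (by norm_num)
    _ ≤ 2 * η * cst α * A := by
        rw [cst]
        have : 0 ≤ 2 * η * A * ∫ τ in (-4 : ℝ)..4, |τ| ^ (α / 2 - 1) := by positivity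
        linarith

theorem kop_holder {α η : ℝ} {γ γ' : ℝ → ℂ} (h : NC α η γ γ') {f : ℝ → ℝ} (hf : Continuous f)
    (hA : ∀ x, |f x| ≤ 1) (hB : ∀ x y, |f x - f y| ≤ |x - y| ^ (α / 2)) (x y : ℝ) :
    |kop γ γ' f x - kop γ γ' f y| ≤ 12 * η * cst α * |x - y| ^ (α / 2) := by
  have he := h.e0
  set d := |x - y| ^ (α / 2) with hd
  have hd0 : 0 ≤ d := by positivity
  have e : (∫ τ in (-4 : ℝ)..4, ker γ γ' x τ * f (x + τ)) -
      (∫ τ in (-4 : ℝ)..4, ker γ γ' y τ * f (y + τ)) =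
      (∫ τ in (-4 : ℝ)..4, (ker γ γ' x τ - ker γ γ' y τ) * f (x + τ)) +
      ∫ τ in (-4 : ℝ)..4, ker γ γ' y τ * (f (x + τ) - f (y + τ)) := by
    have i1 := h.ker_integrable hf hA x x
    have i2 := h.ker_integrable hf hA y x
    have i3 := h.ker_integrable hf hA y y
    simp only [sub_mul, mul_sub]
    rw [intervalIntegral.integral_sub i1 i2, intervalIntegral.integral_sub i2 i3]
    ring
  have h1 := int_le (f := fun τ => (ker γ γ' x τ - ker γ γ' y τ) * f (x + τ)) (C := 10 * η * d)
    (p := α / 2 - 1)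
    (by linarith [h.ha]) (fun τ hτ => by
      rw [abs_mul]
      calc _ ≤ (10 * η * d * |τ| ^ (α / 2 - 1)) * 1 :=
            mul_le_mul (h.ker_holder x y τ hτ) (hA _) (abs_nonneg _) (by positivity)
        _ = _ := by ring)
  have h2 := int_le (f := fun τ => ker γ γ' y τ * (f (x + τ) - f (y + τ))) (C := 2 * η * d)
    (p := α - 1)
    (by linarith [h.ha]) (fun τ hτ => by
      rw [abs_mul]
      have := hB (x + τ) (y + τ)
      simp only [add_sub_add_right_eq_sub] at this
      calc _ ≤ (2 * η * |τ| ^ (α - 1)) * d :=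
            mul_le_mul (h.ker_bound y τ hτ) this (abs_nonneg _) (by positivity)
        _ = _ := by ring)
  have h3 := cst_nonneg (α / 2 - 1)
  have h4 := cst_nonneg (α - 1)
  rw [kop, kop, ← mul_sub, e, abs_mul, abs_of_pos (by positivity : 0 < 1 / Real.pi)]
  calc _ ≤ 1 * ((10 * η * d * ∫ τ in (-4 : ℝ)..4, |τ| ^ (α / 2 - 1)) +
        (2 * η * d * ∫ τ in (-4 : ℝ)..4, |τ| ^ (α - 1))) :=
        mul_le_mul one_div_pi_le ((abs_add_le _ _).trans (add_le_add h1 h2)) (abs_nonneg _)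
          (by norm_num)
    _ ≤ _ := by
        rw [cst]
        have t1 : 0 ≤ η * d * ∫ τ in (-4 : ℝ)..4, |τ| ^ (α / 2 - 1) := by positivity
        have t2 : 0 ≤ η * d * ∫ τ in (-4 : ℝ)..4, |τ| ^ (α - 1) := by positivity
        linarith

theorem kop_sub {α η : ℝ} {γ γ' : ℝ → ℂ} (h : NC α η γ γ') {f g : ℝ → ℝ} (hf : Continuous f)
    (hg : Continuous g) {A : ℝ} (hA : ∀ x, |f x| ≤ A) (hB : ∀ x, |g x| ≤ A) (x : ℝ) :
    kop γ γ' f x - kop γ γ' g x = kop γ γ' (fun t => f t - g t) x := by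
  rw [kop, kop, kop, ← mul_sub, ← intervalIntegral.integral_sub (h.ker_integrable hf hA x x)
    (h.ker_integrable hg hB x x)]
  simp only [mul_sub]

/-- the cutoff -/
noncomputable def chi (x : ℝ) : ℝ := max 0 (min 1 (2 - |x|))

theorem chi_nonneg (x : ℝ) : 0 ≤ chi x := le_max_left _ _
theorem chi_le (x : ℝ) : chi x ≤ 1 := max_le (by norm_num) (min_le_left _ _)
theorem chi_one {x : ℝ} (hx : |x| ≤ 1) : chi x = 1 := by
  rw [chi, min_eq_left (by linarith), max_eq_right (by norm_num)]
theorem chi_zero {x : ℝ} (hx : 2 ≤ |x|) : chi x = 0 := by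
  rw [chi, max_eq_left]; exact (min_le_right _ _).trans (by linarith)
theorem chi_holder {β : ℝ} (hb : 0 < β) (hb1 : β < 1) (x y : ℝ) :
    |chi x - chi y| ≤ |x - y| ^ β := by
  have h1 : |chi x - chi y| ≤ |x - y| := by
    refine (abs_max_sub_max_le_max _ _ _ _).trans ?_
    refine max_le (by simp) ?_
    refine (abs_min_sub_min_le_max _ _ _ _).trans ?_
    refine max_le (by simp) ?_
    have : 2 - |x| - (2 - |y|) = |y| - |x| := by ring
    rw [this, abs_sub_comm x y]; exact abs_abs_sub_abs_le _ _
  rcases le_total |x - y| 1 with h2 | h2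
  · refine h1.trans ?_
    conv_lhs => rw [← Real.rpow_one |x - y|]
    exact Real.rpow_le_rpow_of_exponent_ge' (abs_nonneg _) h2 hb.le hb1.le
  · refine le_trans ?_ (Real.one_le_rpow h2 hb.le)
    rw [abs_le]; constructor <;> linarith [chi_nonneg x, chi_nonneg y, chi_le x, chi_le y]

theorem log_lip {z w : ℂ} (hz : ‖z - 1‖ ≤ 1 / 2) (hw : ‖w - 1‖ ≤ 1 / 2) :
    ‖Complex.log z - Complex.log w‖ ≤ 2 * ‖z - w‖ := by
  have hre : ∀ x ∈ Metric.closedBall (1 : ℂ) (1 / 2), 1 / 2 ≤ x.re := by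
    intro x hx
    rw [Metric.mem_closedBall, dist_eq_norm] at hx
    have := (abs_le.1 ((Complex.abs_re_le_norm _).trans hx)).1
    simp at this; linarith
  refine (convex_closedBall (1 : ℂ) (1 / 2)).norm_image_sub_le_of_norm_hasDerivWithin_le
    (f' := fun x => x⁻¹) (fun x hx => ?_) (fun x hx => ?_) ?_ ?_
  · refine (Complex.hasDerivAt_log ?_).hasDerivWithinAt
    left; linarith [hre x hx]
  · rw [norm_inv]
    have := (hre x hx).trans (Complex.re_le_norm x)
    calc ‖x‖⁻¹ ≤ (1 / 2 : ℝ)⁻¹ := inv_anti₀ (by norm_num) this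
      _ = 2 := by norm_num
  · rwa [Metric.mem_closedBall, dist_eq_norm]
  · rwa [Metric.mem_closedBall, dist_eq_norm]

noncomputable def th (γ' : ℝ → ℂ) (x : ℝ) : ℝ := (Complex.log (γ' x)).im

theorem th_bound {α η : ℝ} {γ γ' : ℝ → ℂ} (h : NC α η γ γ') (x : ℝ) : |th γ' x| ≤ 2 * η := by
  have h1 := log_lip (z := γ' x) (w := 1) ((h.near x).trans (by linarith [h.e1])) (by simp)
  rw [Complex.log_one, sub_zero] at h1
  exact (Complex.abs_im_le_norm _).trans (h1.trans (by linarith [h.near x]))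

theorem th_holder {α η : ℝ} {γ γ' : ℝ → ℂ} (h : NC α η γ γ') (x y : ℝ) :
    |th γ' x - th γ' y| ≤ 4 * η * |x - y| ^ (α / 2) := by
  have he := h.e0
  rcases le_total |x - y| 1 with h2 | h2
  · have h1 := log_lip (z := γ' x) (w := γ' y) ((h.near x).trans (by linarith [h.e1]))
      ((h.near y).trans (by linarith [h.e1]))
    rw [th, th, ← Complex.sub_im]
    refine (Complex.abs_im_le_norm _).trans (h1.trans ?_)
    have h3 := h.hol y x
    have h4 : |x - y| ^ α ≤ |x - y| ^ (α / 2) :=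
      Real.rpow_le_rpow_of_exponent_ge' (abs_nonneg _) h2 (by linarith [h.ha]) (by linarith [h.ha])
    have h5 : 0 ≤ |x - y| ^ α := by positivity
    nlinarith
  · have h1 := Real.one_le_rpow h2 (by linarith [h.ha] : 0 ≤ α / 2)
    have := abs_sub (th γ' x) (th γ' y)
    have := h.th_bound x
    have := h.th_bound y
    nlinarith

open BoundedContinuousFunction in
theorem exists_density {α η : ℝ} {γ γ' : ℝ → ℂ} (h : NC α η γ γ')
    (hη : η * (1 + cst α) ≤ 1 / 100) :
    ∃ ν : ℝ → ℝ, Continuous ν ∧ (∀ x, |ν x| ≤ 1) ∧ (∀ x y, |ν x - ν y| ≤ |x - y| ^ (α / 2)) ∧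
      (∀ x, 2 ≤ |x| → ν x = 0) ∧ ∀ x, |x| ≤ 1 → ν x + kop γ γ' ν x = - th γ' x := by
  have he := h.e0
  have hc0 : 0 ≤ cst α := add_nonneg (cst_nonneg _) (cst_nonneg _)
  have hec : 0 ≤ η * cst α := by positivity
  have ha := h.ha
  let S : Set (ℝ →ᵇ ℝ) := {f | (∀ x, |f x| ≤ 1) ∧ (∀ x y, |f x - f y| ≤ |x - y| ^ (α / 2)) ∧
    ∀ x, 2 ≤ |x| → f x = 0}
  have hev : ∀ x, Continuous fun f : ℝ →ᵇ ℝ => f x := fun x => continuous_eval_const (F := ℝ →ᵇ ℝ) x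
  have hS : IsClosed S := by
    have e : S = (⋂ x, {f : ℝ →ᵇ ℝ | |f x| ≤ 1}) ∩
        ((⋂ x, ⋂ y, {f : ℝ →ᵇ ℝ | |f x - f y| ≤ |x - y| ^ (α / 2)}) ∩
        ⋂ x, ⋂ (_ : 2 ≤ |x|), {f : ℝ →ᵇ ℝ | f x = 0}) := by
      ext f; simp [S]
    rw [e]
    refine IsClosed.inter ?_ (IsClosed.inter ?_ ?_)
    · exact isClosed_iInter fun x => isClosed_le (hev x).abs continuous_const
    · exact isClosed_iInter fun x => isClosed_iInter fun y =>
        isClosed_le ((hev x).sub (hev y)).abs continuous_const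
    · exact isClosed_iInter fun x => isClosed_iInter fun y => isClosed_eq (hev x) continuous_const
  let T : (ℝ → ℝ) → ℝ → ℝ := fun f x => - (chi x * (th γ' x + kop γ γ' f x))
  have hF : ∀ f ∈ S, ∀ x, |th γ' x + kop γ γ' f x| ≤ 2 * η + 2 * η * cst α := by
    intro f hf x
    have := abs_add_le (th γ' x) (kop γ γ' f x)
    have := h.th_bound x
    have := h.kop_bound hf.1 x
    linarith
  have hT1 : ∀ f ∈ S, ∀ x, |T f x| ≤ 1 := by
    intro f hf x
    show |-(chi x * _)| ≤ 1
    rw [abs_neg, abs_mul, abs_of_nonneg (chi_nonneg x)]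
    have := hF f hf x
    calc _ ≤ 1 * (2 * η + 2 * η * cst α) :=
        mul_le_mul (chi_le x) this (abs_nonneg _) (by norm_num)
      _ ≤ _ := by nlinarith
  have hT2 : ∀ f ∈ S, ∀ x y, |T f x - T f y| ≤ |x - y| ^ (α / 2) := by
    intro f hf x y
    have h1 := hF f hf x
    have h2 := chi_holder (β := α / 2) (by linarith) (by linarith [h.ha1]) x y
    have h3 := h.th_holder x y
    have h4 := h.kop_holder f.continuous hf.1 hf.2.1 x y
    have e : T f x - T f y = -((chi x - chi y) * (th γ' x + kop γ γ' f x) +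
      chi y * ((th γ' x - th γ' y) + (kop γ γ' f x - kop γ γ' f y))) := by
      simp only [T]; ring
    set d := |x - y| ^ (α / 2)
    have hd0 : 0 ≤ d := by positivity
    rw [e, abs_neg]
    refine (abs_add_le _ _).trans ?_
    rw [abs_mul, abs_mul, abs_of_nonneg (chi_nonneg y)]
    have t1 : |chi x - chi y| * |th γ' x + kop γ γ' f x| ≤ d * (2 * η + 2 * η * cst α) :=
      mul_le_mul h2 h1 (abs_nonneg _) hd0
    have t2 : chi y * |(th γ' x - th γ' y) + (kop γ γ' f x - kop γ γ' f y)| ≤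
        1 * (4 * η * d + 12 * η * cst α * d) :=
      mul_le_mul (chi_le y) ((abs_add_le _ _).trans (add_le_add h3 h4)) (abs_nonneg _) (by norm_num)
    have t3 : d * (6 * η + 14 * (η * cst α)) ≤ d * 1 :=
      mul_le_mul_of_nonneg_left (by nlinarith) hd0
    linarith
  have hT3 : ∀ f ∈ S, Continuous (T f) := by
    intro f hf
    rw [continuous_iff_continuousAt]
    intro y
    rw [ContinuousAt, tendsto_iff_norm_sub_tendsto_zero]
    have h1 : Tendsto (fun s => |s - y| ^ (α / 2)) (𝓝 y) (𝓝 0) := by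
      have h2 : Tendsto (fun s : ℝ => |s - y|) (𝓝 y) (𝓝 0) := by
        have : Continuous fun s : ℝ => |s - y| := by fun_prop
        simpa using this.tendsto y
      have h3 := (h2.rpow_const (p := α / 2) (Or.inr (by linarith)))
      rwa [Real.zero_rpow (by linarith)] at h3
    exact squeeze_zero (fun _ => norm_nonneg _) (fun s => hT2 f hf s y) h1
  let TT : S → S := fun f => ⟨BoundedContinuousFunction.ofNormedAddCommGroup (T f) (hT3 f f.2) 1
    (hT1 f f.2), hT1 f f.2, hT2 f f.2, fun x hx => by
      show -(chi x * _) = 0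
      rw [chi_zero hx]; simp⟩
  have hcon : ContractingWith (1 / 2) TT := by
    refine ⟨by rw [← NNReal.coe_lt_coe]; norm_num, ?_⟩
    refine LipschitzWith.of_dist_le_mul fun f g => ?_
    rw [Subtype.dist_eq, Subtype.dist_eq, BoundedContinuousFunction.dist_le (by positivity)]
    intro x
    show dist (T f x) (T g x) ≤ _
    have h1 : ∀ t, |f.1 t - g.1 t| ≤ dist f.1 g.1 := fun t =>
      BoundedContinuousFunction.dist_coe_le_dist (f := f.1) (g := g.1) t
    have h2 := h.kop_bound h1 x
    rw [← h.kop_sub f.1.continuous g.1.continuous f.2.1 g.2.1 x] at h2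
    have e : T f x - T g x = -(chi x * (kop γ γ' f x - kop γ γ' g x)) := by
      simp only [T]; ring
    rw [Real.dist_eq, e, abs_neg, abs_mul, abs_of_nonneg (chi_nonneg x)]
    have hd0 : 0 ≤ dist f.1 g.1 := dist_nonneg
    calc _ ≤ 1 * (2 * η * cst α * dist f.1 g.1) :=
          mul_le_mul (chi_le x) h2 (abs_nonneg _) (by norm_num)
      _ ≤ 1 / 2 * dist f.1 g.1 := by
          rw [one_mul]; exact mul_le_mul_of_nonneg_right (by nlinarith) hd0
      _ = _ := by simp
  have : CompleteSpace S := hS.completeSpace_coe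
  have : Nonempty S := ⟨⟨0, fun x => by simp, fun x y => by simp; positivity, fun x _ => rfl⟩⟩
  have hfix := hcon.fixedPoint_isFixedPt
  set ν := ContractingWith.fixedPoint TT hcon
  have hv : ∀ x, T ν x = ν.1 x := fun x => by
    have := congrArg (fun f : S => f.1 x) hfix
    exact this
  refine ⟨ν.1, ν.1.continuous, ν.2.1, ν.2.2.1, ν.2.2.2, fun x hx => ?_⟩
  have h1 := hv x
  simp only [T, chi_one hx] at h1
  linarith

end NC

end


section
open Complex Topology Filter Asymptotics MeasureTheory

namespace NC

/-- denominator -/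
noncomputable def den (γ : ℝ → ℂ) (w : ℂ) (τ : ℝ) : ℂ := γ (w.re + τ) - γ w.re - w.im * I

theorem den_cont {α η : ℝ} {γ γ' : ℝ → ℂ} (h : NC α η γ γ') (τ : ℝ) :
    Continuous fun w => den γ w τ := by
  have := h.cont
  unfold den; fun_prop

theorem den_cont' {α η : ℝ} {γ γ' : ℝ → ℂ} (h : NC α η γ γ') (w : ℂ) :
    Continuous fun τ => den γ w τ := by
  have := h.cont
  unfold den; fun_prop

theorem den_ne {α η : ℝ} {γ γ' : ℝ → ℂ} (h : NC α η γ γ') (w : ℂ) {τ : ℝ} (hτ : τ ≠ 0) :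
    den γ w τ ≠ 0 := by
  have := h.lower w.re τ w.im
  exact norm_pos_iff.1 (lt_of_lt_of_le (by positivity) this)

theorem den_slit {α η : ℝ} {γ γ' : ℝ → ℂ} (h : NC α η γ γ') (w : ℂ) {τ : ℝ}
    (hτ : τ ≠ 0 ∨ 0 < w.im) : I * den γ w τ ∈ slitPlane := by
  by_cases h0 : τ = 0
  · have h1 := hτ.resolve_left (by simpa using h0)
    left; simp [den, h0]; exact h1
  · right
    have e : (I * den γ w τ).im = (γ (w.re + τ) - γ w.re).re := by simp [den]
    rw [e]
    rcases lt_or_gt_of_ne h0 with h2 | h2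
    · have := h.re_sub_pos (x := w.re + τ) (y := w.re) (by linarith)
      have e2 : (γ (w.re + τ) - γ w.re).re = -(γ w.re - γ (w.re + τ)).re := by simp
      rw [e2]; apply ne_of_lt; linarith
    · have := h.re_sub_pos (x := w.re) (y := w.re + τ) (by linarith)
      apply ne_of_gt; linarith

noncomputable def Lam (γ : ℝ → ℂ) (w : ℂ) : ℂ :=
  Complex.log (I * den γ w 4) - Complex.log (I * den γ w (-4))

noncomputable def Lfun (γ γ' : ℝ → ℂ) (ν : ℝ → ℝ) (w : ℂ) : ℂ :=
  (1 / Real.pi : ℝ) * (ν w.re * Lam γ w +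
    ∫ τ in (-4 : ℝ)..4, ((ν (w.re + τ) - ν w.re : ℝ) : ℂ) * (γ' (w.re + τ) / den γ w τ))

theorem int_bound {α η : ℝ} {γ γ' : ℝ → ℂ} (h : NC α η γ γ') {ν : ℝ → ℝ}
    (hν2 : ∀ x y, |ν x - ν y| ≤ |x - y| ^ (α / 2)) (w : ℂ) (τ : ℝ) (hτ : τ ≠ 0) :
    ‖((ν (w.re + τ) - ν w.re : ℝ) : ℂ) * (γ' (w.re + τ) / den γ w τ)‖ ≤ 4 * |τ| ^ (α / 2 - 1) := by
  have hp : 0 < |τ| := abs_pos.2 hτ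
  rw [norm_mul, norm_div, Complex.norm_real, Real.norm_eq_abs]
  have h1 := hν2 (w.re + τ) w.re
  rw [add_sub_cancel_left] at h1
  have h2 : ‖γ' (w.re + τ)‖ / ‖den γ w τ‖ ≤ 2 / (|τ| / 2) :=
    div_le_div₀ (by norm_num) (h.norm_le_two _) (by positivity) (h.lower w.re τ w.im)
  rw [Real.rpow_sub_one hp.ne']
  calc _ ≤ |τ| ^ (α / 2) * (2 / (|τ| / 2)) := mul_le_mul h1 h2 (by positivity) (by positivity)
    _ = _ := by field_simp; norm_num

theorem ae_ne_zero : ∀ᵐ t : ℝ, t ≠ 0 := by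
  rw [ae_iff]; simp

theorem int_meas {α η : ℝ} {γ γ' : ℝ → ℂ} (h : NC α η γ γ') {ν : ℝ → ℝ} (hν : Continuous ν) (w : ℂ) :
    Measurable fun τ : ℝ => ((ν (w.re + τ) - ν w.re : ℝ) : ℂ) * (γ' (w.re + τ) / den γ w τ) := by
  have h1 := (h.den_cont' w).measurable
  have h2 := h.cont'
  have h3 : Measurable fun τ : ℝ => γ' (w.re + τ) :=
    (by fun_prop : Continuous fun τ : ℝ => γ' (w.re + τ)).measurable
  have h4 : Measurable fun τ : ℝ => ((ν (w.re + τ) - ν w.re : ℝ) : ℂ) :=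
    (by fun_prop : Continuous fun τ : ℝ => ((ν (w.re + τ) - ν w.re : ℝ) : ℂ)).measurable
  exact h4.mul (h3.div h1)

theorem Lfun_cont {α η : ℝ} {γ γ' : ℝ → ℂ} (h : NC α η γ γ') {ν : ℝ → ℝ} (hν : Continuous ν)
    (hν2 : ∀ x y, |ν x - ν y| ≤ |x - y| ^ (α / 2)) : Continuous (Lfun γ γ' ν) := by
  have h1 : Continuous fun w => Complex.log (I * den γ w 4) :=
    (continuous_const.mul (h.den_cont 4)).clog fun w => h.den_slit w (Or.inl (by norm_num))
  have h2 : Continuous fun w => Complex.log (I * den γ w (-4)) :=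
    (continuous_const.mul (h.den_cont (-4))).clog fun w => h.den_slit w (Or.inl (by norm_num))
  have h3 : Continuous fun w : ℂ =>
      ∫ τ in (-4 : ℝ)..4, ((ν (w.re + τ) - ν w.re : ℝ) : ℂ) * (γ' (w.re + τ) / den γ w τ) := by
    refine intervalIntegral.continuous_of_dominated_interval
      (bound := fun τ => 4 * |τ| ^ (α / 2 - 1)) ?_ ?_ ?_ ?_
    · intro w
      exact (h.int_meas hν w).aestronglyMeasurable
    · intro w
      filter_upwards [ae_ne_zero] with τ hτ _ using h.int_bound hν2 w τ hτ
    · exact (intervalIntegrable_abs_rpow (by linarith [h.ha]) _ _).const_mul _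
    · filter_upwards [ae_ne_zero] with τ hτ _
      have h5 := h.cont'
      have h6 := h.den_cont τ
      refine Continuous.mul (by fun_prop) (Continuous.div (by fun_prop) h6 fun w => h.den_ne w hτ)
  unfold Lfun Lam
  exact continuous_const.mul (((by fun_prop : Continuous fun w : ℂ => (ν w.re : ℂ)).mul
    (h1.sub h2)).add h3)

noncomputable def ell (γ γ' : ℝ → ℂ) (ν : ℝ → ℝ) (z : ℂ) : ℂ :=
  (1 / Real.pi : ℝ) * ∫ t in (-3 : ℝ)..3, ν t * (γ' t / (γ t - z))

theorem Lfun_eq {α η : ℝ} {γ γ' : ℝ → ℂ} (h : NC α η γ γ') {ν : ℝ → ℝ} (hν : Continuous ν)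
    (hν3 : ∀ x, 2 ≤ |x| → ν x = 0)
    {w : ℂ} (hw : |w.re| < 1) (hw2 : 0 < w.im) :
    Lfun γ γ' ν w = ell γ γ' ν (γ w.re + w.im * I) := by
  have hne : ∀ τ, den γ w τ ≠ 0 := fun τ h0 => by
    have := h.den_slit w (τ := τ) (Or.inr hw2)
    rw [h0, mul_zero] at this
    exact zero_notMem_slitPlane this
  have hc' := h.cont'
  have hcd := h.den_cont' w
  have e1 : ∫ τ in (-4 : ℝ)..4, γ' (w.re + τ) / den γ w τ = Lam γ w := by
    rw [Lam]
    refine intervalIntegral.integral_eq_sub_of_hasDerivAt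
      (f := fun τ => Complex.log (I * den γ w τ)) (fun τ _ => ?_) ?_
    · have h1 : HasDerivAt (fun τ => I * den γ w τ) (I * γ' (w.re + τ)) τ := by
        refine HasDerivAt.const_mul I ?_
        exact (((h.hd (w.re + τ)).comp_const_add w.re τ).sub_const _).sub_const _
      refine (h1.clog_real (h.den_slit w (Or.inr hw2))).congr_deriv ?_
      rw [mul_div_mul_left _ _ I_ne_zero]
    · exact (Continuous.div (by fun_prop) hcd hne).intervalIntegrable _ _
  have i1 : IntervalIntegrable (fun τ : ℝ => ((ν (w.re + τ) - ν w.re : ℝ) : ℂ) *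
      (γ' (w.re + τ) / den γ w τ)) volume (-4) 4 :=
    (Continuous.mul (by fun_prop) (Continuous.div (by fun_prop) hcd hne)).intervalIntegrable _ _
  have i2 : IntervalIntegrable (fun τ : ℝ => (ν w.re : ℂ) *
      (γ' (w.re + τ) / den γ w τ)) volume (-4) 4 :=
    (Continuous.mul (by fun_prop) (Continuous.div (by fun_prop) hcd hne)).intervalIntegrable _ _
  rw [Lfun, ell, ← e1, ← intervalIntegral.integral_const_mul,
    ← intervalIntegral.integral_add i2 i1]
  congr 1
  have e2 : ∀ τ : ℝ, (ν w.re : ℂ) * (γ' (w.re + τ) / den γ w τ) +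
      ((ν (w.re + τ) - ν w.re : ℝ) : ℂ) * (γ' (w.re + τ) / den γ w τ) =
      (fun t : ℝ => ν t * (γ' t / (γ t - (γ w.re + w.im * I)))) (w.re + τ) := by
    intro τ
    simp only [den]
    push_cast
    rw [sub_sub]; ring
  simp only [e2]
  rw [intervalIntegral.integral_comp_add_left
    (fun t : ℝ => (ν t : ℂ) * (γ' t / (γ t - (γ w.re + w.im * I)))) w.re]
  have hsup : Function.support (fun t : ℝ => (ν t : ℂ) * (γ' t / (γ t - (γ w.re + w.im * I)))) ⊆
      Set.Ioo (-2) 2 := by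
    intro t ht
    by_contra h4
    apply ht
    have : 2 ≤ |t| := by
      by_contra h5
      exact h4 (abs_lt.1 (not_le.1 h5))
    simp [hν3 t this]
  have := abs_lt.1 hw
  rw [intervalIntegral.integral_eq_integral_of_support_subset,
    intervalIntegral.integral_eq_integral_of_support_subset]
  · intro t ht
    have := hsup ht
    exact ⟨by linarith [this.1], by linarith [this.2]⟩
  · intro t ht
    have := hsup ht
    exact ⟨by linarith [this.1], by linarith [this.2]⟩

theorem ell_diff {α η : ℝ} {γ γ' : ℝ → ℂ} (h : NC α η γ γ') {ν : ℝ → ℝ} (hν : Continuous ν)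
    (hν1 : ∀ x, |ν x| ≤ 1) {z : ℂ} {r : ℝ} (hr : 0 < r) (hz : ∀ t, 2 * r ≤ ‖γ t - z‖) :
    DifferentiableAt ℂ (ell γ γ' ν) z := by
  have hc := h.cont
  have hc' := h.cont'
  have hlow : ∀ t, ∀ y ∈ Metric.ball z r, r ≤ ‖γ t - y‖ := by
    intro t y hy
    have h1 := hz t
    have h2 := norm_sub_norm_le (γ t - z) (y - z)
    rw [Metric.mem_ball, dist_eq_norm] at hy
    have : γ t - z - (y - z) = γ t - y := by ring
    rw [this] at h2
    linarith
  have hne : ∀ t, ∀ y ∈ Metric.ball z r, γ t - y ≠ 0 := fun t y hy =>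
    norm_pos_iff.1 (lt_of_lt_of_le hr (hlow t y hy))
  have hz0 := Metric.mem_ball_self hr (x := z)
  have key := intervalIntegral.hasDerivAt_integral_of_dominated_loc_of_deriv_le
    (F := fun y (t : ℝ) => (ν t : ℂ) * (γ' t / (γ t - y)))
    (F' := fun y (t : ℝ) => (ν t : ℂ) * (γ' t / (γ t - y) ^ 2)) (x₀ := z) (a := -3) (b := 3)
    (μ := volume) (s := Metric.ball z r)
    (bound := fun _ => 2 / r ^ 2) (Metric.ball_mem_nhds z hr) ?_ ?_ ?_ ?_ ?_ ?_
  · exact (key.2.const_mul _).differentiableAt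
  · filter_upwards [Metric.ball_mem_nhds z hr] with y hy
    exact (Continuous.mul (by fun_prop) (Continuous.div (by fun_prop) (by fun_prop)
      fun t => hne t y hy)).aestronglyMeasurable
  · exact (Continuous.mul (by fun_prop) (Continuous.div (by fun_prop) (by fun_prop)
      fun t => hne t z hz0)).intervalIntegrable _ _
  · exact (Continuous.mul (by fun_prop) (Continuous.div (by fun_prop) (by fun_prop)
      fun t => pow_ne_zero 2 (hne t z hz0))).aestronglyMeasurable
  · refine Eventually.of_forall fun t _ y hy => ?_
    rw [norm_mul, norm_div, norm_pow, Complex.norm_real, Real.norm_eq_abs]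
    calc _ ≤ 1 * (2 / r ^ 2) := mul_le_mul (hν1 t)
          (div_le_div₀ (by norm_num) (h.norm_le_two t) (by positivity)
            (pow_le_pow_left₀ hr.le (hlow t y hy) 2)) (by positivity) (by norm_num)
      _ = _ := one_mul _
  · exact _root_.intervalIntegrable_const
  · refine Eventually.of_forall fun t _ y hy => ?_
    have h1 : HasDerivAt (fun y => γ t - y) (-1) y := by
      simpa using (hasDerivAt_id y).const_sub (γ t)
    have h2 := ((h1.inv (hne t y hy)).const_mul (γ' t)).const_mul (ν t : ℂ)
    refine (h2.congr_deriv ?_)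
    field_simp

/-- the integral of the kernel -/
theorem ker_integral {α η : ℝ} {γ γ' : ℝ → ℂ} (h : NC α η γ γ') (x : ℝ) :
    ∫ τ in (-4 : ℝ)..4, ker γ γ' x τ = (Lam γ x).im - Real.pi := by
  set q : ℝ → ℂ := dslope (fun τ => γ (x + τ)) 0 with hq
  have hd0 : ∀ τ, HasDerivAt (fun τ => γ (x + τ)) (γ' (x + τ)) τ :=
    fun τ => (h.hd (x + τ)).comp_const_add x τ
  have hqn : ∀ τ : ℝ, τ ≠ 0 → q τ = (γ (x + τ) - γ x) / τ := by
    intro τ hτ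
    rw [hq, dslope_of_ne _ hτ, slope_def_module]
    simp [div_eq_inv_mul]
  have hq1 : ∀ τ, ‖q τ - 1‖ ≤ 1 / 2 := by
    intro τ
    by_cases h0 : τ = 0
    · rw [h0, hq, dslope_same, (hd0 0).deriv]
      exact (h.near _).trans (by linarith [h.e1])
    · rw [hqn τ h0]
      have h1 := h.lip' x τ
      have hp : 0 < |τ| := abs_pos.2 h0
      have hτ' : (τ : ℂ) ≠ 0 := by exact_mod_cast h0
      have e : (γ (x + τ) - γ x) / τ - 1 = (γ (x + τ) - γ x - τ) / τ := by field_simp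
      rw [e, norm_div, Complex.norm_real, Real.norm_eq_abs, div_le_iff₀ hp]
      nlinarith [h.e1]
  have hqs : ∀ τ, q τ ∈ slitPlane := by
    intro τ
    left
    have := (abs_le.1 ((Complex.abs_re_le_norm _).trans (hq1 τ))).1
    simp at this; linarith
  have hqc : Continuous q := by
    rw [continuous_iff_continuousAt]
    intro τ
    by_cases h0 : τ = 0
    · rw [h0, hq, continuousAt_dslope_same]; exact (hd0 0).differentiableAt
    · rw [hq, continuousAt_dslope_of_ne h0]; exact (hd0 τ).continuousAt
  have hcc : Continuous fun τ => (Complex.log (q τ)).im :=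
    Complex.continuous_im.comp (hqc.clog hqs)
  have hder : ∀ τ : ℝ, τ ≠ 0 → HasDerivAt (fun τ => (Complex.log (q τ)).im) (ker γ γ' x τ) τ := by
    intro τ h0
    have hτ' : (τ : ℂ) ≠ 0 := by exact_mod_cast h0
    have hp : 0 < |τ| := abs_pos.2 h0
    have hl := h.lower x τ 0
    simp only [Complex.ofReal_zero, zero_mul, sub_zero] at hl
    have hne : γ (x + τ) - γ x ≠ 0 := norm_pos_iff.1 (by linarith)
    have h1 : HasDerivAt q ((γ' (x + τ) * τ - (γ (x + τ) - γ x) * 1) / (τ : ℂ) ^ 2) τ := by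
      have h2 := ((hd0 τ).sub_const (γ x)).div (Complex.ofRealCLM.hasDerivAt (x := τ)) hτ'
      simp only [Complex.ofRealCLM_apply, Complex.ofReal_one] at h2
      refine h2.congr_of_eventuallyEq ?_
      filter_upwards [isOpen_ne.mem_nhds h0] with t ht using hqn t ht
    have h3 := h1.clog_real (hqs τ)
    have h4 := Complex.imCLM.hasFDerivAt.comp_hasDerivAt τ h3
    refine h4.congr_deriv ?_
    rw [ker, hqn τ h0]
    have e : (γ' (x + τ) * τ - (γ (x + τ) - γ x) * 1) / (τ : ℂ) ^ 2 / ((γ (x + τ) - γ x) / τ) =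
      γ' (x + τ) / (γ (x + τ) - γ x) - ((1 / τ : ℝ) : ℂ) := by
      push_cast; field_simp
    rw [e, Complex.imCLM_apply, Complex.sub_im, Complex.ofReal_im, sub_zero]
  have hintg : IntervalIntegrable (fun τ => ker γ γ' x τ) volume (-4) 4 := by
    have := h.ker_integrable (f := fun _ => 1) continuous_const (A := 1) (by simp) x x
    simpa using this
  have key := integral_eq_of_hasDerivAt_off_countable (fun τ => (Complex.log (q τ)).im)
    (fun τ => ker γ γ' x τ) (a := -4) (b := 4) (Set.countable_singleton (0 : ℝ)) hcc.continuousOn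
    (fun τ hτ => hder τ (fun h0 => hτ.2 (by simp [h0]))) hintg
  rw [key, hqn 4 (by norm_num), hqn (-4) (by norm_num), Lam]
  have eA : ∀ A : ℂ, 0 < A.re → Complex.log (I * A) = I * (Real.pi / 2) + Complex.log A := by
    intro A hA
    have hA0 : A ≠ 0 := fun h0 => by rw [h0] at hA; simp at hA
    have harg := Complex.abs_arg_lt_pi_div_two_iff.2 (Or.inl hA)
    have h2 := abs_lt.1 harg
    rw [Complex.log_mul I_ne_zero hA0, Complex.log_I]
    · ring
    · rw [Complex.arg_I]; constructor <;> linarith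
  have eB : ∀ A : ℂ, 0 < A.re → Complex.log (-I * A) = -(I * (Real.pi / 2)) + Complex.log A := by
    intro A hA
    have hA0 : A ≠ 0 := fun h0 => by rw [h0] at hA; simp at hA
    have harg := Complex.abs_arg_lt_pi_div_two_iff.2 (Or.inl hA)
    have h2 := abs_lt.1 harg
    rw [Complex.log_mul (neg_ne_zero.2 I_ne_zero) hA0, Complex.log_neg_I]
    · ring
    · rw [Complex.arg_neg_I]; constructor <;> linarith
  have p4 := h.re_sub_pos (x := x) (y := x + 4) (by linarith)
  have m4 := h.re_sub_pos (x := x - 4) (y := x) (by linarith)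
  have d4 : I * den γ x 4 = I * ((4 : ℝ) * ((γ (x + 4) - γ x) / (4 : ℝ))) := by
    simp [den]; ring
  have dm4 : I * den γ x (-4) = -I * ((4 : ℝ) * ((γ (x - 4) - γ x) / (-4 : ℝ))) := by
    simp [den, ← sub_eq_add_neg]; ring
  have hA1 : (γ (x + 4) - γ x) / (4 : ℝ) ≠ 0 := fun h0 => by
    have : γ (x + 4) - γ x = 0 := by
      simpa using h0
    rw [this] at p4; simp at p4; linarith
  have hB1 : (γ (x - 4) - γ x) / (-4 : ℝ) ≠ 0 := fun h0 => by
    have : γ (x - 4) - γ x = 0 := by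
      simpa using h0
    rw [sub_eq_zero.1 this] at m4; simp at m4; linarith
  rw [d4, dm4, eA, eB, Complex.log_ofReal_mul (by norm_num) hA1,
    Complex.log_ofReal_mul (by norm_num) hB1]
  · simp [← sub_eq_add_neg]; ring
  · have : (((4 : ℝ) : ℂ) * ((γ (x - 4) - γ x) / ((-4 : ℝ) : ℂ))) = γ x - γ (x - 4) := by
      push_cast; ring
    rw [this]; linarith
  · have : (((4 : ℝ) : ℂ) * ((γ (x + 4) - γ x) / ((4 : ℝ) : ℂ))) = γ (x + 4) - γ x := by
      push_cast; ring
    rw [this]; linarith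

theorem Lfun_im {α η : ℝ} {γ γ' : ℝ → ℂ} (h : NC α η γ γ') {ν : ℝ → ℝ} (hν : Continuous ν)
    (hν1 : ∀ x, |ν x| ≤ 1)
    (hν2 : ∀ x y, |ν x - ν y| ≤ |x - y| ^ (α / 2)) (x : ℝ) :
    (Lfun γ γ' ν x).im = ν x + kop γ γ' ν x := by
  have i1 : IntervalIntegrable (fun τ : ℝ => ((ν (x + τ) - ν x : ℝ) : ℂ) *
      (γ' (x + τ) / den γ x τ)) volume (-4) 4 :=
    integrable_of_bound (p := α / 2 - 1) (C := 4) (by linarith [h.ha])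
      (h.int_meas hν x).aestronglyMeasurable _ _ fun τ hτ => h.int_bound hν2 x τ hτ
  have e1 : (∫ τ in (-4 : ℝ)..4, ((ν (x + τ) - ν x : ℝ) : ℂ) * (γ' (x + τ) / den γ x τ)).im =
      ∫ τ in (-4 : ℝ)..4, (ker γ γ' x τ * ν (x + τ) - ν x * ker γ γ' x τ) := by
    have := Complex.imCLM.intervalIntegral_comp_comm i1
    rw [Complex.imCLM_apply] at this
    rw [← this]
    refine intervalIntegral.integral_congr fun τ _ => ?_
    simp only [Complex.imCLM_apply, Complex.im_ofReal_mul, ker, den, Complex.ofReal_im,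
      Complex.ofReal_re, Complex.ofReal_zero, zero_mul, sub_zero]
    ring
  have hintg : IntervalIntegrable (fun τ => ker γ γ' x τ) volume (-4) 4 := by
    have := h.ker_integrable (f := fun _ => 1) continuous_const (A := 1) (by simp) x x
    simpa using this
  rw [intervalIntegral.integral_sub (h.ker_integrable hν hν1 x x) (hintg.const_mul _),
    intervalIntegral.integral_const_mul, h.ker_integral x] at e1
  rw [Lfun, Complex.im_ofReal_mul, Complex.add_im]
  simp only [Complex.ofReal_re]
  rw [e1, Complex.im_ofReal_mul, kop]
  have := Real.pi_ne_zero
  field_simp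
  ring

/-- `C^{1,α}` curve straightening: the derivative of a conformal map, up to the boundary. -/
theorem exists_h {α η : ℝ} {γ γ' : ℝ → ℂ} (h : NC α η γ γ')
    (hη : η * (1 + cst α) ≤ 1 / 100) :
    ∃ H hh : ℂ → ℂ, Continuous H ∧ (∀ w, H w ≠ 0) ∧ H 0 = 1 ∧
      (∀ z, ∀ r > 0, (∀ t, 2 * r ≤ ‖γ t - z‖) → DifferentiableAt ℂ hh z) ∧
      (∀ w : ℂ, |w.re| < 1 → 0 < w.im → H w = hh (γ w.re + w.im * I)) ∧
      ∀ x : ℝ, |x| ≤ 1 → ∃ p : ℝ, 0 < p ∧ H x * γ' x = p := by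
  obtain ⟨ν, hν, hν1, hν2, hν3, hν4⟩ := h.exists_density hη
  set L := Lfun γ γ' ν
  have hp : ∀ x : ℝ, |x| ≤ 1 → ∃ p : ℝ, 0 < p ∧ Complex.exp (L x) * γ' x = p := by
    intro x hx
    have hne : γ' x ≠ 0 := fun h0 => by
      have := h.near x
      rw [h0] at this; simp at this; linarith [h.e1]
    refine ⟨Real.exp (L x + Complex.log (γ' x)).re, Real.exp_pos _, ?_⟩
    have him : (L x + Complex.log (γ' x)).im = 0 := by
      rw [Complex.add_im, h.Lfun_im hν hν1 hν2 x, hν4 x hx, th]; ring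
    have e : L x + Complex.log (γ' x) = ((L x + Complex.log (γ' x)).re : ℂ) := by
      apply Complex.ext
      · simp
      · rw [him]; simp
    rw [Complex.ofReal_exp, ← e, Complex.exp_add, Complex.exp_log hne]
  obtain ⟨p0, hp0, hp1⟩ := hp 0 (by simp)
  rw [h.h1, mul_one, Complex.ofReal_zero] at hp1
  have hp2 : (p0 : ℂ) ≠ 0 := by exact_mod_cast hp0.ne'
  refine ⟨fun w => Complex.exp (L w) / p0, fun z => Complex.exp (ell γ γ' ν z) / p0, ?_, ?_, ?_, ?_,
    ?_, ?_⟩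
  · exact (Complex.continuous_exp.comp (h.Lfun_cont hν hν2)).div_const _
  · exact fun w => div_ne_zero (Complex.exp_ne_zero _) hp2
  · show Complex.exp (L 0) / p0 = 1
    rw [hp1, div_self hp2]
  · intro z r hr hz
    exact ((h.ell_diff hν hν1 hr hz).cexp).div_const _
  · intro w h1 h2
    show Complex.exp (Lfun γ γ' ν w) / p0 = _
    rw [h.Lfun_eq hν hν3 h1 h2]
  · intro x hx
    obtain ⟨p, hp, he⟩ := hp x hx
    refine ⟨p / p0, div_pos hp hp0, ?_⟩
    show Complex.exp (L x) / p0 * γ' x = _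
    rw [div_mul_eq_mul_div, he]; simp

end NC

end


section
open Complex Topology Filter Asymptotics MeasureTheory

theorem near_id_homeo {f : ℂ → ℂ} (hf : ∀ w v, ‖f w - f v - (w - v)‖ ≤ 1 / 2 * ‖w - v‖) :
    ∃ e : ℂ ≃ₜ ℂ, ∀ w, e w = f w := by
  have h1 : ApproximatesLinearOn f ((ContinuousLinearEquiv.refl ℂ ℂ : ℂ ≃L[ℂ] ℂ) : ℂ →L[ℂ] ℂ)
      Set.univ (1 / 2 : NNReal) := by
    intro x _ y _
    simpa using hf x y
  refine ⟨h1.toHomeomorph f ?_, fun w => rfl⟩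
  right
  have : ‖((ContinuousLinearEquiv.refl ℂ ℂ).symm : ℂ →L[ℂ] ℂ)‖₊ = 1 := by
    rw [ContinuousLinearEquiv.refl_symm]
    rw [← NNReal.coe_inj, coe_nnnorm]
    exact ContinuousLinearMap.norm_id
  rw [this, ← NNReal.coe_lt_coe]; norm_num

theorem schwarz_reflection {F : ℂ → ℂ} {R : ℝ}
    (hc : ContinuousOn F ({z | 0 ≤ z.im} ∩ Metric.ball 0 R))
    (hd : ∀ z ∈ Metric.ball (0 : ℂ) R, 0 < z.im → DifferentiableAt ℂ F z)
    (hre : ∀ x : ℝ, |x| < R → (F x).re = 0) :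
    ∃ E : ℂ → ℂ, DifferentiableOn ℂ E (Metric.ball 0 R) ∧
      ∀ z ∈ Metric.ball (0 : ℂ) R, 0 ≤ z.im → E z = F z := by
  classical
  set B := Metric.ball (0 : ℂ) R with hB
  set F2 : ℂ → ℂ := fun z => -(starRingEnd ℂ) (F ((starRingEnd ℂ) z)) with hF2
  set E : ℂ → ℂ := fun z => if 0 ≤ z.im then F z else F2 z with hE
  have hconjB : ∀ z ∈ B, (starRingEnd ℂ) z ∈ B := by
    intro z hz
    simp only [hB, mem_ball_zero_iff] at hz ⊢
    simpa using hz
  have hEu : ∀ z, 0 ≤ z.im → E z = F z := fun z hz => by simp only [hE, if_pos hz]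
  have hEl : ∀ z ∈ B, z.im ≤ 0 → E z = F2 z := by
    intro z hzB hz
    rcases eq_or_lt_of_le hz with h0 | h0
    · rw [hEu z h0.ge]
      have e : z = (z.re : ℂ) := by apply Complex.ext <;> simp [h0]
      have hr : |z.re| < R := by
        rw [hB, mem_ball_zero_iff] at hzB
        exact (Complex.abs_re_le_norm z).trans_lt hzB
      have := hre z.re hr
      rw [e, hF2]
      apply Complex.ext
      · simp [this]
      · simp
    · simp only [hE, if_neg (not_le.2 h0)]
  have hc2 : ContinuousOn F2 ({z | z.im ≤ 0} ∩ B) := by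
    refine (Complex.continuous_conj.comp_continuousOn (hc.comp Complex.continuous_conj.continuousOn
      ?_)).neg
    rintro z ⟨hz1, hz2⟩
    exact ⟨by simpa using hz1, hconjB z hz2⟩
  have hd2 : ∀ z ∈ B, z.im < 0 → DifferentiableAt ℂ F2 z := by
    intro z hz h0
    have h1 := hd _ (hconjB z hz) (by simpa using h0)
    have h2 := (differentiableAt_conj_conj_iff (f := F) (x := (starRingEnd ℂ) z)).2
    have h3 : DifferentiableAt ℂ (fun y => (starRingEnd ℂ) (F ((starRingEnd ℂ) y))) z := by
      have := h1.conj_conj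
      simpa [Function.comp_def] using this
    exact h3.neg
  have hA1 : ContinuousOn E ({z | 0 ≤ z.im} ∩ B) := hc.congr fun z hz => hEu z hz.1
  have hA2 : ContinuousOn E ({z | z.im ≤ 0} ∩ B) := hc2.congr fun z hz => hEl z hz.2 hz.1
  have hEc : ContinuousOn E B := by
    intro z hz
    have hu : B = ({z | 0 ≤ z.im} ∩ B) ∪ ({z | z.im ≤ 0} ∩ B) := by
      ext y; simp only [Set.mem_union, Set.mem_inter_iff, Set.mem_ofPred_eq]
      have := le_total 0 y.im; tauto
    rw [hu]
    refine ContinuousWithinAt.union ?_ ?_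
    · by_cases h0 : 0 ≤ z.im
      · exact hA1 z ⟨h0, hz⟩
      · refine (continuousWithinAt_of_notMem_closure fun h1 => h0 ?_)
        have : IsClosed {z : ℂ | 0 ≤ z.im} := isClosed_le continuous_const Complex.continuous_im
        exact (closure_minimal Set.inter_subset_left this) h1
    · by_cases h0 : z.im ≤ 0
      · exact hA2 z ⟨h0, hz⟩
      · refine (continuousWithinAt_of_notMem_closure fun h1 => h0 ?_)
        have : IsClosed {z : ℂ | z.im ≤ 0} := isClosed_le Complex.continuous_im continuous_const
        exact (closure_minimal Set.inter_subset_left this) h1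
  have hEd : ∀ z ∈ B, z.im ≠ 0 → DifferentiableAt ℂ E z := by
    intro z hz h0
    rcases lt_or_gt_of_ne h0 with h1 | h1
    · refine (hd2 z hz h1).congr_of_eventuallyEq ?_
      filter_upwards [(isOpen_lt Complex.continuous_im continuous_const).mem_nhds h1] with y hy
      simp only [hE, if_neg (not_le.2 hy)]
    · refine (hd z hz h1).congr_of_eventuallyEq ?_
      filter_upwards [(isOpen_lt continuous_const Complex.continuous_im).mem_nhds h1] with y hy
      exact hEu y (le_of_lt hy)
  let Bd : ℂ → ℂ → ℂ := fun z w =>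
    (∫ x : ℝ in z.re..w.re, E (x + z.im * I)) - (∫ x : ℝ in z.re..w.re, E (x + w.im * I)) +
      I • (∫ y : ℝ in z.im..w.im, E (w.re + y * I)) - I • (∫ y : ℝ in z.im..w.im, E (z.re + y * I))
  have hside : ∀ z w : ℂ, ((Set.uIcc z.re w.re) ×ℂ (Set.uIcc z.im w.im)) ⊆ B →
      ((0 ≤ z.im ∧ 0 ≤ w.im) ∨ (z.im ≤ 0 ∧ w.im ≤ 0)) → Bd z w = 0 := by
    intro z w hs hor
    refine integral_boundary_rect_eq_zero_of_continuousOn_of_differentiableOn E z w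
      (hEc.mono hs) fun y hy => (hEd y ?_ ?_).differentiableWithinAt
    · apply hs
      refine ⟨?_, ?_⟩
      · exact ⟨hy.1.1.le, hy.1.2.le⟩
      · exact ⟨hy.2.1.le, hy.2.2.le⟩
    · have h1 := hy.2.1
      have h2 := hy.2.2
      rcases hor with ⟨ha, hb⟩ | ⟨ha, hb⟩
      · have := le_min ha hb; exact ne_of_gt (by linarith)
      · have := max_le ha hb; exact ne_of_lt (by linarith)
  have hvert : ∀ z w : ℂ, ((Set.uIcc z.re w.re) ×ℂ (Set.uIcc z.im w.im)) ⊆ B → 0 ∈ (Set.uIcc z.im w.im) →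
      Bd z w = 0 := by
    intro z w hs h0
    have r1 : (Set.uIcc z.im 0) ⊆ (Set.uIcc z.im w.im) := Set.uIcc_subset_uIcc Set.left_mem_uIcc h0
    have r2 : (Set.uIcc 0 w.im) ⊆ (Set.uIcc z.im w.im) := Set.uIcc_subset_uIcc h0 Set.right_mem_uIcc
    have hcol : ∀ a ∈ (Set.uIcc z.re w.re), ∀ s t, (Set.uIcc s t) ⊆ (Set.uIcc z.im w.im) →
        IntervalIntegrable (fun y : ℝ => E (a + y * I)) volume s t := by
      intro a ha s t hst
      refine ContinuousOn.intervalIntegrable ?_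
      refine hEc.comp (by fun_prop) fun y hy => hs ?_
      exact ⟨by simpa using ha, by simpa using hst hy⟩
    have e1 := hside z ⟨w.re, 0⟩ (fun y hy => hs ⟨hy.1, r1 hy.2⟩) (by
      show (0 ≤ z.im ∧ (0 : ℝ) ≤ 0) ∨ (z.im ≤ 0 ∧ (0 : ℝ) ≤ 0)
      rcases le_total 0 z.im with h | h <;> simp [h])
    have e2 := hside ⟨z.re, 0⟩ w (fun y hy => hs ⟨hy.1, r2 hy.2⟩) (by
      show ((0 : ℝ) ≤ 0 ∧ 0 ≤ w.im) ∨ ((0 : ℝ) ≤ 0 ∧ w.im ≤ 0)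
      rcases le_total 0 w.im with h | h <;> simp [h])
    have e3 := intervalIntegral.integral_add_adjacent_intervals
      (hcol w.re Set.right_mem_uIcc _ _ r1) (hcol w.re Set.right_mem_uIcc _ _ r2)
    have e4 := intervalIntegral.integral_add_adjacent_intervals
      (hcol z.re Set.left_mem_uIcc _ _ r1) (hcol z.re Set.left_mem_uIcc _ _ r2)
    simp only [Bd, smul_eq_mul] at e1 e2 ⊢
    rw [← e3, ← e4]
    linear_combination e1 + e2
  refine ⟨E, ?_, fun z _ hz => hEu z hz⟩
  refine (IsConservativeOn.isExactOn_ball hEc ?_).differentiableOn Metric.isOpen_ball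
  intro z w hs
  rw [← sub_eq_zero, sub_neg_eq_add, wedgeIntegral_add_wedgeIntegral_eq]
  show Bd z w = 0
  by_cases h0 : 0 ∈ (Set.uIcc z.im w.im)
  · exact hvert z w hs h0
  · refine hside z w hs ?_
    rw [Set.mem_uIcc] at h0
    push Not at h0
    rcases le_total 0 z.im with h1 | h1 <;> rcases le_total 0 w.im with h2 | h2
    · left; exact ⟨h1, h2⟩
    · exact absurd (h0.2 h2) (not_lt.2 h1)
    · exact absurd (h0.1 h1) (not_lt.2 h2)
    · right; exact ⟨h1, h2⟩

end


section
open Complex Topology Filter Asymptotics MeasureTheory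

theorem vert_integral {U : Set ℂ} (hU : IsOpen U) {f : ℂ → ℂ} (hf : DifferentiableOn ℂ f U)
    {M : ℝ} (hM : 0 ≤ M) {z0 : ℂ} (hz : ∀ σ ∈ Set.Icc 0 M, z0 + (σ : ℝ) * I ∈ U) :
    HasDerivAt (fun z => ∫ σ in (0 : ℝ)..M, f (z + σ * I)) (-I * (f (z0 + M * I) - f z0)) z0 := by
  have hfa := hf.analyticOnNhd hU
  have hd : ContinuousOn (deriv f) U := fun z hz => (hfa z hz).deriv.continuousAt.continuousWithinAt
  set K : Set ℂ := (fun σ : ℝ => z0 + σ * I) '' Set.Icc 0 M with hK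
  have hKc : IsCompact K := isCompact_Icc.image (by fun_prop)
  have hKU : K ⊆ U := by rintro _ ⟨σ, hσ, rfl⟩; exact hz σ hσ
  obtain ⟨δ, hδ, hδU⟩ := hKc.exists_cthickening_subset_open hU hKU
  obtain ⟨C, hC⟩ := (hKc.cthickening (r := δ)).exists_bound_of_continuousOn (hd.mono hδU)
  have hmem : ∀ σ ∈ Set.Icc 0 M, ∀ z ∈ Metric.ball z0 δ, z + (σ : ℝ) * I ∈ Metric.cthickening δ K := by
    intro σ hσ z hz
    refine Metric.mem_cthickening_of_dist_le _ (z0 + σ * I) _ _ ⟨σ, hσ, rfl⟩ ?_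
    rw [dist_add_right]; exact (Metric.mem_ball.1 hz).le
  have hu : Set.uIcc 0 M = Set.Icc 0 M := Set.uIcc_of_le hM
  have huo : ∀ σ ∈ Set.uIoc 0 M, σ ∈ Set.Icc 0 M := fun σ hσ => by
    rw [Set.uIoc_of_le hM] at hσ; exact ⟨hσ.1.le, hσ.2⟩
  have hfc : ∀ z ∈ Metric.ball z0 δ, ContinuousOn (fun σ : ℝ => f (z + σ * I)) (Set.uIcc 0 M) := by
    intro z hz
    rw [hu]
    exact hf.continuousOn.comp (by fun_prop) fun σ hσ => hδU (hmem σ hσ z hz)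
  have hfc' : ContinuousOn (fun σ : ℝ => deriv f (z0 + σ * I)) (Set.uIcc 0 M) := by
    rw [hu]
    exact hd.comp (by fun_prop) fun σ hσ => hz σ hσ
  have hz0 := Metric.mem_ball_self hδ (x := z0)
  have key := (intervalIntegral.hasDerivAt_integral_of_dominated_loc_of_deriv_le
    (F := fun z (σ : ℝ) => f (z + σ * I))
    (F' := fun z (σ : ℝ) => deriv f (z + σ * I)) (x₀ := z0) (a := 0) (b := M)
    (μ := volume) (s := Metric.ball z0 δ)
    (bound := fun _ => C) (Metric.ball_mem_nhds z0 hδ) ?_ ?_ ?_ ?_ ?_ ?_).2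
  · refine key.congr_deriv ?_
    have h1 := intervalIntegral.integral_eq_sub_of_hasDerivAt (a := 0) (b := M)
      (f := fun σ : ℝ => -I * f (z0 + σ * I)) (f' := fun σ : ℝ => deriv f (z0 + σ * I))
      (fun σ hσ => by
        rw [hu] at hσ
        have h2 := (hfa _ (hz σ hσ)).differentiableAt.hasDerivAt
        have h3 : HasDerivAt (fun σ : ℝ => z0 + σ * I) I σ := by
          have := ((Complex.ofRealCLM.hasDerivAt (x := σ)).mul_const I).const_add z0
          simpa using this
        have h4 := (h2.comp_of_eq σ h3 rfl).const_mul (-I)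
        refine h4.congr_deriv ?_
        linear_combination (-deriv f (z0 + σ * I)) * I_mul_I)
      (hfc'.intervalIntegrable)
    rw [h1]; simp; ring
  · filter_upwards [Metric.ball_mem_nhds z0 hδ] with z hz
    exact ((hfc z hz).mono Set.uIoc_subset_uIcc).aestronglyMeasurable measurableSet_uIoc
  · exact (hfc z0 hz0).intervalIntegrable
  · exact (hfc'.mono Set.uIoc_subset_uIcc).aestronglyMeasurable measurableSet_uIoc
  · exact Eventually.of_forall fun σ hσ z hz => hC _ (hmem σ (huo σ hσ) z hz)
  · exact _root_.intervalIntegrable_const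
  · refine Eventually.of_forall fun σ hσ z hz => ?_
    have h2 := (hfa _ (hδU (hmem σ (huo σ hσ) z hz))).differentiableAt.hasDerivAt
    exact h2.comp_add_const z _

namespace NC

noncomputable def Psi (γ : ℝ → ℂ) (w : ℂ) : ℂ := γ w.re + w.im * I

theorem Psi_real (γ : ℝ → ℂ) (x : ℝ) : Psi γ x = γ x := by simp [Psi]

theorem Psi_add_I (γ : ℝ → ℂ) (w : ℂ) (s : ℝ) : Psi γ (w + s * I) = Psi γ w + s * I := by
  simp [Psi]; ring

theorem Psi_cont {α η : ℝ} {γ γ' : ℝ → ℂ} (h : NC α η γ γ') : Continuous (Psi γ) := by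
  have := h.cont
  unfold Psi; fun_prop

theorem Psi_near {α η : ℝ} {γ γ' : ℝ → ℂ} (h : NC α η γ γ') (w v : ℂ) :
    ‖Psi γ w - Psi γ v - (w - v)‖ ≤ η * ‖w - v‖ := by
  have h1 := h.lip v.re w.re
  have e : Psi γ w - Psi γ v - (w - v) = γ w.re - w.re - (γ v.re - v.re) := by
    rw [Psi, Psi]
    linear_combination (Complex.re_add_im w) - Complex.re_add_im v
  rw [e]
  refine h1.trans (mul_le_mul_of_nonneg_left ?_ h.e0.le)
  simpa using Complex.abs_re_le_norm (w - v)

theorem Psi_near2 {α η : ℝ} {γ γ' : ℝ → ℂ} (h : NC α η γ γ') (w v : ℂ) :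
    ‖Psi γ w - Psi γ v - (w - v)‖ ≤ 1 / 2 * ‖w - v‖ :=
  (h.Psi_near w v).trans (mul_le_mul_of_nonneg_right (by linarith [h.e1]) (norm_nonneg _))

theorem Psi_zero {α η : ℝ} {γ γ' : ℝ → ℂ} (h : NC α η γ γ') : Psi γ 0 = 0 := by
  simp [Psi, h.h0]

end NC

theorem near_lower {f : ℂ → ℂ} (hf : ∀ w v, ‖f w - f v - (w - v)‖ ≤ 1 / 2 * ‖w - v‖) (w v : ℂ) :
    ‖w - v‖ / 2 ≤ ‖f w - f v‖ := by
  have h1 := hf w v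
  have h2 := norm_sub_norm_le (w - v) (f w - f v)
  rw [norm_sub_rev (w - v) (f w - f v)] at h2
  linarith

theorem near_upper {f : ℂ → ℂ} (hf : ∀ w v, ‖f w - f v - (w - v)‖ ≤ 1 / 2 * ‖w - v‖) (w v : ℂ) :
    ‖f w - f v‖ ≤ 2 * ‖w - v‖ := by
  have h1 := hf w v
  have h2 := norm_sub_norm_le (f w - f v) (w - v)
  linarith [norm_nonneg (w - v)]

namespace NC

theorem exists_primitive {α η : ℝ} {γ γ' : ℝ → ℂ} (h : NC α η γ γ') {f : ℂ → ℂ}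
    (hf : ∀ w : ℂ, 0 < w.im → DifferentiableAt ℂ f (Psi γ w)) :
    ∃ φ : ℂ → ℂ, ∀ w : ℂ, ‖w‖ < 1 → 0 < w.im → HasDerivAt φ (f (Psi γ w)) (Psi γ w) := by
  obtain ⟨e, he⟩ := near_id_homeo h.Psi_near2
  set U : Set ℂ := e '' {w | 0 < w.im} with hUdef
  have hU : IsOpen U := e.isOpenMap _ (isOpen_lt continuous_const Complex.continuous_im)
  have hfU : DifferentiableOn ℂ f U := by
    rintro _ ⟨w, hw, rfl⟩
    rw [he]
    exact (hf w hw).differentiableWithinAt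
  have hball : Metric.ball (4 * I) 2 ⊆ U := by
    intro v hv
    refine ⟨e.symm v, ?_, e.apply_symm_apply v⟩
    show 0 < (e.symm v).im
    have h1 := near_lower h.Psi_near2 (e.symm v) (4 * I)
    rw [← he, e.apply_symm_apply] at h1
    have e4 : Psi γ (4 * I) = 4 * I := by simp [Psi, h.h0]
    rw [e4] at h1
    rw [Metric.mem_ball, dist_eq_norm] at hv
    have h2 := (abs_le.1 (Complex.abs_im_le_norm (e.symm v - 4 * I))).1
    simp at h2
    linarith
  obtain ⟨g, hg⟩ := (hfU.mono hball).isExactOn_ball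
  refine ⟨fun z => g (z + (4 : ℝ) * I) - I * ∫ σ in (0 : ℝ)..4, f (z + σ * I), fun w hw1 hw2 => ?_⟩
  have hup : ∀ σ ∈ Set.Icc (0 : ℝ) 4, Psi γ w + (σ : ℝ) * I ∈ U := by
    intro σ hσ
    refine ⟨w + σ * I, ?_, ?_⟩
    · show 0 < (w + σ * I).im
      simp; linarith [hσ.1]
    · rw [he, Psi_add_I]
  have h1 := vert_integral hU hfU (by norm_num : (0 : ℝ) ≤ 4) hup
  have h2 : HasDerivAt (fun z => g (z + (4 : ℝ) * I)) (f (Psi γ w + (4 : ℝ) * I)) (Psi γ w) := by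
    refine (hg _ ?_).comp_add_const _ _
    rw [Metric.mem_ball, dist_eq_norm]
    have h3 := near_upper h.Psi_near2 w 0
    rw [h.Psi_zero, sub_zero, sub_zero] at h3
    push_cast
    rw [add_sub_cancel_right]
    linarith
  refine (h2.sub (h1.const_mul I)).congr_deriv ?_
  linear_combination (f (Psi γ w + (4 : ℝ) * I) - f (Psi γ w)) * I_mul_I

/-- the real derivative of `Psi` -/
noncomputable def DPsi (γ' : ℝ → ℂ) (w : ℂ) : ℂ →L[ℝ] ℂ :=
  (Complex.reCLM.smulRight (γ' w.re)) + Complex.imCLM.smulRight I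

theorem Psi_hasFDerivAt {α η : ℝ} {γ γ' : ℝ → ℂ} (h : NC α η γ γ') (w : ℂ) :
    HasFDerivAt (Psi γ) (DPsi γ' w) w := by
  have h1 : HasFDerivAt (fun w : ℂ => γ w.re) (Complex.reCLM.smulRight (γ' w.re)) w := by
    have := (h.hd w.re).hasFDerivAt.comp w Complex.reCLM.hasFDerivAt
    refine this.congr_fderiv ?_
    ext a <;> simp
  have h2 : HasFDerivAt (fun w : ℂ => (w.im : ℂ) * I) (Complex.imCLM.smulRight I) w := by
    have := (Complex.imCLM.smulRight I).hasFDerivAt (x := w)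
    refine this.congr_of_eventuallyEq (Eventually.of_forall fun v => ?_)
    simp
  exact h1.add h2

theorem primitive_near {α η : ℝ} {γ γ' : ℝ → ℂ} (h : NC α η γ γ') {φ H : ℂ → ℂ}
    (hφ : ∀ w : ℂ, ‖w‖ < 1 → 0 < w.im → HasDerivAt φ (H w) (Psi γ w)) {r ε : ℝ} (hε : 0 ≤ ε)
    (hr : r ≤ 1)
    (h1 : ∀ w : ℂ, ‖w‖ < r → ‖H w * γ' w.re - 1‖ ≤ ε / 2) (h2 : ∀ w : ℂ, ‖w‖ < r → ‖H w - 1‖ ≤ ε / 2)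
    {w v : ℂ} (hw : ‖w‖ < r) (hw' : 0 < w.im) (hv : ‖v‖ < r) (hv' : 0 < v.im) :
    ‖φ (Psi γ w) - φ (Psi γ v) - (w - v)‖ ≤ ε * ‖w - v‖ := by
  have hconv : Convex ℝ (Metric.ball (0 : ℂ) r ∩ {w : ℂ | 0 < w.im}) :=
    (convex_ball _ _).inter (convex_halfSpace_im_gt 0)
  have key := hconv.norm_image_sub_le_of_norm_hasFDerivWithin_le (𝕜 := ℝ) (C := ε)
    (f := fun w => φ (Psi γ w) - w)
    (f' := fun w => H w • DPsi γ' w - ContinuousLinearMap.id ℝ ℂ) (x := v) (y := w) ?_ ?_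
    ⟨by simpa using hv, hv'⟩ ⟨by simpa using hw, hw'⟩
  · have e : φ (Psi γ w) - φ (Psi γ v) - (w - v) = φ (Psi γ w) - w - (φ (Psi γ v) - v) := by ring
    rw [e]; exact key
  · rintro x ⟨hx1, hx2⟩
    rw [mem_ball_zero_iff] at hx1
    have d1 := (hφ x (hx1.trans_le hr) hx2).hasFDerivAt.restrictScalars ℝ
    have d2 := d1.comp x (h.Psi_hasFDerivAt x)
    have d3 := (d2.sub (hasFDerivAt_id x)).hasFDerivWithinAt
      (s := Metric.ball (0 : ℂ) r ∩ {w : ℂ | 0 < w.im})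
    refine d3.congr_fderiv ?_
    ext a <;> simp [mul_comm]
  · rintro x ⟨hx1, hx2⟩
    rw [mem_ball_zero_iff] at hx1
    refine ContinuousLinearMap.opNorm_le_bound _ hε fun a => ?_
    have e : (H x • DPsi γ' x - ContinuousLinearMap.id ℝ ℂ) a =
        (H x * γ' x.re - 1) * a.re + (H x - 1) * (a.im * I) := by
      have : a = a.re + a.im * I := (Complex.re_add_im a).symm
      simp only [DPsi, sub_apply, smul_apply,
        add_apply, ContinuousLinearMap.smulRight_apply, Complex.reCLM_apply,
        Complex.imCLM_apply, Complex.real_smul, smul_eq_mul, ContinuousLinearMap.id_apply]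
      linear_combination -this
    rw [e]
    refine (norm_add_le _ _).trans ?_
    rw [norm_mul, norm_mul, norm_mul, norm_I, mul_one, Complex.norm_real, Complex.norm_real]
    have a1 := mul_le_mul (h1 x hx1) (Complex.abs_re_le_norm a) (abs_nonneg _) (by positivity)
    have a2 := mul_le_mul (h2 x hx1) (Complex.abs_im_le_norm a) (abs_nonneg _) (by positivity)
    simp only [Real.norm_eq_abs]
    linarith

end NC

end


section
open Complex Topology Filter Asymptotics MeasureTheory

namespace NC

/-- conformal chart on the upper side -/
theorem chart {α η : ℝ} {γ γ' : ℝ → ℂ} (h : NC α η γ γ') (hη : η * (1 + cst α) ≤ 1 / 100) :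
    ∃ (e : ℂ ≃ₜ ℂ) (H hh φ : ℂ → ℂ) (r : ℝ), 0 < r ∧ Continuous H ∧ (∀ w, H w ≠ 0) ∧ H 0 = 1 ∧
      e 0 = 0 ∧ (∀ w v, ‖e w - e v - (w - v)‖ ≤ 1 / 2 * ‖w - v‖) ∧
      (∀ w : ℂ, ‖w‖ < r → 0 < w.im → φ (Psi γ w) = e w ∧ HasDerivAt φ (H w) (Psi γ w) ∧
        DifferentiableAt ℂ hh (Psi γ w) ∧ H w = hh (Psi γ w)) ∧
      (∀ x : ℝ, |x| < r → (e x).im = 0) ∧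
      (∀ x : ℝ, |x| < r → ∃ p : ℝ, 0 < p ∧ H x * γ' x = p) ∧
      (∀ ε > 0, ∃ ρ > 0, ∀ w : ℂ, ‖w‖ < ρ → 0 ≤ w.im → ‖e w - w‖ ≤ ε * ‖w‖) := by
  obtain ⟨H, hh, Hc, Hne, H0, hd, hHh, hpos⟩ := h.exists_h hη
  have hdU : ∀ w : ℂ, 0 < w.im → DifferentiableAt ℂ hh (Psi γ w) := by
    intro w hw
    refine hd _ (w.im / 4) (by linarith) fun t => ?_
    have h1 := near_lower h.Psi_near2 t w
    rw [Psi_real] at h1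
    have h2 := Complex.abs_im_le_norm ((t : ℂ) - w)
    simp at h2
    rw [abs_of_pos hw] at h2
    linarith
  obtain ⟨φ, hφ0⟩ := h.exists_primitive hdU
  have hHh' : ∀ w : ℂ, ‖w‖ < 1 → 0 < w.im → H w = hh (Psi γ w) := fun w h1 h2 =>
    hHh w ((Complex.abs_re_le_norm w).trans_lt h1) h2
  have hφ : ∀ w : ℂ, ‖w‖ < 1 → 0 < w.im → HasDerivAt φ (H w) (Psi γ w) := by
    intro w h1 h2
    rw [hHh' w h1 h2]; exact hφ0 w h1 h2
  have hc' := h.cont'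
  have hsm : ∀ ε : ℝ, 0 < ε → ∃ r : ℝ, 0 < r ∧ r ≤ 1 ∧ (∀ w : ℂ, ‖w‖ < r → ‖H w * γ' w.re - 1‖ ≤ ε / 2) ∧
      ∀ w : ℂ, ‖w‖ < r → ‖H w - 1‖ ≤ ε / 2 := by
    intro ε hε
    have c1 : Continuous fun w : ℂ => ‖H w * γ' w.re - 1‖ := by fun_prop
    have c2 : Continuous fun w : ℂ => ‖H w - 1‖ := by fun_prop
    have t1 : ∀ᶠ w in 𝓝 (0 : ℂ), ‖H w * γ' w.re - 1‖ < ε / 2 := by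
      refine (c1.tendsto 0).eventually_lt_const ?_
      simp [H0, h.h1, hε]
    have t2 : ∀ᶠ w in 𝓝 (0 : ℂ), ‖H w - 1‖ < ε / 2 := by
      refine (c2.tendsto 0).eventually_lt_const ?_
      simp [H0, hε]
    obtain ⟨r, hr, hr2⟩ := Metric.eventually_nhds_iff_ball.1 (t1.and t2)
    refine ⟨min r 1, lt_min hr one_pos, min_le_right _ _, fun w hw => ?_, fun w hw => ?_⟩
    · exact (hr2 w (by simpa using hw.trans_le (min_le_left _ _))).1.le
    · exact (hr2 w (by simpa using hw.trans_le (min_le_left _ _))).2.le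
  obtain ⟨r, hr0, hr1, hra, hrb⟩ := hsm (1 / 4) (by norm_num)
  set D : Set ℂ := Metric.ball (0 : ℂ) r ∩ {w : ℂ | 0 < w.im} with hD
  have hlip : ∀ w ∈ D, ∀ v ∈ D, ‖φ (Psi γ w) - w - (φ (Psi γ v) - v)‖ ≤ 1 / 4 * ‖w - v‖ := by
    rintro w ⟨hw1, hw2⟩ v ⟨hv1, hv2⟩
    rw [mem_ball_zero_iff] at hw1 hv1
    have := h.primitive_near hφ (by norm_num) hr1 hra hrb hw1 hw2 hv1 hv2
    have e : φ (Psi γ w) - w - (φ (Psi γ v) - v) = φ (Psi γ w) - φ (Psi γ v) - (w - v) := by ring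
    rw [e]; exact this
  have l1 : LipschitzOnWith (1 / 4 : NNReal) (fun w => (φ (Psi γ w) - w).re) D := by
    refine LipschitzOnWith.of_dist_le_mul fun w hw v hv => ?_
    rw [Real.dist_eq, ← Complex.sub_re, dist_eq_norm]
    refine (Complex.abs_re_le_norm _).trans ((hlip w hw v hv).trans (le_of_eq ?_))
    simp
  have l2 : LipschitzOnWith (1 / 4 : NNReal) (fun w => (φ (Psi γ w) - w).im) D := by
    refine LipschitzOnWith.of_dist_le_mul fun w hw v hv => ?_
    rw [Real.dist_eq, ← Complex.sub_im, dist_eq_norm]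
    refine (Complex.abs_im_le_norm _).trans ((hlip w hw v hv).trans (le_of_eq ?_))
    simp
  obtain ⟨f1, hf1, he1⟩ := l1.extend_real
  obtain ⟨f2, hf2, he2⟩ := l2.extend_real
  set F : ℂ → ℂ := fun w => f1 w + f2 w * I with hF
  have hFD : ∀ w ∈ D, φ (Psi γ w) = w + F w := by
    intro w hw
    have a := he1 hw
    have b := he2 hw
    simp only at a b
    rw [hF]
    simp only
    rw [← a, ← b, Complex.re_add_im]; ring
  have hnear : ∀ w v, ‖(w + F w - F 0) - (v + F v - F 0) - (w - v)‖ ≤ 1 / 2 * ‖w - v‖ := by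
    intro w v
    have a := hf1.dist_le_mul w v
    have b := hf2.dist_le_mul w v
    rw [Real.dist_eq, dist_eq_norm] at a b
    have e : (w + F w - F 0) - (v + F v - F 0) - (w - v) =
        ((f1 w - f1 v : ℝ) : ℂ) + ((f2 w - f2 v : ℝ) : ℂ) * I := by
      simp only [hF]; push_cast; ring
    rw [e]
    refine (norm_add_le _ _).trans ?_
    rw [norm_mul, norm_I, mul_one, Complex.norm_real, Complex.norm_real, Real.norm_eq_abs,
      Real.norm_eq_abs]
    simp at a b
    linarith
  obtain ⟨e, he⟩ := near_id_homeo hnear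
  have hnear' : ∀ w v, ‖e w - e v - (w - v)‖ ≤ 1 / 2 * ‖w - v‖ := by
    intro w v; rw [he, he]; exact hnear w v
  have e0 : e 0 = 0 := by rw [he]; ring
  have heD : ∀ w : ℂ, ‖w‖ < r → 0 < w.im → φ (Psi γ w) - F 0 = e w := by
    intro w h1 h2
    rw [he, hFD w ⟨by simpa using h1, h2⟩]
  refine ⟨e, H, hh, fun z => φ z - F 0, r, hr0, Hc, Hne, H0, e0, hnear', ?_, ?_, ?_, ?_⟩
  · intro w h1 h2
    exact ⟨heD w h1 h2, (hφ w (h1.trans_le hr1) h2).sub_const _, hdU w h2,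
      hHh' w (h1.trans_le hr1) h2⟩
  · intro x hx
    have key : e x - e 0 = ∫ t in (0 : ℝ)..x, H t * γ' t := by
      have cL : Continuous fun s : ℝ => e (x + s * I) - e (s * I) := by
        have := e.continuous
        fun_prop
      have cR : Continuous fun s : ℝ => ∫ t in (0 : ℝ)..x, H (t + s * I) * γ' t := by
        refine intervalIntegral.continuous_parametric_intervalIntegral_of_continuous' ?_ 0 x
        have : Continuous fun p : ℝ × ℝ => H (p.2 + p.1 * I) * γ' p.2 := by fun_prop
        exact this
      have heq : ∀ᶠ s : ℝ in 𝓝[>] (0 : ℝ), e (x + s * I) - e (s * I) =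
          ∫ t in (0 : ℝ)..x, H (t + s * I) * γ' t := by
        have : ∀ᶠ s in 𝓝[>] (0 : ℝ), s < r - |x| :=
          eventually_nhdsWithin_of_eventually_nhds (eventually_lt_nhds (by linarith))
        filter_upwards [this, self_mem_nhdsWithin] with s hs hs0
        have hs0 : 0 < s := hs0
        have hn : ∀ t ∈ Set.uIcc (0 : ℝ) x, ‖(t : ℂ) + s * I‖ < r := by
          intro t ht
          have h1 : |t| ≤ |x| := by
            have := Set.abs_sub_left_of_mem_uIcc ht
            simpa using this
          refine (norm_add_le _ _).trans_lt ?_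
          rw [norm_mul, norm_I, mul_one, Complex.norm_real, Complex.norm_real, Real.norm_eq_abs,
            Real.norm_eq_abs, abs_of_pos hs0]
          linarith
        have hi : ∀ t : ℝ, 0 < ((t : ℂ) + s * I).im := by intro t; simp; exact hs0
        have hder : ∀ t ∈ Set.uIcc (0 : ℝ) x, HasDerivAt (fun t : ℝ => φ (Psi γ (t + s * I)))
            (H (t + s * I) * γ' t) t := by
          intro t ht
          have d1 := hφ _ ((hn t ht).trans_le hr1) (hi t)
          have d2 : HasDerivAt (fun t : ℝ => Psi γ (t + s * I)) (γ' t) t := by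
            have := (h.hd t).add_const (s * I)
            refine this.congr_of_eventuallyEq (Eventually.of_forall fun y => ?_)
            simp [Psi]
          exact d1.comp_of_eq t d2 rfl
        rw [intervalIntegral.integral_eq_sub_of_hasDerivAt hder]
        · rw [← heD _ (hn x Set.right_mem_uIcc) (hi x)]
          have h3 := heD _ (hn 0 Set.left_mem_uIcc) (hi 0)
          rw [Complex.ofReal_zero, zero_add] at h3
          rw [← h3, Complex.ofReal_zero, zero_add]
          ring
        · have : Continuous fun t : ℝ => H (t + s * I) * γ' t := by fun_prop
          exact this.intervalIntegrable _ _
      have l1 := (cL.tendsto 0).mono_left (nhdsWithin_le_nhds (s := Set.Ioi 0))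
      have l2 := (cR.tendsto 0).mono_left (nhdsWithin_le_nhds (s := Set.Ioi 0))
      have := tendsto_nhds_unique (l1.congr' heq) l2
      simpa using this
    rw [e0, sub_zero] at key
    rw [key]
    have hi : IntervalIntegrable (fun t : ℝ => H t * γ' t) volume 0 x :=
      (by fun_prop : Continuous fun t : ℝ => H t * γ' t).intervalIntegrable _ _
    have e5 := Complex.imCLM.intervalIntegral_comp_comm hi
    rw [Complex.imCLM_apply] at e5
    rw [← e5]
    refine intervalIntegral.integral_zero_ae (Eventually.of_forall fun t ht => ?_)
    have h1 : |t| ≤ |x| := by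
      have := Set.abs_sub_left_of_mem_uIcc (Set.uIoc_subset_uIcc ht)
      simpa using this
    obtain ⟨p, _, hp⟩ := hpos t (by linarith)
    rw [Complex.imCLM_apply, hp, Complex.ofReal_im]
  · intro x hx
    exact hpos x (by linarith)
  · intro ε hε
    obtain ⟨ρ, hρ0, hρ1, ha, hb⟩ := hsm ε hε
    refine ⟨min ρ r, lt_min hρ0 hr0, fun w hw hw0 => ?_⟩
    have hwρ := hw.trans_le (min_le_left _ _)
    have hwr := hw.trans_le (min_le_right _ _)
    have cL : Continuous fun s : ℝ => ‖e (w + s * I) - e (s * I) - w‖ := by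
      have := e.continuous
      fun_prop
    have l1 := (cL.tendsto 0).mono_left (nhdsWithin_le_nhds (s := Set.Ioi 0))
    simp only [Complex.ofReal_zero, zero_mul, add_zero, e0, sub_zero] at l1
    refine le_of_tendsto l1 ?_
    have : ∀ᶠ s in 𝓝[>] (0 : ℝ), s < min ρ r - ‖w‖ :=
      eventually_nhdsWithin_of_eventually_nhds (eventually_lt_nhds (by linarith))
    filter_upwards [this, self_mem_nhdsWithin] with s hs hs0
    have hs0 : 0 < s := hs0
    have n1 : ‖w + s * I‖ < min ρ r := by
      refine (norm_add_le _ _).trans_lt ?_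
      rw [norm_mul, norm_I, mul_one, Complex.norm_real, Real.norm_eq_abs, abs_of_pos hs0]
      linarith
    have n2 : ‖(s : ℂ) * I‖ < min ρ r := by
      rw [norm_mul, norm_I, mul_one, Complex.norm_real, Real.norm_eq_abs, abs_of_pos hs0]
      linarith [norm_nonneg w]
    have i1 : 0 < (w + s * I).im := by simp; linarith
    have i2 : 0 < ((s : ℂ) * I).im := by simp; linarith
    have := h.primitive_near hφ hε.le hρ1 ha hb (n1.trans_le (min_le_left _ _)) i1
      (n2.trans_le (min_le_left _ _)) i2
    rw [← heD _ (n1.trans_le (min_le_right _ _)) i1, ← heD _ (n2.trans_le (min_le_right _ _)) i2]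
    have e7 : w + s * I - s * I = w := by ring
    rw [e7] at this
    have e8 : φ (Psi γ (w + s * I)) - F 0 - (φ (Psi γ (s * I)) - F 0) - w =
      φ (Psi γ (w + s * I)) - φ (Psi γ (s * I)) - w := by ring
    rw [e8]; exact this

end NC

end


section
open Complex Topology Filter Asymptotics MeasureTheory

namespace NC

theorem sign_aux {e : ℂ ≃ₜ ℂ} (hnear : ∀ w v, ‖e w - e v - (w - v)‖ ≤ 1 / 2 * ‖w - v‖)
    {w : ℂ} (hre : (e (w.re : ℂ)).im = 0) : |(e w).im - w.im| ≤ 1 / 2 * |w.im| := by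
  have h1 := hnear w (w.re : ℂ)
  have h2 : w - (w.re : ℂ) = (w.im : ℂ) * I := by
    apply Complex.ext <;> simp
  rw [h2, norm_mul, norm_I, mul_one, Complex.norm_real, Real.norm_eq_abs] at h1
  have h3 := (Complex.abs_im_le_norm _).trans h1
  simpa [hre] using h3

theorem ratio_tendsto {α η : ℝ} {γ γ' : ℝ → ℂ} (h : NC α η γ γ') {e : ℂ ≃ₜ ℂ} (e0 : e 0 = 0)
    (hs : ∀ ε > 0, ∃ ρ > 0, ∀ w : ℂ, ‖w‖ < ρ → 0 ≤ w.im → ‖e w - w‖ ≤ ε * ‖w‖) :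
    ∃ k : ℂ → ℂ, (∀ w, k w * Psi γ w = e w) ∧ Tendsto k (𝓝[{w | 0 ≤ w.im}] 0) (𝓝 1) := by
  classical
  have hlow : ∀ w, ‖w‖ / 2 ≤ ‖Psi γ w‖ := by
    intro w
    have := near_lower h.Psi_near2 w 0
    rwa [h.Psi_zero, sub_zero, sub_zero] at this
  refine ⟨fun w => if w = 0 then 1 else e w / Psi γ w, ?_, ?_⟩
  · intro w
    by_cases hw : w = 0
    · simp [hw, e0, h.Psi_zero]
    · have : Psi γ w ≠ 0 := by
        intro h0
        have := hlow w
        rw [h0, norm_zero] at this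
        have : 0 < ‖w‖ := norm_pos_iff.2 hw
        linarith
      simp only [if_neg hw]
      field_simp
  · rw [Metric.tendsto_nhdsWithin_nhds]
    intro ε hε
    obtain ⟨ρ, hρ, h1⟩ := hs (ε / 6) (by positivity)
    have hd := h.hd 0
    rw [h.h1, hasDerivAt_iff_isLittleO] at hd
    have hd2 := hd.def (by positivity : 0 < ε / 6)
    rw [Metric.eventually_nhds_iff] at hd2
    obtain ⟨ρ2, hρ2, h2⟩ := hd2
    refine ⟨min ρ ρ2, lt_min hρ hρ2, fun {w} hw0 hw => ?_⟩
    rw [dist_zero_right] at hw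
    by_cases hw1 : w = 0
    · simp [hw1, hε]
    have hwp : 0 < ‖w‖ := norm_pos_iff.2 hw1
    have hPp : 0 < ‖Psi γ w‖ := by linarith [hlow w]
    have a := h1 w (hw.trans_le (min_le_left _ _)) hw0
    have b : ‖Psi γ w - w‖ ≤ ε / 6 * ‖w‖ := by
      have := h2 (y := w.re) (by
        rw [dist_zero_right, Real.norm_eq_abs]
        exact (Complex.abs_re_le_norm w).trans_lt (hw.trans_le (min_le_right _ _)))
      rw [h.h0] at this
      have e1 : Psi γ w - w = γ w.re - 0 - (w.re - 0 : ℝ) • (1 : ℂ) := by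
        simp only [Psi, sub_zero, Complex.real_smul, mul_one]
        nth_rewrite 3 [← Complex.re_add_im w]
        ring
      rw [e1]
      refine this.trans ?_
      rw [sub_zero, Real.norm_eq_abs]
      gcongr
      exact Complex.abs_re_le_norm w
    rw [if_neg hw1, dist_eq_norm]
    have hne : Psi γ w ≠ 0 := norm_pos_iff.1 hPp
    have e2 : e w / Psi γ w - 1 = ((e w - w) - (Psi γ w - w)) / Psi γ w := by
      field_simp; ring
    rw [e2, norm_div, div_lt_iff₀ hPp]
    refine (norm_sub_le _ _).trans_lt ?_
    nlinarith [hlow w]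

theorem local_thm {α η : ℝ} {γ γ' : ℝ → ℂ} (h : NC α η γ γ') (hη : η * (1 + cst α) ≤ 1 / 100)
    {g : ℂ → ℂ} {R : ℝ} (hR : 0 < R)
    (gc : ContinuousOn (fun w => g (Psi γ w)) {w | |w.re| < R ∧ 0 ≤ w.im ∧ w.im < R})
    (gd : ∀ w : ℂ, |w.re| < R → 0 < w.im → w.im < R → DifferentiableAt ℂ g (Psi γ w))
    (gb : ∀ x : ℝ, |x| < R → (g (γ x) * γ' x).re = 0) :
    (∃ ρ > 0, ∀ w : ℂ, ‖w‖ < ρ → 0 ≤ w.im → g (Psi γ w) = 0) ∨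
    ∃ (m : ℕ) (c : ℂ), c ≠ 0 ∧ (fun w => g (Psi γ w) - c * (Psi γ w) ^ m)
      =o[𝓝[{w | 0 ≤ w.im}] 0] (fun w => (Psi γ w) ^ m) := by
  obtain ⟨e, H, hh, φ, r, hr, Hc, Hne, H0, e0, hnear, hup, hrl, hpos, hsm⟩ := h.chart hη
  set r' := min r R with hr'
  have hr'0 : 0 < r' := lt_min hr hR
  have hr1 : r' ≤ r := min_le_left _ _
  have hr2 : r' ≤ R := min_le_right _ _
  have hbox : ∀ w : ℂ, ‖w‖ < r' → |w.re| < R ∧ w.im < R := fun w hw =>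
    ⟨(Complex.abs_re_le_norm w).trans_lt (hw.trans_le hr2),
      (le_abs_self _).trans_lt ((Complex.abs_im_le_norm w).trans_lt (hw.trans_le hr2))⟩
  have hsgn : ∀ w : ℂ, ‖w‖ < r' → |(e w).im - w.im| ≤ 1 / 2 * |w.im| := fun w hw =>
    sign_aux hnear (hrl _ ((Complex.abs_re_le_norm w).trans_lt (hw.trans_le hr1)))
  have hQ : ∀ ζ : ℂ, ‖ζ‖ < r' / 2 → ‖e.symm ζ‖ < r' := by
    intro ζ hζ
    have := near_lower hnear (e.symm ζ) 0
    rw [e0, sub_zero, sub_zero, e.apply_symm_apply] at this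
    linarith
  have s1 : ∀ ζ : ℂ, ‖ζ‖ < r' / 2 → 0 ≤ ζ.im → 0 ≤ (e.symm ζ).im := by
    intro ζ hζ h0
    have := hsgn _ (hQ ζ hζ)
    rw [e.apply_symm_apply] at this
    by_contra hc
    push Not at hc
    rw [abs_of_neg hc, abs_le] at this
    linarith [this.2]
  have s2 : ∀ ζ : ℂ, ‖ζ‖ < r' / 2 → 0 < ζ.im → 0 < (e.symm ζ).im := by
    intro ζ hζ h0
    refine (s1 ζ hζ h0.le).lt_of_ne fun hc => ?_
    have := hsgn _ (hQ ζ hζ)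
    rw [e.apply_symm_apply, ← hc] at this
    simp at this
    linarith
  have s3 : ∀ ζ : ℂ, ‖ζ‖ < r' / 2 → ζ.im = 0 → (e.symm ζ).im = 0 := by
    intro ζ hζ h0
    have := hsgn _ (hQ ζ hζ)
    rw [e.apply_symm_apply, h0, zero_sub, abs_neg] at this
    exact abs_eq_zero.1 (by linarith [abs_nonneg (e.symm ζ).im])
  have PsiC : Continuous (Psi γ) := h.Psi_cont
  set Gh : ℂ → ℂ := fun ζ => g (Psi γ (e.symm ζ)) / H (e.symm ζ) with hGh
  have c1 : ContinuousOn Gh ({z | 0 ≤ z.im} ∩ Metric.ball 0 (r' / 2)) := by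
    refine ContinuousOn.div ?_ (Hc.comp e.symm.continuous).continuousOn fun _ _ => Hne _
    refine gc.comp e.symm.continuous.continuousOn ?_
    rintro ζ ⟨h1, h2⟩
    have h2 : ‖ζ‖ < r' / 2 := by simpa using h2
    exact ⟨(hbox _ (hQ ζ h2)).1, s1 ζ h2 h1, (hbox _ (hQ ζ h2)).2⟩
  have c2 : ∀ z ∈ Metric.ball (0 : ℂ) (r' / 2), 0 < z.im → DifferentiableAt ℂ Gh z := by
    intro ζ h2 h1
    have h2' : ‖ζ‖ < r' / 2 := by simpa using h2
    have hw := hQ ζ h2'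
    have hwi := s2 ζ h2' h1
    obtain ⟨_, d2, d3, d4⟩ := hup _ (hw.trans_le hr1) hwi
    have hnhd : ∀ᶠ y in 𝓝 ζ, ‖y‖ < r' / 2 ∧ 0 < y.im :=
      (continuous_norm.tendsto ζ |>.eventually (eventually_lt_nhds h2')).and
        (Complex.continuous_im.tendsto ζ |>.eventually (eventually_gt_nhds h1))
    have hT : HasDerivAt (fun y => Psi γ (e.symm y)) (H (e.symm ζ))⁻¹ ζ := by
      refine HasDerivAt.of_local_left_inverse (f := φ) ?_ d2 (Hne _) ?_
      · exact (PsiC.comp e.symm.continuous).continuousAt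
      · filter_upwards [hnhd] with y hy
        rw [(hup _ ((hQ y hy.1).trans_le hr1) (s2 y hy.1 hy.2)).1, e.apply_symm_apply]
    have hg := gd _ (hbox _ hw).1 hwi (hbox _ hw).2
    have hD : DifferentiableAt ℂ (fun y => g (Psi γ (e.symm y)) / hh (Psi γ (e.symm y))) ζ := by
      refine DifferentiableAt.div ?_ ?_ (by rw [← d4]; exact Hne _)
      · exact DifferentiableAt.comp (g := g) ζ hg hT.differentiableAt
      · exact DifferentiableAt.comp (g := hh) ζ d3 hT.differentiableAt
    refine hD.congr_of_eventuallyEq ?_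
    filter_upwards [hnhd] with y hy
    rw [hGh]
    show _ / _ = _ / _
    rw [(hup _ ((hQ y hy.1).trans_le hr1) (s2 y hy.1 hy.2)).2.2.2]
  have c3 : ∀ x : ℝ, |x| < r' / 2 → (Gh x).re = 0 := by
    intro x hx
    have hx' : ‖(x : ℂ)‖ < r' / 2 := by rwa [Complex.norm_real, Real.norm_eq_abs]
    have hw := hQ _ hx'
    have hi := s3 _ hx' (by simp)
    set w := e.symm (x : ℂ) with hwd
    have hwr : w = (w.re : ℂ) := by apply Complex.ext <;> simp [hi]
    have hwl : |w.re| < r' := (Complex.abs_re_le_norm w).trans_lt hw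
    obtain ⟨p, hp, hp2⟩ := hpos w.re (hwl.trans_le hr1)
    have := gb w.re (hwl.trans_le hr2)
    rw [hGh]
    show (g (Psi γ w) / H w).re = 0
    rw [hwr, Psi_real]
    have hH := Hne (w.re : ℂ)
    have hγ : γ' w.re ≠ 0 := by
      intro h0
      rw [h0, mul_zero] at hp2
      exact hp.ne (by exact_mod_cast hp2)
    have e5 : g (γ w.re) / H (w.re : ℂ) = (g (γ w.re) * γ' w.re) / (p : ℂ) := by
      rw [← hp2]; field_simp
    rw [e5, Complex.div_ofReal_re, this, zero_div]
  obtain ⟨E, hE, hEG⟩ := schwarz_reflection c1 c2 c3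
  have hEa : AnalyticAt ℂ E 0 :=
    hE.analyticAt (Metric.ball_mem_nhds _ (by positivity))
  have hgE : ∀ w : ℂ, ‖w‖ < r' / 4 → 0 ≤ w.im → g (Psi γ w) = H w * E (e w) := by
    intro w hw hi
    have h1 := near_upper hnear w 0
    rw [e0, sub_zero, sub_zero] at h1
    have h2 := hsgn w (by linarith)
    rw [abs_of_nonneg hi, abs_le] at h2
    rw [hEG (e w) (by simp; linarith) (by linarith [h2.1])]
    simp only [hGh, e.symm_apply_apply]
    field_simp [Hne w]
  by_cases hz : ∀ᶠ z in 𝓝 0, E z = 0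
  · left
    rw [Metric.eventually_nhds_iff] at hz
    obtain ⟨δ, hδ, hz⟩ := hz
    refine ⟨min (δ / 2) (r' / 4), by positivity, fun w hw hi => ?_⟩
    rw [hgE w (hw.trans_le (min_le_right _ _)) hi]
    have h1 := near_upper hnear w 0
    rw [e0, sub_zero, sub_zero] at h1
    rw [hz (by rw [dist_zero_right]; linarith [hw.trans_le (min_le_left _ _)]), mul_zero]
  · right
    obtain ⟨m, q, hq, hq0, hEq⟩ := hEa.exists_eventuallyEq_pow_smul_nonzero_iff.2 hz
    refine ⟨m, q 0, hq0, ?_⟩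
    obtain ⟨k, hk1, hk2⟩ := h.ratio_tendsto e0 hsm
    rw [isLittleO_iff_exists_eq_mul]
    refine ⟨fun w => H w * q (e w) * k w ^ m - q 0, ?_, ?_⟩
    · have t1 : Tendsto H (𝓝[{w | 0 ≤ w.im}] 0) (𝓝 1) := by
        rw [← H0]; exact (Hc.tendsto 0).mono_left nhdsWithin_le_nhds
      have t2 : Tendsto (fun w => q (e w)) (𝓝[{w | 0 ≤ w.im}] 0) (𝓝 (q 0)) := by
        have := hq.continuousAt.tendsto.comp (by simpa [e0] using e.continuous.tendsto 0)
        exact this.mono_left nhdsWithin_le_nhds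
      have := ((t1.mul t2).mul (hk2.pow m)).sub_const (q 0)
      simpa using this
    · have n1 : ∀ᶠ w in 𝓝[{w : ℂ | 0 ≤ w.im}] 0, ‖w‖ < r' / 4 := by
        refine eventually_nhdsWithin_of_eventually_nhds ?_
        have := continuous_norm.tendsto (0 : ℂ)
        rw [norm_zero] at this
        exact this.eventually (eventually_lt_nhds (by positivity))
      have n2 : ∀ᶠ w in 𝓝[{w : ℂ | 0 ≤ w.im}] 0, E (e w) = (e w) ^ m * q (e w) := by
        refine eventually_nhdsWithin_of_eventually_nhds ?_
        have := e.continuous.tendsto 0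
        rw [e0] at this
        filter_upwards [this.eventually hEq] with w hw
        rw [hw]; simp
      filter_upwards [n1, n2, self_mem_nhdsWithin] with w h1 h2 h3
      have h4 : e w ^ m = k w ^ m * Psi γ w ^ m := by rw [← hk1 w, mul_pow]
      rw [hgE w h1 h3, h2, h4]
      simp only [Pi.mul_apply]
      ring

end NC

end


section
open Complex Topology Filter Asymptotics MeasureTheory

namespace NC

/-- the clamp to `[-1,1]` -/
noncomputable def clamp (t : ℝ) : ℝ := max (-1) (min 1 t)

theorem clamp_abs (t : ℝ) : |clamp t| ≤ 1 := by
  rw [clamp, abs_le]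
  exact ⟨le_max_left _ _, max_le (by norm_num) (min_le_left _ _)⟩

theorem clamp_eq {t : ℝ} (ht : |t| ≤ 1) : clamp t = t := by
  rw [abs_le] at ht
  rw [clamp, min_eq_right ht.2, max_eq_right ht.1]

theorem clamp_lip (s t : ℝ) : |clamp t - clamp s| ≤ |t - s| := by
  rw [clamp, clamp]
  refine (abs_max_sub_max_le_max _ _ _ _).trans ?_
  simp only [sub_self, abs_zero]
  refine max_le (abs_nonneg _) ?_
  refine (abs_min_sub_min_le_max _ _ _ _).trans ?_
  simp

theorem exists_NC {γ : ℝ → ℂ} (hd : ∀ t, HasDerivAt γ (deriv γ t) t) {α C : NNReal} (hα0 : 0 < α)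
    (hα1 : α < 1) (hH : HolderWith C α (deriv γ)) (a : ℝ) (ha : deriv γ a ≠ 0) :
    ∃ η > 0, η * (1 + cst α) ≤ 1 / 100 ∧ ∃ δ₀ > 0, ∀ δ : ℝ, 0 < δ → δ ≤ δ₀ → ∀ s : ℝ,
      (s = 1 ∨ s = -1) → ∃ β β' : ℝ → ℂ, NC α η β β' ∧
        (∀ t : ℝ, |t| ≤ 1 → γ (a + s * δ * t) = γ a + δ * (s * deriv γ a) * β t) ∧
        (∀ t : ℝ, |t| ≤ 1 → β' t = deriv γ (a + s * δ * t) / deriv γ a) := by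
  have hcst : 0 ≤ |cst α| := abs_nonneg _
  have hA : 0 < ‖deriv γ a‖ := norm_pos_iff.2 ha
  set η : ℝ := 1 / 100 / (1 + |cst α|) with hη
  have hη0 : 0 < η := by positivity
  have hη1 : η ≤ 1 / 100 := by
    rw [hη]; exact div_le_self (by norm_num) (by linarith)
  have hη2 : η * (1 + cst α) ≤ 1 / 100 := by
    have : η * (1 + |cst α|) = 1 / 100 := by rw [hη]; field_simp
    nlinarith [le_abs_self (cst α)]
  have hαr : 0 < (α : ℝ) := by exact_mod_cast hα0
  have hαr1 : (α : ℝ) < 1 := by exact_mod_cast hα1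
  have hlim : Tendsto (fun δ : ℝ => (C : ℝ) * δ ^ (α : ℝ) / ‖deriv γ a‖) (𝓝 0) (𝓝 0) := by
    have : Continuous fun δ : ℝ => (C : ℝ) * δ ^ (α : ℝ) / ‖deriv γ a‖ := by
      have := Real.continuous_rpow_const hαr.le
      fun_prop
    have h2 := this.tendsto 0
    simpa [Real.zero_rpow hαr.ne'] using h2
  obtain ⟨δ₁, hδ₁, hlt⟩ := Metric.eventually_nhds_iff.1 (hlim.eventually (eventually_lt_nhds hη0))
  refine ⟨η, hη0, hη2, δ₁ / 2, by positivity, fun δ hδ hδ2 s hs => ?_⟩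
  have hsm : (C : ℝ) * δ ^ (α : ℝ) / ‖deriv γ a‖ ≤ η :=
    (hlt (by rw [dist_zero_right, Real.norm_eq_abs, abs_of_pos hδ]; linarith)).le
  have hs1 : |s| = 1 := by rcases hs with rfl | rfl <;> simp
  have hs2 : (s : ℂ) * s = 1 := by rcases hs with rfl | rfl <;> simp
  have hs0 : (s : ℂ) ≠ 0 := fun h0 => by simp [h0] at hs2
  have hol0 : ∀ x y : ℝ, ‖deriv γ x - deriv γ y‖ ≤ C * |x - y| ^ (α : ℝ) := by
    intro x y
    have := hH.dist_le x y
    rwa [dist_eq_norm, Real.dist_eq] at this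
  set β' : ℝ → ℂ := fun t => deriv γ (a + s * δ * clamp t) / deriv γ a with hβ'
  have hol : ∀ x t : ℝ, ‖β' t - β' x‖ ≤ C * δ ^ (α : ℝ) / ‖deriv γ a‖ * |clamp t - clamp x| ^ (α : ℝ) := by
    intro x t
    rw [hβ']
    show ‖_ / _ - _ / _‖ ≤ _
    rw [← sub_div, norm_div, div_mul_eq_mul_div]
    gcongr
    refine (hol0 _ _).trans (le_of_eq ?_)
    have : a + s * δ * clamp t - (a + s * δ * clamp x) = s * δ * (clamp t - clamp x) := by ring
    rw [this, abs_mul, abs_mul, hs1, one_mul, abs_of_pos hδ, Real.mul_rpow hδ.le (abs_nonneg _)]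
    ring
  have cl0 : clamp 0 = 0 := clamp_eq (by simp)
  have b0 : β' 0 = 1 := by
    simp [hβ', cl0, ha]
  have hc : Continuous β' := by
    have h1 : Continuous (deriv γ) := hH.continuous hα0
    have h2 : Continuous clamp := by unfold clamp; fun_prop
    rw [hβ']
    fun_prop
  have hd' : ∀ t, HasDerivAt (fun t => ∫ x in (0 : ℝ)..t, β' x) (β' t) t := fun t =>
    intervalIntegral.integral_hasDerivAt_right (hc.intervalIntegrable _ _)
      (hc.stronglyMeasurableAtFilter _ _) hc.continuousAt
  refine ⟨fun t => ∫ x in (0 : ℝ)..t, β' x, β', ?_, ?_, ?_⟩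
  · refine ⟨hαr, hαr1, hη0, hη1, hd', by simp, b0, ?_, ?_⟩
    · intro t
      have := hol 0 t
      rw [b0, cl0, sub_zero] at this
      refine this.trans ?_
      calc _ ≤ η * 1 := by
            refine mul_le_mul hsm ?_ (by positivity) hη0.le
            exact Real.rpow_le_one (abs_nonneg _) (clamp_abs t) hαr.le
        _ = η := mul_one _
    · intro x t
      refine (hol x t).trans ?_
      refine mul_le_mul hsm ?_ (by positivity) hη0.le
      exact Real.rpow_le_rpow (abs_nonneg _) (clamp_lip x t) hαr.le
  · intro t ht
    have hder : ∀ x ∈ Set.uIcc (0 : ℝ) t, HasDerivAt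
        (fun x : ℝ => γ (a + s * δ * x) / (δ * (s * deriv γ a))) (β' x) x := by
      intro x hx
      have hx1 : |x| ≤ 1 := by
        have := Set.abs_sub_left_of_mem_uIcc hx
        simp only [sub_zero] at this
        exact this.trans ht
      have d1 : HasDerivAt (fun x : ℝ => a + s * δ * x) (s * δ) x := by
        simpa using ((hasDerivAt_id x).const_mul (s * δ)).const_add a
      have d2 := ((hd (a + s * δ * x)).scomp x d1).div_const (δ * (s * deriv γ a))
      refine d2.congr_deriv ?_
      simp only [hβ', clamp_eq hx1, Complex.real_smul]
      push_cast
      have : (δ : ℂ) ≠ 0 := by exact_mod_cast hδ.ne'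
      field_simp
    have := intervalIntegral.integral_eq_sub_of_hasDerivAt hder (hc.intervalIntegrable _ _)
    show _ = _ + _ * ∫ x in (0 : ℝ)..t, β' x
    rw [this]
    have : (δ : ℂ) ≠ 0 := by exact_mod_cast hδ.ne'
    simp only [mul_zero, add_zero]
    field_simp
    ring
  · intro t ht
    simp only [hβ', clamp_eq ht]

end NC

end


section
open Complex Topology Filter Asymptotics MeasureTheory

theorem side_dichotomy {Ω S : Set ℂ} (hΩ : IsOpen Ω) (hS : IsPreconnected S)
    (hd : ∀ z ∈ S, z ∉ frontier Ω) : S ⊆ Ω ∨ S ⊆ (closure Ω)ᶜ := by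
  refine hS.subset_or_subset hΩ isClosed_closure.isOpen_compl ?_ ?_
  · rw [Set.disjoint_compl_right_iff_subset]; exact subset_closure
  · intro z hz
    by_cases hc : z ∈ closure Ω
    · left
      have := hd z hz
      rw [hΩ.frontier_eq] at this
      by_contra h0
      exact this ⟨hc, h0⟩
    · right; exact hc

theorem IsSCC.near_param {γ : ℝ → ℂ} (h : IsSCC γ) (a : ℝ) {δ : ℝ} (hδ : 0 < δ) :
    ∃ κ > 0, ∀ t, ‖γ t - γ a‖ < κ → ∃ x, |x| < δ ∧ γ (a + x) = γ t := by
  have hc := h.continuous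
  have hK : IsCompact (Set.Icc (a - 1 / 2) (a + 1 / 2) ∩ {t | δ ≤ |t - a|}) :=
    isCompact_Icc.inter_right (isClosed_le continuous_const (by fun_prop))
  have hf : ContinuousOn (fun t => ‖γ t - γ a‖)
      (Set.Icc (a - 1 / 2) (a + 1 / 2) ∩ {t | δ ≤ |t - a|}) := by fun_prop
  obtain ⟨κ, hκ, hmin⟩ := hK.exists_forall_le' hf (a := 0) (by
    rintro t ⟨⟨h1, h2⟩, h3⟩
    rw [norm_pos_iff, sub_ne_zero]
    intro h4
    obtain ⟨n, hn⟩ := h.eq_imp h4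
    have h5 : |(n : ℝ)| < 1 := by rw [← hn, abs_lt]; constructor <;> linarith
    have h6 : n = 0 := by
      rw [← Int.abs_lt_one_iff]; exact_mod_cast h5
    rw [h6, Int.cast_zero] at hn
    have h3 : δ ≤ |t - a| := h3
    rw [hn, abs_zero] at h3
    linarith)
  refine ⟨κ, hκ, fun t ht => ⟨t - a - round (t - a), ?_, ?_⟩⟩
  · by_contra hcon
    push Not at hcon
    have hr := abs_sub_round (t - a)
    rw [abs_le] at hr
    have e1 : γ (t - (round (t - a) : ℤ)) = γ t := h.sub_int t _
    have := hmin (t - (round (t - a) : ℤ)) ⟨⟨by linarith [hr.1], by linarith [hr.2]⟩, by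
      show δ ≤ |_|
      rwa [show t - (round (t - a) : ℤ) - a = t - a - (round (t - a) : ℤ) by ring]⟩
    simp only [e1] at this
    linarith
  · rw [show a + (t - a - (round (t - a) : ℤ)) = t - (round (t - a) : ℤ) by ring]
    exact h.sub_int t _

/-- domains bounded by disjoint `C^{1,α}` curves -/
structure Dom (Ω : Set ℂ) {J : ℕ} (γ : Fin J → ℝ → ℂ) (α : NNReal) : Prop where
  o : IsOpen Ω
  c : IsConnected Ω
  b : Bornology.IsBounded Ω
  a0 : 0 < α
  a1 : α < 1
  scc : ∀ j, IsSCC (γ j)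
  hol : ∀ j, ∃ C : NNReal, HolderWith C α (deriv (γ j))
  dis : ∀ j k, j ≠ k → ∀ s t, γ j s ≠ γ k t
  fr : frontier Ω = ⋃ j, Set.range (γ j)

/-- boundary chart -/
structure BC (α : ℝ) (γ : ℝ → ℂ) (a s η δ r : ℝ) (β β' : ℝ → ℂ) (E : ℂ ≃ₜ ℂ) : Prop where
  nc : NC α η β β'
  hη : η * (1 + NC.cst α) ≤ 1 / 100
  δ0 : 0 < δ
  r0 : 0 < r
  r1 : r ≤ 1
  par : ∀ t : ℝ, |t| ≤ 1 → γ (a + s * δ * t) = γ a + δ * (s * deriv γ a) * β t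
  par' : ∀ t : ℝ, |t| ≤ 1 → β' t = deriv γ (a + s * δ * t) / deriv γ a
  hE : ∀ w, E w = γ a + δ * (s * deriv γ a) * NC.Psi β w

theorem BC.E_zero {α : ℝ} {γ : ℝ → ℂ} {a s η δ r : ℝ} {β β' : ℝ → ℂ} {E : ℂ ≃ₜ ℂ}
    (h : BC α γ a s η δ r β β' E) : E 0 = γ a := by
  rw [h.hE, h.nc.Psi_zero]; ring

theorem BC.E_real {α : ℝ} {γ : ℝ → ℂ} {a s η δ r : ℝ} {β β' : ℝ → ℂ} {E : ℂ ≃ₜ ℂ}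
    (h : BC α γ a s η δ r β β' E) {x : ℝ} (hx : |x| ≤ 1) : E x = γ (a + s * δ * x) := by
  rw [h.hE, NC.Psi_real, h.par x hx]

theorem BC.E_I {α : ℝ} {γ : ℝ → ℂ} {a s η δ r : ℝ} {β β' : ℝ → ℂ} {E : ℂ ≃ₜ ℂ}
    (h : BC α γ a s η δ r β β' E) (y : ℝ) : E (y * I) = γ a + s * (δ * y : ℝ) * I * deriv γ a := by
  rw [h.hE]
  have : NC.Psi β (y * I) = y * I := by
    simp [NC.Psi, h.nc.h0]
  rw [this]; push_cast; ring

namespace Dom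

theorem frontier_curve {Ω : Set ℂ} {J : ℕ} {γ : Fin J → ℝ → ℂ} {α : NNReal} (D : Dom Ω γ α)
    (j : Fin J) (t : ℝ) : γ j t ∈ frontier Ω := by
  rw [D.fr]; exact Set.mem_iUnion.2 ⟨j, t, rfl⟩

theorem not_mem {Ω : Set ℂ} {J : ℕ} {γ : Fin J → ℝ → ℂ} {α : NNReal} (D : Dom Ω γ α)
    (j : Fin J) {z : ℂ} (hz : z ∉ frontier Ω) : z ∉ Set.range (γ j) := by
  rintro ⟨t, rfl⟩; exact hz (D.frontier_curve j t)

theorem mem_not_frontier {Ω : Set ℂ} {J : ℕ} {γ : Fin J → ℝ → ℂ} {α : NNReal} (D : Dom Ω γ α)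
    {z : ℂ} (hz : z ∈ Ω) : z ∉ frontier Ω := by
  rw [D.o.frontier_eq]; exact fun h => h.2 hz

theorem exists_chart {Ω : Set ℂ} {J : ℕ} {γ : Fin J → ℝ → ℂ} {α : NNReal} (D : Dom Ω γ α)
    (j : Fin J) (a s : ℝ) (hs : s = 1 ∨ s = -1) :
    ∃ (η δ r : ℝ) (β β' : ℝ → ℂ) (E : ℂ ≃ₜ ℂ), BC α (γ j) a s η δ r β β' E ∧
      (∀ w, ‖w‖ < r → (E w ∈ frontier Ω ↔ w.im = 0)) ∧
      (∀ k, k ≠ j → ∀ w, ‖w‖ < r → E w ∉ Set.range (γ k)) := by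
  have hj := D.scc j
  obtain ⟨C, hC⟩ := D.hol j
  obtain ⟨η, hη0, hη, δ, hδ, hNC⟩ := NC.exists_NC hj.hasDerivAt D.a0 D.a1 hC a (hj.reg a)
  obtain ⟨β, β', nc, par, par'⟩ := hNC δ hδ le_rfl s hs
  have hs0 : (s : ℂ) ≠ 0 := by rcases hs with rfl | rfl <;> simp
  have hss : s * s = 1 := by rcases hs with rfl | rfl <;> simp
  have hδc : (δ : ℂ) ≠ 0 := by exact_mod_cast hδ.ne'
  have hd0 : (δ : ℂ) * (s * deriv (γ j) a) ≠ 0 := mul_ne_zero hδc (mul_ne_zero hs0 (hj.reg a))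
  obtain ⟨e, he⟩ := near_id_homeo nc.Psi_near2
  set E : ℂ ≃ₜ ℂ := (e.trans (Homeomorph.mulLeft₀ _ hd0)).trans (Homeomorph.addLeft (γ j a)) with hEd
  have hE : ∀ w, E w = γ j a + δ * (s * deriv (γ j) a) * NC.Psi β w := by
    intro w
    simp [hEd, he]
  have E0 : E 0 = γ j a := by rw [hE, nc.Psi_zero]; ring
  obtain ⟨κ, hκ, hnear⟩ := hj.near_param a hδ
  have ev1 : ∀ᶠ w in 𝓝 (0 : ℂ), ‖E w - γ j a‖ < κ := by
    have hc : Continuous fun w => ‖E w - γ j a‖ := by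
      have := E.continuous
      fun_prop
    have h1 := hc.tendsto 0
    rw [E0, sub_self, norm_zero] at h1
    exact h1.eventually (eventually_lt_nhds hκ)
  have ev2 : ∀ᶠ w in 𝓝 (0 : ℂ), ∀ k, k ≠ j → E w ∉ Set.range (γ k) := by
    rw [eventually_all]
    intro k
    by_cases hk : k = j
    · exact Eventually.of_forall fun _ h => absurd hk h
    · have h1 := E.continuous.tendsto 0
      rw [E0] at h1
      have h2 : γ j a ∉ Set.range (γ k) := by
        rintro ⟨t, ht⟩
        exact D.dis k j hk t a ht
      have h3 := (D.scc k).isCompact_range.isClosed.isOpen_compl.mem_nhds h2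
      filter_upwards [h1.eventually h3] with w hw _
      exact hw
  obtain ⟨r, hr, hev⟩ := Metric.eventually_nhds_iff.1 (ev1.and ev2)
  have hev' : ∀ w : ℂ, ‖w‖ < min r 1 → ‖E w - γ j a‖ < κ ∧ ∀ k, k ≠ j → E w ∉ Set.range (γ k) := by
    intro w hw
    exact hev (by rw [dist_zero_right]; exact hw.trans_le (min_le_left _ _))
  have bc : BC α (γ j) a s η δ (min r 1) β β' E :=
    ⟨nc, hη, hδ, lt_min hr one_pos, min_le_right _ _, par, par', hE⟩
  refine ⟨η, δ, min r 1, β, β', E, bc, fun w hw => ⟨fun hf => ?_, fun hi => ?_⟩,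
    fun k hk w hw => (hev' w hw).2 k hk⟩
  · rw [D.fr, Set.mem_iUnion] at hf
    obtain ⟨k, hk⟩ := hf
    by_cases hkj : k = j
    · subst hkj
      obtain ⟨t, ht⟩ := hk
      have h1 := (hev' w hw).1
      rw [← ht] at h1
      obtain ⟨x, hx, hx2⟩ := hnear t h1
      have h2 : |s * x / δ| ≤ 1 := by
        have hsa : |s| = 1 := by rcases hs with rfl | rfl <;> simp
        rw [abs_div, abs_mul, hsa, one_mul, abs_of_pos hδ, div_le_one hδ]
        exact hx.le
      have h3 := bc.E_real h2
      have h4 : a + s * δ * (s * x / δ) = a + x := by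
        field_simp
        rw [show s ^ 2 = 1 by rw [sq, hss]]; ring
      rw [h4, hx2, ht] at h3
      rw [← E.injective h3, Complex.ofReal_im]
    · exact absurd hk ((hev' w hw).2 k hkj)
  · have h1 : w = (w.re : ℂ) := by apply Complex.ext <;> simp [hi]
    rw [h1, bc.E_real ((Complex.abs_re_le_norm w).trans (hw.le.trans (min_le_right _ _)))]
    exact D.frontier_curve j _

end Dom

end


section
open Complex Topology Filter Asymptotics MeasureTheory

theorem half_disc_convex (r q : ℝ) : Convex ℝ {w : ℂ | ‖w‖ < r ∧ 0 < q * w.im} := by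
  have h1 : {w : ℂ | ‖w‖ < r ∧ 0 < q * w.im} = Metric.ball 0 r ∩ {w : ℂ | 0 < q * w.im} := by
    ext w; simp
  rw [h1]
  refine (convex_ball _ _).inter ?_
  intro x hx y hy a b ha hb hab
  have hx : 0 < q * x.im := hx
  have hy : 0 < q * y.im := hy
  show 0 < q * (a • x + b • y).im
  have : q * (a • x + b • y).im = a * (q * x.im) + b * (q * y.im) := by
    simp; ring
  rw [this]
  rcases ha.eq_or_lt with h | h
  · have : b = 1 := by linarith
    rw [← h, this]; linarith
  · have := mul_pos h hx
    have := mul_nonneg hb hy.le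
    linarith

namespace Dom

/-- winding number on one side of the boundary -/
theorem side_nw {Ω : Set ℂ} {J : ℕ} {γ : Fin J → ℝ → ℂ} {α : NNReal} (D : Dom Ω γ α)
    {j : Fin J} {a s τ η δ r : ℝ} {β β' : ℝ → ℂ} {E : ℂ ≃ₜ ℂ} (hs : s = 1 ∨ s = -1)
    (hT : HasWind (secT (γ j) a) (τ / 2)) (bc : BC α (γ j) a s η δ r β β' E)
    (hfr : ∀ w, ‖w‖ < r → (E w ∈ frontier Ω ↔ w.im = 0)) {q : ℝ} (hq : q = 1 ∨ q = -1) :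
    (∀ w, ‖w‖ < r → 0 < q * w.im → nw (γ j) (E w) = τ / 2 + q * s / 2) ∧
    ((∀ w, ‖w‖ < r → 0 < q * w.im → E w ∈ Ω) ∨
      (∀ w, ‖w‖ < r → 0 < q * w.im → E w ∉ closure Ω)) := by
  have hS : IsPreconnected (E '' {w : ℂ | ‖w‖ < r ∧ 0 < q * w.im}) :=
    (half_disc_convex r q).isPreconnected.image _ E.continuous.continuousOn
  have hav : ∀ z ∈ E '' {w : ℂ | ‖w‖ < r ∧ 0 < q * w.im}, z ∉ frontier Ω := by
    rintro _ ⟨w, ⟨h1, h2⟩, rfl⟩ h3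
    rw [hfr w h1] at h3
    rw [h3, mul_zero] at h2
    exact lt_irrefl _ h2
  have hqq : q * q = 1 := by rcases hq with rfl | rfl <;> norm_num
  constructor
  · intro w hw hi
    obtain ⟨ε, hε, hjump⟩ := (D.scc j).jump a hT
    set y : ℝ := min (r / 2) (ε / (2 * δ)) with hy
    have hδ := bc.δ0
    have hr := bc.r0
    have hy0 : 0 < y := lt_min (by linarith) (by positivity)
    have hqs : q * s = 1 ∨ q * s = -1 := by
      rcases hq with rfl | rfl <;> rcases hs with rfl | rfl <;> norm_num
    have h1 := hjump (q * s) hqs (δ * y) (by positivity) (by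
      have : y ≤ ε / (2 * δ) := min_le_right _ _
      rw [le_div_iff₀ (by positivity)] at this
      nlinarith)
    have h2 : nw (γ j) (E ((q * y : ℝ) * I)) = τ / 2 + q * s / 2 := by
      refine HasWind.wnum_eq ?_
      rw [bc.E_I]
      have e1 : (s : ℂ) * ((δ * (q * y) : ℝ) : ℂ) * I * deriv (γ j) a =
        ((q * s : ℝ) : ℂ) * ((δ * y : ℝ) : ℂ) * I * deriv (γ j) a := by push_cast; ring
      rw [e1]
      exact h1
    rw [← h2]
    refine (D.scc j).nw_preconnected hS (fun z hz => D.not_mem j (hav z hz)) ⟨w, ⟨hw, hi⟩, rfl⟩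
      ⟨_, ⟨?_, ?_⟩, rfl⟩
    · rw [norm_mul, norm_I, mul_one, Complex.norm_real, Real.norm_eq_abs, abs_mul,
        abs_of_pos hy0]
      have : |q| = 1 := by rcases hq with rfl | rfl <;> norm_num
      rw [this, one_mul]
      have : y ≤ r / 2 := min_le_left _ _
      linarith
    · simp only [mul_im, ofReal_re, I_im, ofReal_im, I_re, mul_zero, mul_one, add_zero]
      rw [← mul_assoc, hqq, one_mul]; exact hy0
  · rcases side_dichotomy D.o hS hav with h | h
    · left
      exact fun w h1 h2 => h ⟨w, ⟨h1, h2⟩, rfl⟩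
    · right
      exact fun w h1 h2 => h ⟨w, ⟨h1, h2⟩, rfl⟩

theorem sides {Ω : Set ℂ} {J : ℕ} {γ : Fin J → ℝ → ℂ} {α : NNReal} (D : Dom Ω γ α)
    {j : Fin J} {a s τ η δ r : ℝ} {β β' : ℝ → ℂ} {E : ℂ ≃ₜ ℂ} (hs : s = 1 ∨ s = -1)
    (hT : HasWind (secT (γ j) a) (τ / 2)) (bc : BC α (γ j) a s η δ r β β' E)
    (hfr : ∀ w, ‖w‖ < r → (E w ∈ frontier Ω ↔ w.im = 0)) {z₀ : ℂ} (hz₀ : z₀ ∈ Ω) :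
    ∃ q : ℝ, (q = 1 ∨ q = -1) ∧ nw (γ j) z₀ = τ / 2 + q * s / 2 ∧
      (∀ w, ‖w‖ < r → 0 < q * w.im → E w ∈ Ω) ∧
      (∀ w, ‖w‖ < r → q * w.im < 0 → E w ∉ closure Ω ∧ nw (γ j) (E w) = τ / 2 - q * s / 2) := by
  have hnΩ : ∀ z ∈ Ω, nw (γ j) z = nw (γ j) z₀ := fun z hz =>
    (D.scc j).nw_preconnected D.c.isPreconnected (fun z hz => D.not_mem j (D.mem_not_frontier hz))
      hz hz₀
  have hr := bc.r0
  have hex : ∃ w, ‖w‖ < r ∧ E w ∈ Ω := by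
    have h1 : γ j a ∈ closure Ω := frontier_subset_closure (D.frontier_curve j a)
    have h2 : E '' Metric.ball 0 r ∈ 𝓝 (γ j a) := by
      rw [← bc.E_zero]
      exact E.isOpenMap.image_mem_nhds (Metric.ball_mem_nhds _ hr)
    obtain ⟨_, ⟨w, hw, rfl⟩, h3⟩ := mem_closure_iff_nhds.1 h1 _ h2
    exact ⟨w, by simpa using hw, h3⟩
  obtain ⟨w, hw, hwΩ⟩ := hex
  have hi : w.im ≠ 0 := fun h0 => D.mem_not_frontier hwΩ ((hfr w hw).2 h0)
  obtain ⟨q, hq, hqw⟩ : ∃ q : ℝ, (q = 1 ∨ q = -1) ∧ 0 < q * w.im := by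
    rcases lt_or_gt_of_ne hi with h | h
    · exact ⟨-1, Or.inr rfl, by linarith⟩
    · exact ⟨1, Or.inl rfl, by linarith⟩
  obtain ⟨n1, d1⟩ := D.side_nw hs hT bc hfr hq
  have hq' : -q = 1 ∨ -q = -1 := by rcases hq with rfl | rfl <;> norm_num
  obtain ⟨n2, d2⟩ := D.side_nw hs hT bc hfr hq'
  have hn : nw (γ j) z₀ = τ / 2 + q * s / 2 := by rw [← hnΩ _ hwΩ, n1 w hw hqw]
  have hin : ∀ w, ‖w‖ < r → 0 < q * w.im → E w ∈ Ω := by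
    rcases d1 with d | d
    · exact d
    · exact absurd (subset_closure hwΩ) (d w hw hqw)
  have hqs : q * s ≠ 0 := by
    rcases hq with rfl | rfl <;> rcases hs with rfl | rfl <;> norm_num
  have hout : ∀ w, ‖w‖ < r → 0 < -q * w.im → E w ∉ closure Ω := by
    rcases d2 with d | d
    · exfalso
      have hc : ‖-w‖ < r := by rwa [norm_neg]
      have hc2 : 0 < -q * (-w).im := by simpa using hqw
      have h1 := n2 _ hc hc2
      rw [hnΩ _ (d _ hc hc2), hn] at h1
      apply hqs
      linarith
    · exact d
  refine ⟨q, hq, hn, hin, fun w h1 h2 => ⟨hout w h1 (by linarith), ?_⟩⟩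
  rw [n2 w h1 (by linarith)]; ring

/-- orientation signs -/
theorem orient {Ω : Set ℂ} {J : ℕ} {γ : Fin J → ℝ → ℂ} {α : NNReal} (D : Dom Ω γ α) {z₀ : ℂ}
    (hz₀ : z₀ ∈ Ω) (j : Fin J) : ∃ σ τ : ℝ, (σ = 1 ∨ σ = -1) ∧ HasWind (deriv (γ j)) τ ∧
      (∀ a, HasWind (secT (γ j) a) (τ / 2)) ∧ nw (γ j) z₀ = τ / 2 + σ / 2 ∧
      ∀ a, ∃ (η δ r : ℝ) (β β' : ℝ → ℂ) (E : ℂ ≃ₜ ℂ), BC α (γ j) a σ η δ r β β' E ∧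
      (∀ w, ‖w‖ < r → 0 < w.im → E w ∈ Ω) ∧
      (∀ w, ‖w‖ < r → w.im = 0 → E w ∈ frontier Ω) ∧
      (∀ w, ‖w‖ < r → w.im < 0 → E w ∉ closure Ω ∧ nw (γ j) (E w) = nw (γ j) z₀ - σ ∧
        ∀ k, k ≠ j → nw (γ k) (E w) = nw (γ k) z₀) := by
  obtain ⟨τ, h1, h2⟩ := (D.scc j).hopf
  obtain ⟨η, δ, r, β, β', E, bc, hfr, _⟩ := D.exists_chart j 0 1 (Or.inl rfl)
  obtain ⟨σ, hσ, hn, -, -⟩ := D.sides (Or.inl rfl) (h2 0) bc hfr hz₀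
  rw [mul_one] at hn
  refine ⟨σ, τ, hσ, h1, h2, hn, fun a => ?_⟩
  obtain ⟨η, δ, r, β, β', E, bc, hfr, hoth⟩ := D.exists_chart j a σ hσ
  obtain ⟨q, hq, hn2, hin, hout⟩ := D.sides hσ (h2 a) bc hfr hz₀
  have hq1 : q = 1 := by
    rcases hq with h | h
    · exact h
    · exfalso
      rw [hn, h] at hn2
      rcases hσ with rfl | rfl <;> linarith
  subst hq1
  refine ⟨η, δ, r, β, β', E, bc, fun w h1 h2 => hin w h1 (by linarith), fun w h1 h2 => (hfr w h1).2 h2,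
    fun w h1 h2 => ?_⟩
  obtain ⟨o1, o2⟩ := hout w h1 (by linarith)
  refine ⟨o1, by rw [o2, hn]; ring, fun k hk => ?_⟩
  have hS : IsPreconnected (E '' Metric.ball 0 r) :=
    (convex_ball _ _).isPreconnected.image _ E.continuous.continuousOn
  have hr := bc.r0
  set p : ℂ := ((r / 2 : ℝ) : ℂ) * I with hp
  have hp1 : ‖p‖ < r := by
    rw [hp, norm_mul, norm_I, mul_one, Complex.norm_real, Real.norm_eq_abs, abs_of_pos (by linarith)]
    linarith
  have hp2 : E p ∈ Ω := by
    refine hin p hp1 ?_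
    simp only [hp, mul_im, ofReal_re, I_im, ofReal_im, I_re, mul_zero, mul_one, add_zero, one_mul]
    linarith
  have e1 : nw (γ k) (E w) = nw (γ k) (E p) := by
    refine (D.scc k).nw_preconnected hS ?_ ⟨w, by simpa using h1, rfl⟩ ⟨p, by simpa using hp1, rfl⟩
    rintro _ ⟨v, hv, rfl⟩
    exact hoth k hk v (by simpa using hv)
  rw [e1]
  exact (D.scc k).nw_preconnected D.c.isPreconnected
    (fun z hz => D.not_mem k (D.mem_not_frontier hz)) hp2 hz₀

end Dom

end


section
open Complex Topology Filter Asymptotics MeasureTheory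

/-- geometric data at the boundary component `j` -/
structure Geo (Ω : Set ℂ) {J : ℕ} (γ : Fin J → ℝ → ℂ) (α : NNReal) (z₀ : ℂ) (j : Fin J) (σ τ : ℝ) :
    Prop where
  sgn : σ = 1 ∨ σ = -1
  wd : HasWind (deriv (γ j)) τ
  ws : ∀ a, HasWind (secT (γ j) a) (τ / 2)
  n : nw (γ j) z₀ = τ / 2 + σ / 2
  chart : ∀ a, ∃ (η δ r : ℝ) (β β' : ℝ → ℂ) (E : ℂ ≃ₜ ℂ), BC α (γ j) a σ η δ r β β' E ∧
      (∀ w, ‖w‖ < r → 0 < w.im → E w ∈ Ω) ∧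
      (∀ w, ‖w‖ < r → w.im = 0 → E w ∈ frontier Ω) ∧
      (∀ w, ‖w‖ < r → w.im < 0 → E w ∉ closure Ω ∧ nw (γ j) (E w) = nw (γ j) z₀ - σ ∧
        ∀ k, k ≠ j → nw (γ k) (E w) = nw (γ k) z₀)

namespace Dom

theorem exists_geo {Ω : Set ℂ} {J : ℕ} {γ : Fin J → ℝ → ℂ} {α : NNReal} (D : Dom Ω γ α) {z₀ : ℂ}
    (hz₀ : z₀ ∈ Ω) : ∃ σ τ : Fin J → ℝ, ∀ j, Geo Ω γ α z₀ j (σ j) (τ j) := by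
  have := D.orient hz₀
  choose σ τ h1 h2 h3 h4 h5 using this
  exact ⟨σ, τ, fun j => ⟨h1 j, h2 j, h3 j, h4 j, h5 j⟩⟩

theorem nw_const {Ω : Set ℂ} {J : ℕ} {γ : Fin J → ℝ → ℂ} {α : NNReal} (D : Dom Ω γ α) (j : Fin J)
    {z z₀ : ℂ} (hz : z ∈ Ω) (hz₀ : z₀ ∈ Ω) : nw (γ j) z = nw (γ j) z₀ :=
  (D.scc j).nw_preconnected D.c.isPreconnected (fun z hz => D.not_mem j (D.mem_not_frontier hz))
      hz hz₀

/-- winding number about a point of another boundary component -/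
theorem nw_bd {Ω : Set ℂ} {J : ℕ} {γ : Fin J → ℝ → ℂ} {α : NNReal} (D : Dom Ω γ α) {j k : Fin J}
    (hk : k ≠ j) (t : ℝ) {z₀ : ℂ} (hz₀ : z₀ ∈ Ω) : nw (γ k) (γ j t) = nw (γ k) z₀ := by
  have h1 : γ j t ∉ Set.range (γ k) := by
    rintro ⟨s, hs⟩
    exact D.dis k j hk s t hs
  have h2 := (D.scc k).nw_eventually h1
  have h3 : γ j t ∈ closure Ω := frontier_subset_closure (D.frontier_curve j t)
  obtain ⟨z, hz, hzΩ⟩ := mem_closure_iff_nhds.1 h3 _ h2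
  rw [← D.nw_const k hzΩ hz₀]
  exact hz.symm

theorem total {Ω : Set ℂ} {J : ℕ} {γ : Fin J → ℝ → ℂ} {α : NNReal} (D : Dom Ω γ α) {z₀ : ℂ}
    (hz₀ : z₀ ∈ Ω) {σ τ : Fin J → ℝ} (G : ∀ j, Geo Ω γ α z₀ j (σ j) (τ j)) :
    ∑ j, σ j * nw (γ j) z₀ = 1 ∧ ∀ ζ ∉ closure Ω, ∑ j, σ j * nw (γ j) ζ = 0 := by
  classical
  set M : ℂ → ℝ := fun ζ => ∑ j, σ j * nw (γ j) ζ with hM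
  set B : Set ℂ := {ζ | ζ ∉ closure Ω ∧ M ζ ≠ M z₀ - 1} with hB
  have hloc : ∀ ζ, ζ ∉ frontier Ω → ∀ᶠ z in 𝓝 ζ, M z = M ζ := by
    intro ζ hζ
    have : ∀ᶠ z in 𝓝 ζ, ∀ j, nw (γ j) z = nw (γ j) ζ :=
      eventually_all.2 fun j => (D.scc j).nw_eventually (D.not_mem j hζ)
    filter_upwards [this] with z hz
    simp only [hM, hz]
  have nf : ∀ ζ, ζ ∉ closure Ω → ζ ∉ frontier Ω := fun ζ h h2 => h (frontier_subset_closure h2)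
  have hBo : IsOpen B := by
    rw [isOpen_iff_mem_nhds]
    rintro ζ ⟨h1, h2⟩
    filter_upwards [hloc ζ (nf ζ h1), isClosed_closure.isOpen_compl.mem_nhds h1] with z hz hz2
    exact ⟨hz2, by rwa [hz]⟩
  have hBc : IsOpen Bᶜ := by
    rw [isOpen_iff_mem_nhds]
    intro ζ hζ
    by_cases h1 : ζ ∈ closure Ω
    · by_cases h2 : ζ ∈ Ω
      · filter_upwards [D.o.mem_nhds h2] with z hz hz2
        exact hz2.1 (subset_closure hz)
      · have h3 : ζ ∈ frontier Ω := by rw [D.o.frontier_eq]; exact ⟨h1, h2⟩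
        rw [D.fr, Set.mem_iUnion] at h3
        obtain ⟨j, a, rfl⟩ := h3
        obtain ⟨η, δ, r, β, β', E, bc, c1, c2, c3⟩ := (G j).chart a
        have h4 : E '' Metric.ball 0 r ∈ 𝓝 (γ j a) := by
          rw [← bc.E_zero]
          exact E.isOpenMap.image_mem_nhds (Metric.ball_mem_nhds _ bc.r0)
        filter_upwards [h4] with z hz hz2
        obtain ⟨w, hw, rfl⟩ := hz
        have hw : ‖w‖ < r := by simpa using hw
        rcases lt_trichotomy w.im 0 with h | h | h
        · obtain ⟨-, d1, d2⟩ := c3 w hw h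
          apply hz2.2
          have : ∀ k, σ k * nw (γ k) (E w) = σ k * nw (γ k) z₀ - (if k = j then 1 else 0) := by
            intro k
            by_cases hk : k = j
            · subst hk
              rw [d1, if_pos rfl]
              rcases (G k).sgn with h | h <;> rw [h] <;> ring
            · rw [d2 k hk, if_neg hk, sub_zero]
          simp only [hM, this, Finset.sum_sub_distrib, Finset.sum_ite_eq', Finset.mem_univ, if_true]
        · exact hz2.1 (frontier_subset_closure (c2 w hw h))
        · exact hz2.1 (subset_closure (c1 w hw h))
    · have h2 : M ζ = M z₀ - 1 := by
        by_contra h3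
        exact hζ ⟨h1, h3⟩
      filter_upwards [hloc ζ (nf ζ h1)] with z hz hz2
      exact hz2.2 (by rw [hz, h2])
  have hBcl : IsClopen B := ⟨⟨hBc⟩, hBo⟩
  have hBe : B = ∅ := by
    rcases isClopen_iff.1 hBcl with h | h
    · exact h
    · exfalso
      have : z₀ ∈ B := by rw [h]; trivial
      exact this.1 (subset_closure hz₀)
  have hval : ∀ ζ ∉ closure Ω, M ζ = M z₀ - 1 := by
    intro ζ hζ
    by_contra h
    have : ζ ∈ B := ⟨hζ, h⟩
    rw [hBe] at this
    exact this
  have hfar : ∃ ζ, ζ ∉ closure Ω ∧ M ζ = 0 := by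
    have := fun j => (D.scc j).nw_far
    choose R hR using this
    obtain ⟨R0, hR0⟩ := D.b.closure.exists_norm_le
    obtain ⟨S, hS⟩ : ∃ S : ℝ, (R0 < S ∧ ∀ j, R j < S) ∧ 0 < S := by
      refine ⟨1 + |R0| + ∑ j, |R j|, ⟨?_, fun j => ?_⟩, ?_⟩
      · have := Finset.sum_nonneg (fun (j : Fin J) (_ : j ∈ Finset.univ) => abs_nonneg (R j))
        linarith [le_abs_self R0]
      · have := Finset.single_le_sum (fun (j : Fin J) (_ : j ∈ Finset.univ) => abs_nonneg (R j))
          (Finset.mem_univ j)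
        linarith [le_abs_self (R j), abs_nonneg R0]
      · have := Finset.sum_nonneg (fun (j : Fin J) (_ : j ∈ Finset.univ) => abs_nonneg (R j))
        linarith [abs_nonneg R0]
    have hn : ‖(S : ℂ)‖ = S := by rw [Complex.norm_real, Real.norm_eq_abs, abs_of_pos hS.2]
    refine ⟨S, fun hc => ?_, ?_⟩
    · have := hR0 _ hc
      rw [hn] at this
      linarith [hS.1.1]
    · simp only [hM]
      refine Finset.sum_eq_zero fun j _ => ?_
      rw [(hR j _ (by rw [hn]; exact hS.1.2 j)).1, mul_zero]
  obtain ⟨ζ, h1, h2⟩ := hfar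
  have h3 := hval ζ h1
  rw [h2] at h3
  refine ⟨by show M z₀ = 1; linarith, fun ζ hζ => ?_⟩
  show M ζ = 0
  rw [hval ζ hζ]; linarith

theorem sum_tau {Ω : Set ℂ} {J : ℕ} {γ : Fin J → ℝ → ℂ} {α : NNReal} (D : Dom Ω γ α) {z₀ : ℂ}
    (hz₀ : z₀ ∈ Ω) {σ τ : Fin J → ℝ} (G : ∀ j, Geo Ω γ α z₀ j (σ j) (τ j)) :
    ∑ j, σ j * τ j = 2 - J := by
  have h1 := (D.total hz₀ G).1
  have h2 : ∀ j, σ j * τ j = 2 * (σ j * nw (γ j) z₀) - 1 := by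
    intro j
    rw [(G j).n]
    rcases (G j).sgn with h | h <;> rw [h] <;> ring
  simp only [h2, Finset.sum_sub_distrib, ← Finset.mul_sum, h1]
  simp

end Dom

end


section
open Complex Topology Filter Asymptotics MeasureTheory

theorem cone_convex (r : ℝ) : Convex ℝ {w : ℂ | ‖w‖ < r ∧ |w.re| < w.im} := by
  have h1 : {w : ℂ | ‖w‖ < r ∧ |w.re| < w.im} =
      Metric.ball 0 r ∩ {w : ℂ | |w.re| < w.im} := by
    ext w; simp
  rw [h1]
  refine (convex_ball _ _).inter ?_
  intro x hx y hy a b ha hb hab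
  have hx : |x.re| < x.im := hx
  have hy : |y.re| < y.im := hy
  show |(a • x + b • y).re| < (a • x + b • y).im
  rw [abs_lt] at hx hy ⊢
  simp only [add_re, real_smul, mul_re, ofReal_re, ofReal_im, zero_mul, sub_zero, add_im, mul_im,
    add_zero]
  have e : b = 1 - a := by linarith
  subst e
  rcases ha.eq_or_lt with h | h
  · rw [← h]; constructor <;> nlinarith [hx.1, hx.2, hy.1, hy.2]
  · constructor <;> nlinarith [hx.1, hx.2, hy.1, hy.2]

theorem NC.cone_up {α η : ℝ} {β β' : ℝ → ℂ} (h : NC α η β β') {w : ℂ}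
    (hw : |(NC.Psi β w).re| < (NC.Psi β w).im) : 0 < w.im ∧ ‖w‖ ≤ 2 * ‖NC.Psi β w‖ := by
  have h1 := near_lower h.Psi_near2 w 0
  rw [h.Psi_zero, sub_zero, sub_zero] at h1
  have h2 := h.lip 0 w.re
  have h3 : ‖NC.Psi β w‖ ≤ |(NC.Psi β w).re| + |(NC.Psi β w).im| := Complex.norm_le_abs_re_add_abs_im _
  have hp : 0 < (NC.Psi β w).im := (abs_nonneg _).trans_lt hw
  rw [abs_of_pos hp] at h3
  have h4 : ‖β w.re - w.re‖ ≤ η * |w.re| := by simpa [h.h0] using h2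
  have h5 := (Complex.abs_im_le_norm _).trans h4
  simp only [sub_im, ofReal_im, sub_zero] at h5
  have h6 : (NC.Psi β w).im = (β w.re).im + w.im := by simp [NC.Psi]
  have h7 : |w.re| ≤ 4 * (NC.Psi β w).im := by
    linarith [Complex.abs_re_le_norm w]
  have h8 := h.e1
  have h9 := h.e0
  have h10 := le_abs_self (β w.re).im
  refine ⟨?_, by linarith⟩
  nlinarith [abs_nonneg w.re]

namespace Dom

theorem uniqueDiff {Ω : Set ℂ} {J : ℕ} {γ : Fin J → ℝ → ℂ} {α : NNReal} (D : Dom Ω γ α) {z₀ : ℂ}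
    {σ τ : Fin J → ℝ} (G : ∀ j, Geo Ω γ α z₀ j (σ j) (τ j)) :
    UniqueDiffOn ℝ (closure Ω) := by
  intro z hz
  by_cases h2 : z ∈ Ω
  · exact (D.o.uniqueDiffWithinAt h2).mono subset_closure
  have h3 : z ∈ frontier Ω := by rw [D.o.frontier_eq]; exact ⟨hz, h2⟩
  rw [D.fr, Set.mem_iUnion] at h3
  obtain ⟨j, a, rfl⟩ := h3
  obtain ⟨η, δ, r, β, β', E, bc, c1, c2, c3⟩ := (G j).chart a
  have hs0 : (σ j : ℂ) ≠ 0 := by rcases (G j).sgn with h | h <;> simp [h]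
  have hδc : (δ : ℂ) ≠ 0 := by exact_mod_cast bc.δ0.ne'
  set d : ℂ := (δ : ℂ) * (σ j * deriv (γ j) a) with hd
  have hd0 : d ≠ 0 := mul_ne_zero hδc (mul_ne_zero hs0 ((D.scc j).reg a))
  have hr := bc.r0
  set C0 : Set ℂ := {w : ℂ | ‖w‖ < r / 2 ∧ |w.re| < w.im} with hC0
  set C : Set ℂ := (fun z => (z - γ j a) / d) ⁻¹' C0 with hC
  have hC0o : IsOpen C0 := by
    have o1 : IsOpen {w : ℂ | ‖w‖ < r / 2} := isOpen_lt (by fun_prop) (by fun_prop)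
    have o2 : IsOpen {w : ℂ | |w.re| < w.im} :=
      isOpen_lt Complex.continuous_re.abs Complex.continuous_im
    exact o1.inter o2
  have hCo : IsOpen C := hC0o.preimage (by fun_prop)
  have hCc : Convex ℝ C := by
    intro x hx y hy s t hs ht hst
    show (s • x + t • y - γ j a) / d ∈ C0
    have := cone_convex (r / 2) hx hy hs ht hst
    have e : (s • x + t • y - γ j a) / d = s • ((x - γ j a) / d) + t • ((y - γ j a) / d) := by
      simp only [real_smul]
      have : (s : ℂ) + t = 1 := by exact_mod_cast hst
      have e2 : γ j a = (s + t) * γ j a := by rw [this, one_mul]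
      nth_rewrite 1 [e2]
      ring
    rw [e]; exact this
  have hmem : ∀ y : ℝ, 0 < y → y < r / 2 → γ j a + d * (y * I) ∈ C := by
    intro y hy hy2
    show (γ j a + d * (y * I) - γ j a) / d ∈ C0
    have e : (γ j a + d * (y * I) - γ j a) / d = y * I := by field_simp; ring
    rw [e]
    refine ⟨?_, ?_⟩
    · rw [norm_mul, norm_I, mul_one, Complex.norm_real, Real.norm_eq_abs, abs_of_pos hy]; exact hy2
    · simpa using hy
  have hsub : C ⊆ closure Ω := by
    intro z hz
    obtain ⟨w, rfl⟩ := E.surjective z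
    have e : (E w - γ j a) / d = NC.Psi β w := by rw [bc.hE]; field_simp; ring
    have hz : (E w - γ j a) / d ∈ C0 := hz
    rw [e] at hz
    obtain ⟨h4, h5⟩ := bc.nc.cone_up hz.2
    have h6 := hz.1
    exact subset_closure (c1 w (by linarith) h4)
  refine (uniqueDiffWithinAt_convex hCc ?_ ?_).mono hsub
  · rw [hCo.interior_eq]
    exact ⟨_, hmem (r / 4) (by linarith) (by linarith)⟩
  · have hc : Continuous fun y : ℝ => γ j a + d * (y * I) := by fun_prop
    have h4 := (hc.tendsto 0).mono_left (nhdsWithin_le_nhds (s := Set.Ioi 0))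
    simp only [ofReal_zero, zero_mul, mul_zero, add_zero] at h4
    refine mem_closure_of_tendsto h4 ?_
    have : ∀ᶠ s in 𝓝[>] (0 : ℝ), s < r / 2 :=
      eventually_nhdsWithin_of_eventually_nhds (eventually_lt_nhds (by linarith))
    filter_upwards [this, self_mem_nhdsWithin] with y hy hy2
    exact hmem y hy2 hy

end Dom

theorem grad_mul_re (u : ℂ → ℝ) (S : Set ℂ) (z v : ℂ) :
    (complexGradWithin u S z * v).re = fderivWithin ℝ u S z v := by
  have : v = v.re • (1 : ℂ) + v.im • I := by
    simp [Complex.re_add_im]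
  nth_rewrite 2 [this]
  rw [map_add, map_smul, map_smul, complexGradWithin]
  simp
  ring

theorem grad_eq_zero_iff (u : ℂ → ℝ) (S : Set ℂ) (z : ℂ) :
    complexGradWithin u S z = 0 ↔ fderivWithin ℝ u S z = 0 := by
  constructor
  · intro h
    ext v
    rw [← grad_mul_re, h]; simp
  · intro h
    simp [complexGradWithin, h]

theorem grad_continuousOn {u : ℂ → ℝ} {K : Set ℂ} (hu : ContDiffOn ℝ 1 u K)
    (hK : UniqueDiffOn ℝ K) : ContinuousOn (complexGradWithin u K) K := by
  have h := hu.continuousOn_fderivWithin hK le_rfl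
  have h1 : ∀ v : ℂ, ContinuousOn (fun z => fderivWithin ℝ u K z v) K := fun v =>
    h.clm_apply continuousOn_const
  unfold complexGradWithin
  have a := Complex.continuous_ofReal.comp_continuousOn (h1 1)
  have b := Complex.continuous_ofReal.comp_continuousOn (h1 I)
  exact a.sub (continuousOn_const.mul b)

theorem grad_interior {u : ℂ → ℝ} {Ω : Set ℂ} (ho : IsOpen Ω) {z : ℂ} (hz : z ∈ Ω) :
    fderivWithin ℝ u (closure Ω) z = fderiv ℝ u z :=
  fderivWithin_of_mem_nhds (Filter.mem_of_superset (ho.mem_nhds hz) subset_closure)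

theorem grad_holo {u : ℂ → ℝ} {Ω : Set ℂ} (ho : IsOpen Ω) (hu : ContDiffOn ℝ 2 u Ω)
    (hharm : ∀ z ∈ Ω, fderiv ℝ (fun w => fderiv ℝ u w 1) z 1 +
        fderiv ℝ (fun w => fderiv ℝ u w Complex.I) z Complex.I = 0) {z : ℂ} (hz : z ∈ Ω) :
    DifferentiableAt ℂ (complexGradWithin u (closure Ω)) z := by
  have hcd : ContDiffAt ℝ 2 u z := hu.contDiffAt (ho.mem_nhds hz)
  have hd : DifferentiableAt ℝ (fderiv ℝ u) z :=
    (hcd.fderiv_right (m := 1) (by norm_num)).differentiableAt (by norm_num)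
  have hsym : IsSymmSndFDerivAt ℝ u z := hcd.isSymmSndFDerivAt (by simp)
  set B := fderiv ℝ (fderiv ℝ u) z with hB
  have hev : ∀ v : ℂ, HasFDerivAt (fun w => fderiv ℝ u w v) (B.flip v) z := fun v => by
    have := hd.hasFDerivAt.clm_apply (hasFDerivAt_const v z)
    refine this.congr_fderiv ?_
    ext y
    simp [hB]
  have hh := hharm z hz
  rw [(hev 1).fderiv, (hev I).fderiv] at hh
  have hg : HasFDerivAt (fun w => (Complex.ofReal (fderiv ℝ u w 1) -
    I * Complex.ofReal (fderiv ℝ u w I) : ℂ))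
    (Complex.ofRealCLM.comp (B.flip 1) - I • Complex.ofRealCLM.comp (B.flip I)) z := by
    have a := Complex.ofRealCLM.hasFDerivAt.comp z (hev 1)
    have b := (Complex.ofRealCLM.hasFDerivAt.comp z (hev I)).const_mul I
    exact a.sub b
  have hg2 : DifferentiableAt ℂ (fun w => (Complex.ofReal (fderiv ℝ u w 1) -
    I * Complex.ofReal (fderiv ℝ u w I) : ℂ)) z := by
    rw [differentiableAt_complex_iff_differentiableAt_real]
    refine ⟨hg.differentiableAt, ?_⟩
    rw [hg.fderiv]
    have s := hsym 1 I
    have hh' : (B 1 1 + B I I : ℝ) = 0 := hh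
    have hh2 : B I I = - B 1 1 := by linarith
    simp [hh2]
    rw [← hB] at s
    rw [s]
    ring_nf
    simp
  refine hg2.congr_of_eventuallyEq ?_
  filter_upwards [ho.mem_nhds hz] with w hw
  rw [complexGradWithin, grad_interior ho hw]

theorem grad_boundary {u : ℂ → ℝ} {K : Set ℂ} (hu : ContDiffOn ℝ 1 u K) {γ : ℝ → ℂ}
    (hγ : ∀ t, HasDerivAt γ (deriv γ t) t) (hK : ∀ t, γ t ∈ K) {a : ℝ} (ha : ∀ t, u (γ t) = a)
    (t : ℝ) : (complexGradWithin u K (γ t) * deriv γ t).re = 0 := by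
  rw [grad_mul_re]
  have h1 : HasFDerivWithinAt u (fderivWithin ℝ u K (γ t)) K (γ t) :=
    ((hu.differentiableOn (by norm_num)) _ (hK t)).hasFDerivWithinAt
  have h2 := h1.comp_hasDerivAt t (hγ t) (Eventually.of_forall hK)
  have h3 : HasDerivAt (u ∘ γ) 0 t := by
    have : u ∘ γ = fun _ => a := funext ha
    rw [this]; exact hasDerivAt_const _ _
  exact h2.unique h3

end


section
open Complex Topology Filter Asymptotics MeasureTheory

namespace Dom

theorem not_loc_zero {Ω : Set ℂ} {J : ℕ} {γ : Fin J → ℝ → ℂ} {α : NNReal} (D : Dom Ω γ α)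
    {g : ℂ → ℂ} (gd : ∀ z ∈ Ω, DifferentiableAt ℂ g z) (gn : ¬ ∀ z ∈ Ω, g z = 0) {z : ℂ}
    (hz : z ∈ Ω) : ¬ ∀ᶠ y in 𝓝 z, g y = 0 := by
  intro h
  have hD : DifferentiableOn ℂ g Ω := fun z hz => (gd z hz).differentiableWithinAt
  have ha : AnalyticOnNhd ℂ g Ω := hD.analyticOnNhd D.o
  have := ha.eqOn_zero_of_preconnected_of_eventuallyEq_zero D.c.isPreconnected hz h
  exact gn fun z hz => this hz

theorem asym_in {Ω : Set ℂ} {J : ℕ} {γ : Fin J → ℝ → ℂ} {α : NNReal} (D : Dom Ω γ α)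
    {g : ℂ → ℂ} (gd : ∀ z ∈ Ω, DifferentiableAt ℂ g z) (gn : ¬ ∀ z ∈ Ω, g z = 0) {z : ℂ}
    (hz : z ∈ Ω) : ∃ (m : ℕ) (c : ℂ), c ≠ 0 ∧ (fun y => g y - c * (y - z) ^ m)
      =o[𝓝[closure Ω] z] (fun y => (y - z) ^ m) := by
  have hD : DifferentiableOn ℂ g Ω := fun z hz => (gd z hz).differentiableWithinAt
  have ha : AnalyticAt ℂ g z := hD.analyticAt (D.o.mem_nhds hz)
  obtain ⟨m, q, hq, hq0, hEq⟩ :=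
    ha.exists_eventuallyEq_pow_smul_nonzero_iff.2 (D.not_loc_zero gd gn hz)
  refine ⟨m, q z, hq0, ?_⟩
  rw [isLittleO_iff_exists_eq_mul]
  refine ⟨fun y => q y - q z, ?_, ?_⟩
  · have := (hq.continuousAt.tendsto).sub_const (q z)
    rw [sub_self] at this
    exact this.mono_left nhdsWithin_le_nhds
  · filter_upwards [eventually_nhdsWithin_of_eventually_nhds hEq] with y hy
    rw [hy]; simp only [smul_eq_mul, Pi.mul_apply]; ring

theorem asym_bd {Ω : Set ℂ} {J : ℕ} {γ : Fin J → ℝ → ℂ} {α : NNReal} (D : Dom Ω γ α) {z₀ : ℂ}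
    {σ τ : Fin J → ℝ} (G : ∀ j, Geo Ω γ α z₀ j (σ j) (τ j))
    {g : ℂ → ℂ} (gd : ∀ z ∈ Ω, DifferentiableAt ℂ g z) (gn : ¬ ∀ z ∈ Ω, g z = 0)
    (gc : ContinuousOn g (closure Ω)) (gb : ∀ j t, (g (γ j t) * deriv (γ j) t).re = 0)
    (j : Fin J) (a : ℝ) : ∃ (m : ℕ) (c : ℂ), c ≠ 0 ∧ (fun y => g y - c * (y - γ j a) ^ m)
      =o[𝓝[closure Ω] (γ j a)] (fun y => (y - γ j a) ^ m) := by
  obtain ⟨η, δ, r, β, β', E, bc, c1, c2, c3⟩ := (G j).chart a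
  have hs0 : (σ j : ℂ) ≠ 0 := by rcases (G j).sgn with h | h <;> simp [h]
  have hδc : (δ : ℂ) ≠ 0 := by exact_mod_cast bc.δ0.ne'
  set d : ℂ := (δ : ℂ) * (σ j * deriv (γ j) a) with hd
  have hreg := (D.scc j).reg a
  have hd0 : d ≠ 0 := mul_ne_zero hδc (mul_ne_zero hs0 hreg)
  have hr := bc.r0
  have hE : ∀ w, E w = γ j a + d * NC.Psi β w := bc.hE
  have hbox : ∀ w : ℂ, |w.re| < r / 2 → 0 ≤ w.im → w.im < r / 2 → ‖w‖ < r := by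
    intro w h1 h2 h3
    refine (Complex.norm_le_abs_re_add_abs_im w).trans_lt ?_
    rw [abs_of_nonneg h2]; linarith
  have hcl : ∀ w : ℂ, ‖w‖ < r → 0 ≤ w.im → E w ∈ closure Ω := by
    intro w h1 h2
    rcases h2.eq_or_lt with h | h
    · exact frontier_subset_closure (c2 w h1 h.symm)
    · exact subset_closure (c1 w h1 h)
  have key := bc.nc.local_thm bc.hη (g := fun ζ => d * g (γ j a + d * ζ)) (R := r / 2)
    (by linarith) ?_ ?_ ?_
  · rcases key with ⟨ρ, hρ, h0⟩ | ⟨m, c, hc, ho⟩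
    · exfalso
      set y : ℝ := min r ρ / 2 with hy
      have hm : 0 < min r ρ := lt_min hr hρ
      have hy0 : 0 < y := by rw [hy]; linarith
      set w : ℂ := (y : ℂ) * I with hw
      have hwn : ‖w‖ < min r ρ := by
        rw [hw, norm_mul, norm_I, mul_one, Complex.norm_real, Real.norm_eq_abs, abs_of_pos hy0]
        linarith
      have hwi : 0 < w.im := by simpa [hw] using hy0
      refine D.not_loc_zero gd gn (c1 w (hwn.trans_le (min_le_left _ _)) hwi) ?_
      have hev : ∀ᶠ v in 𝓝 w, g (E v) = 0 := by
        have e1 : ∀ᶠ v : ℂ in 𝓝 w, ‖v‖ < ρ :=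
          (continuous_norm.tendsto w).eventually
            (eventually_lt_nhds (hwn.trans_le (min_le_right _ _)))
        have e2 : ∀ᶠ v : ℂ in 𝓝 w, 0 < v.im :=
          (Complex.continuous_im.tendsto w).eventually (eventually_gt_nhds hwi)
        filter_upwards [e1, e2] with v h1 h2
        have := h0 v h1 h2.le
        rw [hE]
        exact (mul_eq_zero.1 this).resolve_left hd0
      have ht : Tendsto E.symm (𝓝 (E w)) (𝓝 w) := by
        have := E.symm.continuous.tendsto (E w)
        rwa [E.symm_apply_apply] at this
      filter_upwards [ht.eventually hev] with y hy
      rwa [E.apply_symm_apply] at hy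
    · have ht : Tendsto E.symm (𝓝[closure Ω] (γ j a)) (𝓝[{w | 0 ≤ w.im}] 0) := by
        have h1 : Tendsto E.symm (𝓝[closure Ω] (γ j a)) (𝓝 0) := by
          have := E.symm.continuous.tendsto (γ j a)
          rw [← bc.E_zero, E.symm_apply_apply, bc.E_zero] at this
          exact this.mono_left nhdsWithin_le_nhds
        refine tendsto_nhdsWithin_iff.2 ⟨h1, ?_⟩
        have h2 : ∀ᶠ z in 𝓝[closure Ω] (γ j a), ‖E.symm z‖ < r := by
          have := h1.norm
          rw [norm_zero] at this
          exact this.eventually (eventually_lt_nhds hr)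
        filter_upwards [h2, self_mem_nhdsWithin] with z hz hzK
        by_contra hneg
        have hneg : (E.symm z).im < 0 := not_le.1 hneg
        have := (c3 _ hz hneg).1
        rw [E.apply_symm_apply] at this
        exact this hzK
      have ho2 := ho.comp_tendsto ht
      have hPs : ∀ z, NC.Psi β (E.symm z) = (z - γ j a) / d := by
        intro z
        have := hE (E.symm z)
        rw [E.apply_symm_apply] at this
        rw [eq_div_iff hd0]; linear_combination -this
      refine ⟨m, c / d ^ (m + 1), div_ne_zero hc (pow_ne_zero _ hd0), ?_⟩
      have e1 : ((fun w => d * g (γ j a + d * NC.Psi β w) - c * NC.Psi β w ^ m) ∘ E.symm) =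
          fun y => d * (g y - c / d ^ (m + 1) * (y - γ j a) ^ m) := by
        funext y
        have e3 : γ j a + d * NC.Psi β (E.symm y) = y := by
          rw [← hE, E.apply_symm_apply]
        simp only [Function.comp]
        rw [e3, hPs, div_pow, pow_succ]
        field_simp
      have e2 : ((fun w => NC.Psi β w ^ m) ∘ E.symm) = fun y => (d ^ m)⁻¹ * (y - γ j a) ^ m := by
        funext y
        simp only [Function.comp]
        rw [hPs, div_pow]; field_simp
      rw [e1, e2] at ho2
      rw [isLittleO_const_mul_left_iff hd0] at ho2
      exact (isLittleO_const_mul_right_iff (inv_ne_zero (pow_ne_zero _ hd0))).1 ho2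
  · have e : (fun w => d * g (γ j a + d * NC.Psi β w)) = fun w => d * g (E w) := by
      funext w; rw [hE]
    show ContinuousOn (fun w => d * g (γ j a + d * NC.Psi β w)) _
    rw [e]
    refine continuousOn_const.mul (gc.comp E.continuous.continuousOn ?_)
    rintro w ⟨h1, h2, h3⟩
    exact hcl w (hbox w h1 h2 h3) h2
  · intro w h1 h2 h3
    have hz := c1 w (hbox w h1 h2.le h3) h2
    have h4 := gd _ hz
    rw [hE] at h4
    have h5 : DifferentiableAt ℂ (fun ζ => γ j a + d * ζ) (NC.Psi β w) := by fun_prop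
    exact (DifferentiableAt.comp (g := g) (f := fun ζ => γ j a + d * ζ) (NC.Psi β w) h4 h5).const_mul d
  · intro x hx
    have hx1 : |x| ≤ 1 := by linarith [bc.r1]
    show (d * g (γ j a + d * β x) * β' x).re = 0
    rw [← bc.par x hx1, bc.par' x hx1]
    have e : d * g (γ j (a + σ j * δ * x)) * (deriv (γ j) (a + σ j * δ * x) / deriv (γ j) a) =
      ((δ * σ j : ℝ) : ℂ) * (g (γ j (a + σ j * δ * x)) * deriv (γ j) (a + σ j * δ * x)) := by
      rw [hd]; push_cast; field_simp
    rw [e, Complex.re_ofReal_mul, gb, mul_zero]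

theorem asym {Ω : Set ℂ} {J : ℕ} {γ : Fin J → ℝ → ℂ} {α : NNReal} (D : Dom Ω γ α) {z₀ : ℂ}
    {σ τ : Fin J → ℝ} (G : ∀ j, Geo Ω γ α z₀ j (σ j) (τ j))
    {g : ℂ → ℂ} (gd : ∀ z ∈ Ω, DifferentiableAt ℂ g z) (gn : ¬ ∀ z ∈ Ω, g z = 0)
    (gc : ContinuousOn g (closure Ω)) (gb : ∀ j t, (g (γ j t) * deriv (γ j) t).re = 0)
    {z : ℂ} (hz : z ∈ closure Ω) : ∃ (m : ℕ) (c : ℂ), c ≠ 0 ∧ (fun y => g y - c * (y - z) ^ m)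
      =o[𝓝[closure Ω] z] (fun y => (y - z) ^ m) := by
  by_cases h2 : z ∈ Ω
  · exact D.asym_in gd gn h2
  have h3 : z ∈ frontier Ω := by rw [D.o.frontier_eq]; exact ⟨hz, h2⟩
  rw [D.fr, Set.mem_iUnion] at h3
  obtain ⟨j, a, rfl⟩ := h3
  exact D.asym_bd G gd gn gc gb j a

end Dom

theorem asym_isolated {g : ℂ → ℂ} {K : Set ℂ} {z c : ℂ} {m : ℕ} (hc : c ≠ 0)
    (h : (fun y => g y - c * (y - z) ^ m) =o[𝓝[K] z] (fun y => (y - z) ^ m)) :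
    ∀ᶠ y in 𝓝[K] z, y ≠ z → g y ≠ 0 := by
  have hcp : 0 < ‖c‖ := norm_pos_iff.2 hc
  filter_upwards [h.def (by linarith : 0 < ‖c‖ / 2)] with y hy hne h0
  rw [h0, zero_sub, norm_neg, norm_mul] at hy
  have : 0 < ‖(y - z) ^ m‖ := norm_pos_iff.2 (pow_ne_zero _ (sub_ne_zero.2 hne))
  nlinarith

theorem asym_value {g : ℂ → ℂ} {K : Set ℂ} {z c : ℂ} {m : ℕ} (hz : z ∈ K)
    (h : (fun y => g y - c * (y - z) ^ m) =o[𝓝[K] z] (fun y => (y - z) ^ m)) :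
    g z = c * 0 ^ m := by
  have h1 : ∀ ε : ℝ, 0 < ε → ‖g z - c * 0 ^ m‖ ≤ 0 + ε := by
    intro ε hε
    have := (h.def hε).self_of_nhdsWithin hz
    rw [sub_self] at this
    refine this.trans ?_
    rw [zero_add]
    refine mul_le_of_le_one_right hε.le ?_
    rw [norm_pow, norm_zero]
    exact pow_le_one₀ le_rfl zero_le_one
  exact sub_eq_zero.1 (norm_le_zero_iff.1 (le_of_forall_pos_le_add h1))

theorem zeros_finite {g : ℂ → ℂ} {K : Set ℂ} (hK : IsCompact K)
    (h : ∀ z ∈ K, ∀ᶠ y in 𝓝[K] z, y ≠ z → g y ≠ 0) : {z | z ∈ K ∧ g z = 0}.Finite := by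
  by_contra hinf
  obtain ⟨x, hx, hacc⟩ := Set.Infinite.exists_accPt_of_subset_isCompact hinf hK fun z hz => hz.1
  rw [accPt_iff_frequently] at hacc
  have h1 := h x hx
  rw [eventually_nhdsWithin_iff] at h1
  obtain ⟨y, ⟨hy1, hy2⟩, hy3⟩ := (hacc.and_eventually h1).exists
  exact hy3 hy2.1 hy1 hy2.2

theorem extend_quot {g : ℂ → ℂ} {K : Set ℂ} (hg : ContinuousOn g K) (Z : Finset ℂ) (m : ℂ → ℕ)
    (c : ℂ → ℂ) (hZK : ∀ z ∈ Z, z ∈ K) (hZ : ∀ z ∈ K, g z = 0 → z ∈ Z)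
    (hm : ∀ z ∈ Z, 1 ≤ m z) (hc : ∀ z ∈ Z, c z ≠ 0)
    (ha : ∀ z ∈ Z, (fun y => g y - c z * (y - z) ^ m z) =o[𝓝[K] z] (fun y => (y - z) ^ m z)) :
    ∃ G : ℂ → ℂ, ContinuousOn G K ∧ (∀ z ∈ K, G z ≠ 0) ∧
      ∀ z ∈ K, g z = G z * ∏ k ∈ Z, (z - k) ^ m k := by
  classical
  set G : ℂ → ℂ := fun z => if z ∈ Z then c z / ∏ k ∈ Z.erase z, (z - k) ^ m k else
    g z / ∏ k ∈ Z, (z - k) ^ m k with hG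
  have hP : ∀ z, z ∉ Z → ∏ k ∈ Z, (z - k) ^ m k ≠ 0 := by
    intro z hz
    rw [Finset.prod_ne_zero_iff]
    intro k hk
    refine pow_ne_zero _ (sub_ne_zero.2 ?_)
    rintro rfl; exact hz hk
  have hP2 : ∀ z, ∏ k ∈ Z.erase z, (z - k) ^ m k ≠ 0 := by
    intro z
    rw [Finset.prod_ne_zero_iff]
    intro k hk
    exact pow_ne_zero _ (sub_ne_zero.2 (Finset.ne_of_mem_erase hk).symm)
  refine ⟨G, ?_, ?_, ?_⟩
  · intro z hz
    have hcl : IsClosed ((Z.erase z : Finset ℂ) : Set ℂ) := (Z.erase z).finite_toSet.isClosed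
    have hev : ∀ᶠ y in 𝓝[K] z, y ∉ Z.erase z := by
      refine eventually_nhdsWithin_of_eventually_nhds ?_
      exact hcl.isOpen_compl.mem_nhds (by simp)
    by_cases hzZ : z ∈ Z
    · have hcz : ContinuousWithinAt G (K \ {z}) z := by
        have ho := (ha z hzZ).mono (nhdsWithin_mono z (Set.sdiff_subset (t := {z})))
        obtain ⟨φ, hφ, heq⟩ := isLittleO_iff_exists_eq_mul.1 ho
        have hcont : ContinuousAt (fun y => ∏ k ∈ Z.erase z, (y - k) ^ m k) z :=
          (by fun_prop : Continuous fun y => ∏ k ∈ Z.erase z, (y - k) ^ m k).continuousAt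
        have ht : Tendsto (fun y => (φ y + c z) / ∏ k ∈ Z.erase z, (y - k) ^ m k) (𝓝[K \ {z}] z)
            (𝓝 ((0 + c z) / ∏ k ∈ Z.erase z, (z - k) ^ m k)) :=
          (hφ.add_const _).div (hcont.tendsto.mono_left nhdsWithin_le_nhds) (hP2 z)
        have hGz : G z = (0 + c z) / ∏ k ∈ Z.erase z, (z - k) ^ m k := by
          simp [hG, hzZ]
        rw [ContinuousWithinAt, hGz]
        refine ht.congr' ?_
        filter_upwards [heq, hev.filter_mono (nhdsWithin_mono z (Set.sdiff_subset (t := {z}))),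
          self_mem_nhdsWithin] with y h1 h2 h3
        have hyz : y ≠ z := h3.2
        have hyZ : y ∉ Z := fun h => h2 (Finset.mem_erase.2 ⟨hyz, h⟩)
        have h4 : g y = (φ y + c z) * (y - z) ^ m z := by
          have : g y - c z * (y - z) ^ m z = φ y * (y - z) ^ m z := h1
          linear_combination this
        simp only [hG, if_neg hyZ]
        rw [← Finset.mul_prod_erase Z _ hzZ, h4]
        have h5 : (y - z) ^ m z ≠ 0 := pow_ne_zero _ (sub_ne_zero.2 hyz)
        rw [mul_comm, mul_div_mul_left _ _ h5]
      have := hcz.insert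
      exact this.mono fun y hy => by
        by_cases h : y = z
        · left; exact h
        · right; exact ⟨hy, h⟩
    · have h1 : ContinuousWithinAt (fun y => g y / ∏ k ∈ Z, (y - k) ^ m k) K z := by
        refine (hg z hz).div ?_ (hP z hzZ)
        exact (by fun_prop : Continuous fun y => ∏ k ∈ Z, (y - k) ^ m k).continuousWithinAt
      refine h1.congr_of_eventuallyEq ?_ (by simp only [hG, if_neg hzZ])
      rw [Finset.erase_eq_of_notMem hzZ] at hev
      filter_upwards [hev] with y hy
      simp only [hG, if_neg hy]
  · intro z hz
    by_cases hzZ : z ∈ Z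
    · simp only [hG, if_pos hzZ]
      exact div_ne_zero (hc z hzZ) (hP2 z)
    · simp only [hG, if_neg hzZ]
      exact div_ne_zero (fun h => hzZ (hZ z hz h)) (hP z hzZ)
  · intro z hz
    by_cases hzZ : z ∈ Z
    · have h0 : (0 : ℂ) ^ m z = 0 := zero_pow (by have := hm z hzZ; omega)
      rw [asym_value hz (ha z hzZ), h0, mul_zero, ← Finset.mul_prod_erase Z _ hzZ, sub_self, h0]
      ring
    · simp only [hG, if_neg hzZ]
      have := hP z hzZ
      field_simp

end


section
open Complex Topology Filter Asymptotics MeasureTheory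

namespace IsSCC

/-- factor of `γ t - k` which does not vanish -/
theorem factor {γ : ℝ → ℂ} (h : IsSCC γ) {τ : ℝ} (ws : ∀ a, HasWind (secT γ a) (τ / 2)) {k : ℂ}
    {ν : ℝ} (h1 : k ∉ Set.range γ → ν = nw γ k) (h2 : k ∈ Set.range γ → ν = τ / 2) :
    ∃ (f : ℝ → ℂ) (s : ℝ → ℝ), HasWind f ν ∧ (∀ t, γ t - k = f t * s t) ∧
      (∀ t, ‖f (t + 1)‖ = ‖f t‖) ∧ {t | s t = 0}.Countable := by
  by_cases hk : k ∈ Set.range γ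
  · rw [h2 hk]
    obtain ⟨a, rfl⟩ := hk
    refine ⟨secT γ a, fun t => Real.sin (Real.pi * (t - a)), ws a,
      fun t => (h.secT_mul_sin a t).symm, fun t => by rw [h.secT_add_one_right, norm_neg], ?_⟩
    refine (Set.countable_range (fun n : ℤ => (n : ℝ) + a)).mono ?_
    intro t ht
    obtain ⟨n, hn⟩ := sin_pi_eq_zero.1 ht
    exact ⟨n, by simp only; linarith⟩
  · rw [h1 hk]
    exact ⟨fun t => γ t - k, fun _ => 1, h.hasWind_nw hk, fun t => by simp,
      fun t => by simp only [h.per], by simp⟩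

theorem curve_id {γ : ℝ → ℂ} (h : IsSCC γ) {τ : ℝ} (wd : HasWind (deriv γ) τ)
    (ws : ∀ a, HasWind (secT γ a) (τ / 2)) {g G : ℂ → ℂ} (Z : Finset ℂ) (m : ℂ → ℕ) {w : ℝ}
    (hw : HasWind (fun t => G (γ t)) w)
    (hfac : ∀ t, g (γ t) = G (γ t) * ∏ k ∈ Z, (γ t - k) ^ m k)
    (gb : ∀ t, (g (γ t) * deriv γ t).re = 0) (ν : ℂ → ℝ)
    (h1 : ∀ k, k ∉ Set.range γ → ν k = nw γ k) (h2 : ∀ k, k ∈ Set.range γ → ν k = τ / 2) :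
    τ + w + ∑ k ∈ Z, m k * ν k = 0 := by
  have hf := fun k => h.factor ws (h1 k) (h2 k)
  choose f s f1 f2 f3 f4 using hf
  set F : ℝ → ℂ := fun t => deriv γ t * G (γ t) * ∏ k ∈ Z, f k t ^ m k with hF
  have hFw : HasWind F (τ + w + ∑ k ∈ Z, m k * ν k) :=
    (wd.mul hw).mul (HasWind.prod Z fun k _ => (f1 k).pow (m k))
  have hFc := hFw.continuous
  have hFe : ∀ t, g (γ t) * deriv γ t = ((∏ k ∈ Z, s k t ^ m k : ℝ) : ℂ) * F t := by
    intro t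
    rw [hfac t]
    simp only [f2, mul_pow, Finset.prod_mul_distrib, hF]
    push_cast; ring
  have hcount : {t | ∃ k ∈ Z, s k t = 0}.Countable := by
    have : {t | ∃ k ∈ Z, s k t = 0} = ⋃ k ∈ Z, {t | s k t = 0} := by ext t; simp
    rw [this]
    exact Set.Countable.biUnion Z.countable_toSet fun k _ => f4 k
  have hre0 : ∀ t ∈ {t | ∃ k ∈ Z, s k t = 0}ᶜ, (F t).re = 0 := by
    intro t ht
    have hP : ∏ k ∈ Z, s k t ^ m k ≠ 0 :=
      Finset.prod_ne_zero_iff.2 fun k hk => pow_ne_zero _ fun h0 => ht ⟨k, hk, h0⟩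
    have := gb t
    rw [hFe, Complex.re_ofReal_mul] at this
    exact (mul_eq_zero.1 this).resolve_left hP
  have hre : ∀ t, (F t).re = 0 := by
    have hd : Dense {t | ∃ k ∈ Z, s k t = 0}ᶜ := hcount.dense_compl ℝ
    have := Continuous.ext_on hd (Complex.continuous_re.comp hFc)
      (continuous_const (y := (0 : ℝ))) (fun t ht => hre0 t ht)
    exact fun t => congrFun this t
  have hFI : ∀ t, F t = I * ((F t).im : ℂ) := by
    intro t
    apply Complex.ext <;> simp [hre t]
  have habs : ∀ t, |(F t).im| = ‖F t‖ := by
    intro t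
    conv_rhs => rw [hFI t]
    simp
  have hp := hasWind_real (p := fun t => (F t).im) (Complex.continuous_im.comp hFc)
    (fun t h0 => hFw.ne_zero t (by rw [hFI t, h0]; simp)) (fun t => by
      rw [habs, habs]
      simp only [hF, norm_mul, norm_prod, norm_pow, f3, h.per, h.perDeriv])
  have hq := (hasWind_const I_ne_zero).mul hp
  have e : (fun t => I * (((F t).im : ℝ) : ℂ)) = F := by
    funext t; exact (hFI t).symm
  rw [e, add_zero] at hq
  exact hFw.unique hq

end IsSCC

end


section
open Complex Topology Filter Asymptotics MeasureTheory

namespace Dom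

/-- the counting identity for the factorised gradient -/
theorem count {Ω : Set ℂ} {J : ℕ} {γ : Fin J → ℝ → ℂ} {α : NNReal} (D : Dom Ω γ α) {z₀ : ℂ}
    (hz₀ : z₀ ∈ Ω) {σ τ : Fin J → ℝ} (Ge : ∀ j, Geo Ω γ α z₀ j (σ j) (τ j)) {g G : ℂ → ℂ}
    (gb : ∀ j t, (g (γ j t) * deriv (γ j) t).re = 0) (Z : Finset ℂ) (m : ℂ → ℕ)
    (hG : ContinuousOn G (closure Ω)) (hG0 : ∀ z ∈ closure Ω, G z ≠ 0)
    (hfac : ∀ z ∈ closure Ω, g z = G z * ∏ k ∈ Z, (z - k) ^ m k)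
    (κ : ℂ → ℝ) (hκ1 : ∀ z ∈ Z, z ∈ Ω → κ z = 1) (hκ2 : ∀ z ∈ Z, z ∉ Ω → κ z = 1 / 2)
    (hZ : ∀ z ∈ Z, z ∈ closure Ω) :
    ∑ z ∈ Z, m z * κ z = J - 2 := by
  classical
  have hcl : ∀ j t, γ j t ∈ closure Ω := fun j t => frontier_subset_closure (D.frontier_curve j t)
  have hK : IsCompact (closure Ω) := D.b.isCompact_closure
  have hw : ∀ j, ∃ w, HasWind (fun t => G (γ j t)) w := fun j =>
    exists_hasWind (hG.comp_continuous (D.scc j).continuous (hcl j)) (fun t => hG0 _ (hcl j t))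
      (fun t => by rw [(D.scc j).per])
  choose w hw using hw
  set ν : Fin J → ℂ → ℝ := fun j k => if k ∈ Set.range (γ j) then τ j / 2 else nw (γ j) k with hν
  have hid : ∀ j, τ j + w j + ∑ k ∈ Z, m k * ν j k = 0 := fun j =>
    (D.scc j).curve_id (Ge j).wd (Ge j).ws Z m (hw j) (fun t => hfac _ (hcl j t)) (gb j) (ν j)
      (fun k hk => if_neg hk) (fun k hk => if_pos hk)
  have hs := sum_wind_zero D.scc hK hcl σ (D.total hz₀ Ge).2 hG hG0 w hw
  have ht := D.sum_tau hz₀ Ge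
  have h1 := (D.total hz₀ Ge).1
  have hκ : ∀ k ∈ Z, ∑ j, σ j * ν j k = κ k := by
    intro k hk
    by_cases hkΩ : k ∈ Ω
    · rw [hκ1 k hk hkΩ, ← h1]
      refine Finset.sum_congr rfl fun j _ => ?_
      rw [hν]
      simp only [if_neg (D.not_mem j (D.mem_not_frontier hkΩ)), D.nw_const j hkΩ hz₀]
    · rw [hκ2 k hk hkΩ]
      have hkf : k ∈ frontier Ω := by rw [D.o.frontier_eq]; exact ⟨hZ k hk, hkΩ⟩
      rw [D.fr, Set.mem_iUnion] at hkf
      obtain ⟨i, t, rfl⟩ := hkf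
      have e : ∀ j, σ j * ν j (γ i t) = σ j * nw (γ j) z₀ - if j = i then 1 / 2 else 0 := by
        intro j
        by_cases hj : j = i
        · subst hj
          simp only [hν, Set.mem_range_self, if_true]
          rw [(Ge j).n]
          rcases (Ge j).sgn with h | h <;> rw [h] <;> ring
        · have hn : γ i t ∉ Set.range (γ j) := by
            rintro ⟨s, hs⟩
            exact D.dis j i hj s t hs
          simp only [hν, if_neg hn, if_neg hj, D.nw_bd hj t hz₀, sub_zero]
      simp only [e, Finset.sum_sub_distrib, h1, Finset.sum_ite_eq', Finset.mem_univ, if_true]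
      norm_num
  have hfin : ∑ j, σ j * (τ j + w j + ∑ k ∈ Z, m k * ν j k) = 0 :=
    Finset.sum_eq_zero fun j _ => by rw [hid j, mul_zero]
  simp only [mul_add, Finset.sum_add_distrib, ht, hs] at hfin
  have hsw : ∑ j, σ j * ∑ k ∈ Z, m k * ν j k = ∑ k ∈ Z, m k * κ k := by
    simp only [Finset.mul_sum]
    rw [Finset.sum_comm]
    refine Finset.sum_congr rfl fun k hk => ?_
    rw [← hκ k hk, Finset.mul_sum]
    exact Finset.sum_congr rfl fun j _ => by ring
  rw [hsw] at hfin
  linarith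

theorem grad_ne {Ω : Set ℂ} {J : ℕ} {γ : Fin J → ℝ → ℂ} {α : NNReal} (D : Dom Ω γ α) {u : ℂ → ℝ}
    (hu1 : ContDiffOn ℝ 1 u (closure Ω)) {a : Fin J → ℝ} (hbc : ∀ j t, u (γ j t) = a j)
    (hne : ¬ ∀ j k, a j = a k) : ¬ ∀ z ∈ Ω, complexGradWithin u (closure Ω) z = 0 := by
  intro h
  have hd : DifferentiableOn ℝ u Ω := (hu1.differentiableOn (by norm_num)).mono subset_closure
  have hf : Ω.EqOn (fderiv ℝ u) 0 := by
    intro z hz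
    rw [← grad_interior D.o hz]
    exact (grad_eq_zero_iff _ _ _).1 (h z hz)
  obtain ⟨c, hc⟩ := D.o.exists_is_const_of_fderiv_eq_zero D.c.isPreconnected hd hf
  have hcl : ∀ z ∈ closure Ω, u z = c := by
    have : Set.EqOn u (fun _ => c) (closure Ω) :=
      Set.EqOn.of_subset_closure (s := Ω) (fun z hz => hc z hz) hu1.continuousOn
        continuousOn_const subset_closure subset_rfl
    exact this
  refine hne fun j k => ?_
  rw [← hbc j 0, ← hbc k 0, hcl _ (frontier_subset_closure (D.frontier_curve j 0)),
    hcl _ (frontier_subset_closure (D.frontier_curve k 0))]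

end Dom

end

/-- **Alessandrini–Magnanini counting identity.** Let `Ω ⊂ ℂ` be a bounded domain whose
boundary consists of `J` pairwise disjoint simple closed curves `Γ_j` of class `C^{1,α}`,
and let `u ∈ C¹(closure Ω) ∩ C²(Ω)` be harmonic in `Ω` with `u ≡ a_j` on `Γ_j`, the `a_j`
not all equal.  Then `u` has finitely many critical points `z_k` in the closure of `Ω`;
at each of them `uₓ - i·u_y = c·(z-z_k)^{m(z_k)} + o(|z-z_k|^{m(z_k)})` with `c ≠ 0`,
`m(z_k) ≥ 1`; and `Σ_{z_k ∈ Ω} m(z_k) + (1/2)·Σ_{z_k ∈ Γ} m(z_k) = J - 2`. -/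
theorem harmonic_capacitor_critical_point_identity
    (Ω : Set ℂ) (hΩo : IsOpen Ω) (hΩc : IsConnected Ω) (hΩb : Bornology.IsBounded Ω)
    (J : ℕ) (hJ : 0 < J)
    (α : NNReal) (hα0 : 0 < α) (hα1 : α < 1)
    -- the boundary components are disjoint simple closed curves of class `C^{1,α}`
    (γ : Fin J → ℝ → ℂ)
    (hper : ∀ j, Function.Periodic (γ j) 1)
    (hC1 : ∀ j, ContDiff ℝ 1 (γ j))
    (hHol : ∀ j, ∃ C : NNReal, HolderWith C α (deriv (γ j)))
    (hinj : ∀ j, Set.InjOn (γ j) (Set.Ico (0 : ℝ) 1))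
    (hregn : ∀ j s, deriv (γ j) s ≠ 0)
    (Γ : Fin J → Set ℂ) (hΓ : ∀ j, Γ j = Set.range (γ j))
    (hdisj : ∀ j k, j ≠ k → Disjoint (Γ j) (Γ k))
    (hfront : frontier Ω = ⋃ j, Γ j)
    -- `u ∈ C¹(closure Ω) ∩ C²(Ω)` is harmonic in `Ω`
    (u : ℂ → ℝ)
    (hu1 : ContDiffOn ℝ 1 u (closure Ω))
    (hu2 : ContDiffOn ℝ 2 u Ω)
    (hharm : ∀ z ∈ Ω,
      fderiv ℝ (fun w => fderiv ℝ u w 1) z 1 +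
        fderiv ℝ (fun w => fderiv ℝ u w Complex.I) z Complex.I = 0)
    -- Dirichlet boundary conditions, not all equal
    (a : Fin J → ℝ)
    (hbc : ∀ j, ∀ z ∈ Γ j, u z = a j)
    (hne : ¬ ∀ j k, a j = a k) :
    ∃ (Sin Sbd : Finset ℂ) (m : ℂ → ℕ) (c : ℂ → ℂ),
      (∀ z : ℂ, z ∈ Sin ↔ (z ∈ Ω ∧ fderivWithin ℝ u (closure Ω) z = 0)) ∧
      (∀ z : ℂ, z ∈ Sbd ↔ (z ∈ frontier Ω ∧ fderivWithin ℝ u (closure Ω) z = 0)) ∧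
      (∀ z₀ ∈ Sin ∪ Sbd, 1 ≤ m z₀ ∧ c z₀ ≠ 0 ∧
        (fun z => complexGradWithin u (closure Ω) z - c z₀ * (z - z₀) ^ m z₀)
          =o[𝓝[closure Ω] z₀] (fun z => (z - z₀) ^ m z₀)) ∧
      ((∑ z ∈ Sin, (m z : ℝ)) + (1 / 2) * ∑ z ∈ Sbd, (m z : ℝ) = (J : ℝ) - 2) := by
  classical
  have D : Dom Ω γ α :=
    { o := hΩo
      c := hΩc
      b := hΩb
      a0 := hα0
      a1 := hα1
      scc := fun j => ⟨hper j, hC1 j, hinj j, hregn j⟩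
      hol := hHol
      dis := by
        intro j k hjk s t hst
        have := hdisj j k hjk
        rw [hΓ, hΓ] at this
        exact Set.disjoint_left.1 this ⟨s, rfl⟩ ⟨t, hst.symm⟩
      fr := by rw [hfront]; simp only [hΓ] }
  have hbc' : ∀ j t, u (γ j t) = a j := fun j t => hbc j _ (by rw [hΓ]; exact ⟨t, rfl⟩)
  obtain ⟨z₀, hz₀⟩ := hΩc.nonempty
  obtain ⟨σ, τ, Ge⟩ := D.exists_geo hz₀
  set g : ℂ → ℂ := complexGradWithin u (closure Ω) with hg
  have hcl : ∀ j t, γ j t ∈ closure Ω := fun j t => frontier_subset_closure (D.frontier_curve j t)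
  have gn : ¬ ∀ z ∈ Ω, g z = 0 := D.grad_ne hu1 hbc' hne
  have gd : ∀ z ∈ Ω, DifferentiableAt ℂ g z := fun z hz => grad_holo hΩo hu2 hharm hz
  have gc : ContinuousOn g (closure Ω) := grad_continuousOn hu1 (D.uniqueDiff Ge)
  have gb : ∀ j t, (g (γ j t) * deriv (γ j) t).re = 0 := fun j t =>
    grad_boundary hu1 (D.scc j).hasDerivAt (hcl j) (hbc' j) t
  have has : ∀ z, ∃ (m : ℕ) (c : ℂ), z ∈ closure Ω → c ≠ 0 ∧
      (fun y => g y - c * (y - z) ^ m) =o[𝓝[closure Ω] z] (fun y => (y - z) ^ m) := by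
    intro z
    by_cases hz : z ∈ closure Ω
    · obtain ⟨m, c, h⟩ := D.asym Ge gd gn gc gb hz
      exact ⟨m, c, fun _ => h⟩
    · exact ⟨0, 0, fun h => absurd h hz⟩
  choose m c hmc using has
  have hfin : {z | z ∈ closure Ω ∧ g z = 0}.Finite :=
    zeros_finite hΩb.isCompact_closure fun z hz => asym_isolated (hmc z hz).1 (hmc z hz).2
  set Z : Finset ℂ := hfin.toFinset with hZdef
  have hZ : ∀ z, z ∈ Z ↔ z ∈ closure Ω ∧ g z = 0 := fun z => by
    rw [hZdef, Set.Finite.mem_toFinset]; rfl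
  have hm : ∀ z ∈ Z, 1 ≤ m z := by
    intro z hz
    obtain ⟨h1, h2⟩ := (hZ z).1 hz
    have h3 := asym_value h1 (hmc z h1).2
    by_contra h4
    have h5 : m z = 0 := by omega
    rw [h2, h5, pow_zero, mul_one] at h3
    exact (hmc z h1).1 h3.symm
  obtain ⟨G, hGc, hG0, hfac⟩ := extend_quot gc Z m c (fun z hz => ((hZ z).1 hz).1)
    (fun z h1 h2 => (hZ z).2 ⟨h1, h2⟩) hm (fun z hz => (hmc z ((hZ z).1 hz).1).1)
    (fun z hz => (hmc z ((hZ z).1 hz).1).2)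
  have hcount := D.count hz₀ Ge gb Z m hGc hG0 hfac (fun z => if z ∈ Ω then 1 else 1 / 2)
    (fun z _ h => if_pos h) (fun z _ h => if_neg h) (fun z hz => ((hZ z).1 hz).1)
  have hfrm : ∀ z ∈ Z, z ∉ Ω ↔ z ∈ frontier Ω := by
    intro z hz
    rw [hΩo.frontier_eq]
    exact ⟨fun h => ⟨((hZ z).1 hz).1, h⟩, fun h => h.2⟩
  refine ⟨Z.filter (· ∈ Ω), Z.filter (· ∉ Ω), m, c, ?_, ?_, ?_, ?_⟩
  · intro z
    rw [Finset.mem_filter, hZ, ← grad_eq_zero_iff]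
    exact ⟨fun h => ⟨h.2, h.1.2⟩, fun h => ⟨⟨subset_closure h.1, h.2⟩, h.1⟩⟩
  · intro z
    rw [Finset.mem_filter, hZ, ← grad_eq_zero_iff, hΩo.frontier_eq]
    exact ⟨fun h => ⟨⟨h.1.1, h.2⟩, h.1.2⟩, fun h => ⟨⟨h.1.1, h.2⟩, h.1.2⟩⟩
  · intro z hz
    have hzZ : z ∈ Z := by
      rcases Finset.mem_union.1 hz with h | h <;> exact (Finset.mem_filter.1 h).1
    exact ⟨hm z hzZ, hmc z ((hZ z).1 hzZ).1⟩
  · rw [← hcount, ← Finset.sum_filter_add_sum_filter_not Z (· ∈ Ω)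
      (fun z => (m z : ℝ) * if z ∈ Ω then 1 else 1 / 2), Finset.mul_sum]
    congr 1
    · refine Finset.sum_congr rfl fun z hz => ?_
      rw [if_pos (Finset.mem_filter.1 hz).2, mul_one]
    · refine Finset.sum_congr rfl fun z hz => ?_
      rw [if_neg (Finset.mem_filter.1 hz).2, mul_comm]
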